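/- There exists a universal constant C > 0 such that for every weighted graph G = (V,E,w) on n vertices and every parameter 0 < ρ < 1, there exists a spanning tree T of G with lightness Ψ(T) ≤ 1 + ρ and scaling distortion γ, where γ(ε) = (C/ρ) · ε^{-1/2} · (1 + log(2/ε))². -/

import Mathlib

open Finset

attribute [local instance] Classical.propDecidable

section Defs

variable {V : Type*} [Fintype V]

/-- Total weight of a (sub)graph: the sum of its edge weights. -/
noncomputable def wWeight (H : SimpleGraph V) (w : Sym2 V → ℝ) : ℝ :=
  ∑ e ∈ H.edgeSet.toFinite.toFinset, w e

/-- Shortest-path distance in a weighted graph: infimum of walk weights. -/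
noncomputable def wdist (G : SimpleGraph V) (w : Sym2 V → ℝ) (u v : V) : ℝ :=
  sInf {x : ℝ | ∃ p : G.Walk u v, x = (p.edges.map w).sum}

/-- `T` is a spanning tree of `G`. -/
def IsSpanningTree (G T : SimpleGraph V) : Prop :=
  T ≤ G ∧ T.IsTree

/-- Weight of a minimum spanning tree of `G`. -/
noncomputable def mstWeight (G : SimpleGraph V) (w : Sym2 V → ℝ) : ℝ :=
  sInf {x : ℝ | ∃ T : SimpleGraph V, IsSpanningTree G T ∧ x = wWeight T w}

/-- `T` is a minimum spanning tree of `G`. -/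
def IsMST (G : SimpleGraph V) (w : Sym2 V → ℝ) (T : SimpleGraph V) : Prop :=
  IsSpanningTree G T ∧ ∀ T' : SimpleGraph V, IsSpanningTree G T' → wWeight T w ≤ wWeight T' w

/-- A spanner of `G`: a connected spanning subgraph. -/
def IsSpanner (G H : SimpleGraph V) : Prop := H ≤ G ∧ H.Connected

/-- `G` together with `w` is a weighted graph: connected, positive pairwise-distinct
edge weights. -/
def IsWeightedGraph (G : SimpleGraph V) (w : Sym2 V → ℝ) : Prop :=
  G.Connected ∧ (∀ e ∈ G.edgeSet, 0 < w e) ∧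
    (∀ e ∈ G.edgeSet, ∀ e' ∈ G.edgeSet, e ≠ e' → w e ≠ w e')

/-- The ordered pairs of distinct vertices whose distortion in `H` is at most `t`. -/
noncomputable def goodPairs (G H : SimpleGraph V) (w : Sym2 V → ℝ) (t : ℝ) : Finset (V × V) :=
  Finset.univ.offDiag.filter (fun p => wdist H w p.1 p.2 ≤ t * wdist G w p.1 p.2)

/-- Scaling distortion `γ`: for every `ε ∈ (0,1)`, at least a `(1-ε)` fraction of the
pairs of distinct vertices have distortion at most `γ ε`.  (Counted over ordered pairs:
`n·(n-1) = 2·(n choose 2)`.) -/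
def HasScalingDistortion (G H : SimpleGraph V) (w : Sym2 V → ℝ) (γ : ℝ → ℝ) : Prop :=
  ∀ ε : ℝ, 0 < ε → ε < 1 →
    (1 - ε) * ((Fintype.card V : ℝ) * ((Fintype.card V : ℝ) - 1)) ≤
      ((goodPairs G H w (γ ε)).card : ℝ)

/-- The `ℓ_q`-distortion of the spanner `H` of `G`. -/
noncomputable def distq (G H : SimpleGraph V) (w : Sym2 V → ℝ) (q : ℝ) : ℝ :=
  ((∑ p ∈ (Finset.univ : Finset V).offDiag, (wdist H w p.1 p.2 / wdist G w p.1 p.2) ^ q) /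
    ((Fintype.card V : ℝ) * ((Fintype.card V : ℝ) - 1))) ^ (1 / q)

/-- `R(v,ε)`: the minimal radius `r` such that the ball `B(v,r)` contains at least `εn`
vertices. -/
noncomputable def Rgraph (G : SimpleGraph V) (w : Sym2 V → ℝ) (v : V) (ε : ℝ) : ℝ :=
  sInf {r : ℝ | 0 ≤ r ∧
    ε * (Fintype.card V : ℝ) ≤ ((Finset.univ.filter (fun u => wdist G w u v ≤ r)).card : ℝ)}

/-- Coarse scaling distortion `γ`: every pair of distinct vertices that are mutually
`ε/2`-far has distortion at most `γ ε`. -/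
def HasCoarseScalingDistortion (G H : SimpleGraph V) (w : Sym2 V → ℝ) (γ : ℝ → ℝ) : Prop :=
  ∀ ε : ℝ, 0 < ε → ε < 1 → ∀ u v : V, u ≠ v →
    Rgraph G w v (ε / 2) ≤ wdist G w u v → Rgraph G w u (ε / 2) ≤ wdist G w u v →
    wdist H w u v ≤ γ ε * wdist G w u v

end Defs

/-- A real-valued pseudo-distance on a type. -/
structure IsPDist {V : Type*} (d : V → V → ℝ) : Prop where
  nonneg : ∀ u v, 0 ≤ d u v
  self : ∀ u, d u u = 0
  symm : ∀ u v, d u v = d v u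
  tri : ∀ u v x, d u x ≤ d u v + d v x

/-- `δ` is a pseudo-distance dominated by the line distance of `f`, and by `d` on the pairs
of `P`. -/
structure Dominated {V : Type*} (d : V → V → ℝ) (f : V → ℝ) (P : Finset (V × V))
    (δ : V → V → ℝ) : Prop where
  pdist : IsPDist δ
  le_line : ∀ u v, δ u v ≤ |f u - f v|
  le_on : ∀ a ∈ P, δ a.1 a.2 ≤ d a.1 a.2

theorem Dominated.mono {V : Type*} {d : V → V → ℝ} {f : V → ℝ} {P Q : Finset (V × V)}
    {δ : V → V → ℝ} (h : Dominated d f Q δ) (hPQ : P ⊆ Q) : Dominated d f P δ :=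
  ⟨h.pdist, h.le_line, fun a ha => h.le_on a (hPQ ha)⟩

theorem sum_biUnion_le {ι α : Type*} [DecidableEq α] (s : Finset ι) (P : ι → Finset α)
    (c : α → ℝ) (hc : ∀ a, 0 ≤ c a) :
    ∑ a ∈ s.biUnion P, c a ≤ ∑ i ∈ s, ∑ a ∈ P i, c a := by
  induction s using Finset.induction_on with
  | empty => simp
  | insert i s hi ih =>
    rw [Finset.biUnion_insert, Finset.sum_insert hi]
    have := Finset.sum_union_inter (s₁ := P i) (s₂ := s.biUnion P) (f := c)
    have h2 : 0 ≤ ∑ a ∈ P i ∩ s.biUnion P, c a := Finset.sum_nonneg fun a _ => hc a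
    linarith

/-- An arbitrary union of subsets of a finite type costs at most any common bound for the
finite partial sums of the individual costs. -/
theorem exists_union_cost_le {ι α : Type*} [Fintype α] (P : ι → Finset α)
    (c : α → ℝ) (hc : ∀ a, 0 ≤ c a) (B : ℝ)
    (hB : ∀ s : Finset ι, ∑ i ∈ s, ∑ a ∈ P i, c a ≤ B) :
    ∃ Q : Finset α, (∀ i, P i ⊆ Q) ∧ ∑ a ∈ Q, c a ≤ B := by
  refine ⟨univ.filter fun a => ∃ i, a ∈ P i, fun i a ha => by simp; exact ⟨i, ha⟩, ?_⟩
  set Q := univ.filter fun a => ∃ i, a ∈ P i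
  have : ∀ a : Q, ∃ i, a.1 ∈ P i := fun a => (Finset.mem_filter.1 a.2).2
  choose g hg using this
  refine le_trans ?_ (hB (Q.attach.image g))
  refine le_trans ?_ (sum_biUnion_le _ P c hc)
  refine Finset.sum_le_sum_of_subset_of_nonneg ?_ fun a _ _ => hc a
  intro a ha
  rw [Finset.mem_biUnion]
  exact ⟨g ⟨a, ha⟩, Finset.mem_image_of_mem _ (Finset.mem_attach _ _), hg ⟨a, ha⟩⟩

/-- Greedy choice: processing the elements by increasing weight gives an independent set such
that each element conflicts with a chosen element of no larger weight. -/
theorem exists_greedy {V : Type*} (A : Finset V) (d : V → ℝ) (J : V → V → Prop)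
    (hr : ∀ v, J v v) :
    ∃ B ⊆ A, (∀ a ∈ B, ∀ b ∈ B, a ≠ b → ¬ (J a b ∧ J b a)) ∧
      ∀ v ∈ A, ∃ b ∈ B, J v b ∧ d b ≤ d v := by
  refine Finset.induction_on_max_value d A ?_ ?_
  · exact ⟨∅, by simp, by simp, by simp⟩
  · intro a s ha hmax ih
    obtain ⟨B, hBs, hind, hcov⟩ := ih
    by_cases hc : ∃ b ∈ B, J a b
    · obtain ⟨b, hb, hab⟩ := hc
      refine ⟨B, hBs.trans (Finset.subset_insert _ _), hind, ?_⟩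
      intro v hv
      rcases Finset.mem_insert.1 hv with rfl | hv
      · exact ⟨b, hb, hab, hmax b (hBs hb)⟩
      · exact hcov v hv
    · refine ⟨insert a B, Finset.insert_subset_insert _ hBs, ?_, ?_⟩
      · intro x hx y hy hxy h
        rcases Finset.mem_insert.1 hx with rfl | hx' <;>
          rcases Finset.mem_insert.1 hy with rfl | hy'
        · exact hxy rfl
        · exact hc ⟨y, hy', h.1⟩
        · exact hc ⟨x, hx', h.2⟩
        · exact hind x hx' y hy' hxy h
      · intro v hv
        rcases Finset.mem_insert.1 hv with rfl | hv
        · exact ⟨v, Finset.mem_insert_self _ _, hr v, le_rfl⟩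
        · obtain ⟨b, hb, h⟩ := hcov v hv
          exact ⟨b, Finset.mem_insert_of_mem hb, h⟩

section
variable {V : Type*} [Fintype V]

/-- The closed ball of a pseudo-distance, as a finset. -/
noncomputable def pball (d : V → V → ℝ) (u : V) (D : ℝ) : Finset V :=
  univ.filter fun v => d u v ≤ D

theorem mem_pball {d : V → V → ℝ} {u v : V} {D : ℝ} : v ∈ pball d u D ↔ d u v ≤ D := by
  simp [pball]

theorem pball_mono {d : V → V → ℝ} {u : V} {D D' : ℝ} (h : D ≤ D') :
    pball d u D ⊆ pball d u D' := fun _ hv => mem_pball.2 ((mem_pball.1 hv).trans h)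

/-- A `θ`-net: few points, within twice the radius of every ball of `θ n` points. -/
theorem exists_net [Nonempty V] {d : V → V → ℝ} (hd : IsPDist d) {θ : ℝ} (h0 : 0 < θ)
    (h1 : θ ≤ 1) :
    ∃ N : Finset V, N.Nonempty ∧ (N.card : ℝ) * θ ≤ 1 ∧
      ∀ u D, θ * Fintype.card V ≤ ((pball d u D).card : ℝ) → ∃ p ∈ N, d u p ≤ 2 * D := by
  have hn : (0 : ℝ) < Fintype.card V := by exact_mod_cast Fintype.card_pos
  -- minimal radius
  have hR : ∀ u, ∃ v, θ * Fintype.card V ≤ ((pball d u (d u v)).card : ℝ) ∧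
      ∀ x, θ * Fintype.card V ≤ ((pball d u (d u x)).card : ℝ) → d u v ≤ d u x := by
    intro u
    have hne : (univ.filter fun v =>
        θ * Fintype.card V ≤ ((pball d u (d u v)).card : ℝ)).Nonempty := by
      obtain ⟨v, -, hv⟩ := Finset.exists_max_image univ (fun v => d u v) univ_nonempty
      refine ⟨v, ?_⟩
      have : pball d u (d u v) = univ := by
        ext x; simp [mem_pball]; exact hv x (mem_univ _)
      simp only [mem_filter, mem_univ, true_and, this, Finset.card_univ]
      nlinarith
    obtain ⟨v, hv, hm⟩ := Finset.exists_min_image _ (fun v => d u v) hne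
    refine ⟨v, (mem_filter.1 hv).2, fun x hx => hm x ?_⟩
    simpa using hx
  choose r hr hrmin using hR
  obtain ⟨N, -, hind, hcov⟩ := exists_greedy (univ : Finset V) (fun u => d u (r u))
    (fun u v => d u v ≤ d u (r u) + d v (r v))
    (fun v => by rw [hd.self]; linarith [hd.nonneg v (r v)])
  refine ⟨N, ?_, ?_, ?_⟩
  · obtain ⟨b, hb, -⟩ := hcov (Classical.arbitrary V) (mem_univ _)
    exact ⟨b, hb⟩
  · have hdisj : ∀ a ∈ N, ∀ b ∈ N, a ≠ b →
        Disjoint (pball d a (d a (r a))) (pball d b (d b (r b))) := by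
      intro a ha b hb hab
      rw [Finset.disjoint_left]
      intro x hxa hxb
      refine hind a ha b hb hab ?_
      have := hd.tri a x b
      have e := hd.symm x b
      have e2 := hd.symm a b
      rw [mem_pball] at hxa hxb
      constructor <;> linarith
    have hcard := Finset.card_biUnion hdisj
    have hle : (∑ a ∈ N, (pball d a (d a (r a))).card) ≤ Fintype.card V := by
      rw [← hcard]; exact Finset.card_le_univ _
    have : (N.card : ℝ) * (θ * Fintype.card V) ≤ Fintype.card V := by
      calc (N.card : ℝ) * (θ * Fintype.card V) = ∑ a ∈ N, θ * Fintype.card V := by simp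
        _ ≤ ∑ a ∈ N, ((pball d a (d a (r a))).card : ℝ) := Finset.sum_le_sum fun a _ => hr a
        _ ≤ _ := by exact_mod_cast hle
    have h : (N.card : ℝ) * θ * Fintype.card V ≤ 1 * Fintype.card V := by linarith
    exact le_of_mul_le_mul_right h hn
  · intro u D hD
    obtain ⟨p, hp, h1, h2⟩ := hcov u (mem_univ _)
    refine ⟨p, hp, ?_⟩
    -- `D` dominates the minimal radius
    have hne : (pball d u D).Nonempty := by
      rw [← Finset.card_pos]
      have : (0 : ℝ) < (pball d u D).card := lt_of_lt_of_le (by positivity) hD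
      exact_mod_cast this
    obtain ⟨v, hv, hm⟩ := Finset.exists_max_image (pball d u D) (fun v => d u v) hne
    have hsub : pball d u D ⊆ pball d u (d u v) := fun x hx => mem_pball.2 (hm x hx)
    have := hrmin u v (hD.trans (by exact_mod_cast Finset.card_le_card hsub))
    rw [mem_pball] at hv
    linarith

end

/-- Non-overlapping intervals inside `[lo, hi]` have total length at most `hi - lo`. -/
theorem sum_length_le {ι : Type*} (B : Finset ι) (x l : ι → ℝ) (lo : ℝ)
    (hl : ∀ b ∈ B, 0 ≤ l b) (hlo : ∀ b ∈ B, lo ≤ x b)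
    (hdis : ∀ a ∈ B, ∀ b ∈ B, a ≠ b → x a + l a ≤ x b ∨ x b + l b ≤ x a) :
    ∀ hi, lo ≤ hi → (∀ b ∈ B, x b + l b ≤ hi) → ∑ b ∈ B, l b ≤ hi - lo := by
  revert hl hlo hdis
  refine Finset.induction_on_max_value x B ?_ ?_
  · intro _ _ _ hi h _
    simpa using h
  · intro a s ha hmax ih hl hlo hdis hi hlh hhi
    rw [Finset.sum_insert ha]
    have m : ∀ b ∈ s, b ∈ insert a s := fun b hb => Finset.mem_insert_of_mem hb
    have ih' := ih (fun b hb => hl b (m b hb)) (fun b hb => hlo b (m b hb))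
      (fun b hb c hc => hdis b (m b hb) c (m c hc))
    have ha' := Finset.mem_insert_self a s
    rcases (hl a ha').eq_or_lt with h0 | h0
    · have := ih' hi hlh (fun b hb => hhi b (m b hb))
      linarith
    · have := ih' (x a) (hlo a ha') (fun b hb => by
        rcases hdis b (m b hb) a ha' (by rintro rfl; exact ha hb) with h | h
        · exact h
        · linarith [hmax b hb])
      linarith [hhi a ha']

section
variable {V : Type*} [Fintype V]

/-- A cheap set of shortcuts approximating the distances to a set of terminals (a shallow-light
tree hung on the line). -/
theorem exists_shallow_light {d : V → V → ℝ} (hd : IsPDist d) {f : V → ℝ} {M : ℝ}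
    (hf : ∀ v, 0 ≤ f v ∧ f v ≤ 2 * M)
    {N : Finset V} (hN : N.Nonempty) {c : ℝ} (hc0 : 0 < c) (hc1 : c ≤ 1) :
    ∃ (P : Finset (V × V)) (g : V → V), ∑ a ∈ P, d a.1 a.2 ≤ 4 * c * M ∧ (∀ u, g u ∈ N) ∧
      ∀ δ, Dominated d f P δ → ∀ u, ∀ p ∈ N, δ u (g u) ≤ 2 / c * d u p := by
  have h1 : ∀ u, ∃ p ∈ N, ∀ q ∈ N, d u p ≤ d u q := fun u =>
    Finset.exists_min_image N (fun p => d u p) hN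
  choose ν hνN hν using h1
  set e : V → ℝ := fun u => d u (ν u) with he
  have he0 : ∀ u, 0 ≤ e u := fun u => hd.nonneg _ _
  obtain ⟨B, -, hind, hcov⟩ := exists_greedy (univ : Finset V) e
    (fun v b => |f v - f b| ≤ (e v + e b) / (2 * c))
    (fun v => by
      have := he0 v
      simp only [sub_self, abs_zero]; positivity)
  have hcov' : ∀ v, ∃ b ∈ B, |f v - f b| ≤ (e v + e b) / (2 * c) ∧ e b ≤ e v :=
    fun v => hcov v (mem_univ _)
  have hind' : ∀ a ∈ B, ∀ b ∈ B, a ≠ b → (e a + e b) / (2 * c) < |f a - f b| := by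
    intro a ha b hb hab
    by_contra h
    rw [not_lt] at h
    refine hind a ha b hb hab ⟨h, ?_⟩
    rw [abs_sub_comm, add_comm]; exact h
  choose β hβB hβ1 hβ2 using hcov'
  refine ⟨B.image fun b => (b, ν b), fun u => ν (β u), ?_, fun u => hνN _, ?_⟩
  · rw [Finset.sum_image (by intro a _ b _ h; exact (Prod.mk.inj h).1)]
    obtain ⟨p, hp⟩ := hN
    have hb0 : e (β p) = 0 := by
      have h2 := hβ2 p
      have : e p ≤ 0 := by have := hν p p hp; rw [hd.self] at this; exact this
      linarith [he0 (β p)]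
    set b0 := β p
    have hk : ∀ x : ℝ, (x) / (2 * c) = x * (1 / (2 * c)) := fun x => by ring
    have hs := sum_length_le B (fun b => if f b0 ≤ f b then f b - e b / (2 * c) else f b)
      (fun b => e b / (2 * c)) 0 (fun b _ => div_nonneg (he0 b) (by positivity)) ?_ ?_ (2 * M)
      (by linarith [hf p]) ?_
    · rw [← Finset.sum_div, div_le_iff₀ (by positivity)] at hs
      change ∑ b ∈ B, e b ≤ _
      linarith
    · intro b hb
      by_cases hbb : b = b0
      · subst hbb; simp [hb0]; exact (hf _).1
      have := hind' b hb b0 (hβB p) hbb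
      rw [hb0, add_zero] at this
      split_ifs with h
      · rw [abs_of_nonneg (by linarith)] at this
        linarith [(hf b0).1]
      · exact (hf b).1
    · intro a ha b hb hab
      have := hind' a ha b hb hab
      rw [add_div] at this
      have ga : 0 ≤ e a / (2 * c) := div_nonneg (he0 a) (by positivity)
      have gb : 0 ≤ e b / (2 * c) := div_nonneg (he0 b) (by positivity)
      rcases le_total (f a) (f b) with h | h
      · left
        rw [abs_of_nonpos (by linarith)] at this
        split_ifs <;> linarith
      · right
        rw [abs_of_nonneg (by linarith)] at this
        split_ifs <;> linarith
    · intro b hb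
      by_cases hbb : b = b0
      · subst hbb; simp [hb0]; exact (hf _).2
      have := hind' b hb b0 (hβB p) hbb
      rw [hb0, add_zero] at this
      split_ifs with h
      · linarith [(hf b).2]
      · rw [abs_of_nonpos (by linarith)] at this
        linarith [(hf b0).2]
  · intro δ hδ u q hq
    have h1 := hδ.pdist.tri u (β u) (ν (β u))
    have h2 := hδ.le_line u (β u)
    have h3 := hδ.le_on (β u, ν (β u)) (Finset.mem_image_of_mem _ (hβB u))
    have h4 := hβ1 u
    have h5 := hβ2 u
    have h6 := hν u q hq
    have h7 : (e u + e (β u)) / (2 * c) ≤ e u / c := by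
      rw [div_le_div_iff₀ (by positivity) hc0]
      nlinarith
    have h8 : e u ≤ e u / c := by
      rw [le_div_iff₀ hc0]; nlinarith [he0 u]
    have h9 : e u / c ≤ d u q / c := by gcongr
    have : 2 / c * d u q = 2 * (d u q / c) := by ring
    rw [this]
    change δ u (ν (β u)) ≤ _
    simp only [he] at *
    linarith
end

section
variable {ι : Type*}

/-- The relation ball of hop radius `i` around `a` inside `A`. -/
noncomputable def hopBall (J : ι → ι → Prop) (A : Finset ι) (a : ι) : ℕ → Finset ι
  | 0 => {a}
  | i + 1 => hopBall J A a i ∪ A.filter fun b => ∃ c ∈ hopBall J A a i, J c b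

theorem hopBall_subset {J : ι → ι → Prop} {A : Finset ι} {a : ι} (ha : a ∈ A) (i : ℕ) :
    hopBall J A a i ⊆ A := by
  induction i with
  | zero => simpa [hopBall] using ha
  | succ i ih => exact Finset.union_subset ih (Finset.filter_subset _ _)

theorem self_mem_hopBall {J : ι → ι → Prop} {A : Finset ι} {a : ι} (i : ℕ) :
    a ∈ hopBall J A a i := by
  induction i with
  | zero => simp [hopBall]
  | succ i ih => exact Finset.mem_union_left _ ih

/-- A two-variable function that behaves like a pseudo-distance on `A`, with self-distances
at most `L`. -/
structure IsRoughDist (A : Finset ι) (δ : ι → ι → ℝ) (L : ℝ) : Prop where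
  self_le : ∀ a ∈ A, δ a a ≤ L
  symm : ∀ a ∈ A, ∀ b ∈ A, δ a b = δ b a
  tri : ∀ a ∈ A, ∀ b ∈ A, ∀ c ∈ A, δ a c ≤ δ a b + δ b c

theorem exists_hopBall_tree (J : ι → ι → Prop) (A : Finset ι) {a : ι} (ha : a ∈ A) (i : ℕ) :
    ∃ F : Finset (ι × ι), (∀ e ∈ F, e.1 ∈ A ∧ e.2 ∈ A ∧ J e.1 e.2) ∧
      F.card ≤ (hopBall J A a i).card ∧
      ∀ δ L, IsRoughDist A δ L → (∀ e ∈ F, δ e.1 e.2 ≤ L) →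
        ∀ b ∈ hopBall J A a i, δ a b ≤ (i + 1) * L := by
  induction i with
  | zero =>
    refine ⟨∅, by simp, by simp, ?_⟩
    intro δ L h _ b hb
    simp only [hopBall, mem_singleton] at hb
    subst hb
    simpa using h.self_le b ha
  | succ i ih =>
    obtain ⟨F, hF, hc, hδ⟩ := ih
    have hp : ∀ b ∈ hopBall J A a (i + 1) \ hopBall J A a i, ∃ c ∈ hopBall J A a i, J c b := by
      intro b hb
      rw [Finset.mem_sdiff, hopBall, Finset.mem_union, Finset.mem_filter] at hb
      tauto
    choose! par hpar hJ using hp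
    have hsub : hopBall J A a i ⊆ hopBall J A a (i + 1) := Finset.subset_union_left
    refine ⟨F ∪ (hopBall J A a (i + 1) \ hopBall J A a i).image fun b => (par b, b), ?_, ?_, ?_⟩
    · intro e he
      rcases Finset.mem_union.1 he with he | he
      · exact hF e he
      · obtain ⟨b, hb, rfl⟩ := Finset.mem_image.1 he
        exact ⟨hopBall_subset ha _ (hpar b hb),
          hopBall_subset ha (i + 1) (Finset.mem_sdiff.1 hb).1, hJ b hb⟩
    · refine (Finset.card_union_le _ _).trans ?_
      have h1 := Finset.card_image_le (s := hopBall J A a (i + 1) \ hopBall J A a i)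
        (f := fun b => (par b, b))
      have h2 := Finset.card_sdiff_add_card_eq_card hsub
      omega
    · intro δ L h hL b hb
      have hLa : ∀ e ∈ F, δ e.1 e.2 ≤ L := fun e he => hL e (Finset.mem_union_left _ he)
      by_cases hbi : b ∈ hopBall J A a i
      · have h0 : 0 ≤ L := by
          have t1 := h.tri a ha a ha a ha
          have := h.self_le a ha
          linarith
        have := hδ δ L h hLa b hbi
        push_cast; nlinarith
      · have hb' : b ∈ hopBall J A a (i + 1) \ hopBall J A a i := Finset.mem_sdiff.2 ⟨hb, hbi⟩
        have h1 := hδ δ L h hLa _ (hpar b hb')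
        have h2 := hL (par b, b) (Finset.mem_union_right _ (Finset.mem_image_of_mem _ hb'))
        have h3 := h.tri a ha (par b) (hopBall_subset ha _ (hpar b hb')) b
          (hopBall_subset ha (i + 1) hb)
        push_cast; linarith

/-- Sparse hop-spanner of a relation: with `Γ |A|` pairs, related elements get within
`2 h + 2` hops whenever `|A| < Γ ^ h`. -/
theorem exists_sparse_hop (J : ι → ι → Prop) (hJ : ∀ a b, J a b → J b a) (Γ h : ℕ) (A : Finset ι)
    (hA : A.card < Γ ^ h) :
    ∃ F : Finset (ι × ι), (∀ e ∈ F, e.1 ∈ A ∧ e.2 ∈ A ∧ J e.1 e.2) ∧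
      F.card ≤ Γ * A.card ∧
      ∀ δ L, IsRoughDist A δ L → (∀ e ∈ F, δ e.1 e.2 ≤ L) →
        ∀ a ∈ A, ∀ b ∈ A, J a b → δ a b ≤ (2 * h + 2) * L := by
  induction A using Finset.strongInduction with
  | H A ih =>
  rcases A.eq_empty_or_nonempty with rfl | ⟨a, ha⟩
  · exact ⟨∅, by simp, by simp, by simp⟩
  have hi : ∃ i, i < h ∧ (hopBall J A a (i + 1)).card ≤ Γ * (hopBall J A a i).card := by
    by_contra hcon
    push Not at hcon
    have : ∀ i ≤ h, Γ ^ i ≤ (hopBall J A a i).card := by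
      intro i
      induction i with
      | zero => simp [hopBall]
      | succ i ihi =>
        intro hi
        calc Γ ^ (i + 1) = Γ * Γ ^ i := by ring
          _ ≤ Γ * (hopBall J A a i).card := Nat.mul_le_mul_left _ (ihi (by omega))
          _ ≤ _ := (hcon i (by omega)).le
    have h1 := this h le_rfl
    have h2 := Finset.card_le_card (hopBall_subset (J := J) ha h)
    omega
  obtain ⟨i, hih, hgrow⟩ := hi
  set B := hopBall J A a i with hB
  have hBA : B ⊆ A := hopBall_subset ha i
  have hss : A \ B ⊂ A := by
    refine Finset.ssubset_iff_subset_ne.2 ⟨Finset.sdiff_subset, fun he => ?_⟩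
    have : a ∈ A \ B := by rw [he]; exact ha
    exact (Finset.mem_sdiff.1 this).2 (self_mem_hopBall i)
  obtain ⟨F', hF', hc', hδ'⟩ := ih _ hss
    (lt_of_le_of_lt (Finset.card_le_card hss.1) hA)
  obtain ⟨F, hF, hc, hδ⟩ := exists_hopBall_tree J A ha (i + 1)
  refine ⟨F ∪ F', ?_, ?_, ?_⟩
  · intro e he
    rcases Finset.mem_union.1 he with he | he
    · exact hF e he
    · have := hF' e he
      exact ⟨hss.1 this.1, hss.1 this.2.1, this.2.2⟩
  · have h1 := Finset.card_union_le F F'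
    have h2 := Finset.card_sdiff_add_card_eq_card hBA
    calc (F ∪ F').card ≤ F.card + F'.card := h1
      _ ≤ Γ * B.card + Γ * (A \ B).card := by omega
      _ = Γ * A.card := by rw [← h2]; ring
  · intro δ L hL hFL x hx y hy hxy
    have hL0 : 0 ≤ L := by
      have t1 := hL.tri a ha a ha a ha
      have := hL.self_le a ha
      linarith
    have hball := hδ δ L hL fun e he => hFL e (Finset.mem_union_left _ he)
    have key : ∀ x ∈ B, ∀ y ∈ A, J x y → δ x y ≤ (2 * h + 2) * L := by
      intro x hx y hy hxy
      have hy' : y ∈ hopBall J A a (i + 1) :=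
        Finset.mem_union_right _ (Finset.mem_filter.2 ⟨hy, x, hx, hxy⟩)
      have hx' : x ∈ hopBall J A a i := hx
      have h1 := hball y hy'
      have h2 := hball x (Finset.mem_union_left _ hx)
      have h3 := hL.tri x (hBA hx) a ha y hy
      rw [hL.symm x (hBA hx) a ha] at h3
      push_cast at h1 h2
      have : (i : ℝ) + 1 ≤ h := by exact_mod_cast hih
      nlinarith
    by_cases hxB : x ∈ B
    · exact key x hxB y hy hxy
    by_cases hyB : y ∈ B
    · rw [hL.symm x hx y hy]
      exact key y hyB x hx (hJ _ _ hxy)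
    refine hδ' δ L ⟨fun a ha => hL.self_le a (hss.1 ha), fun a ha b hb => hL.symm a (hss.1 ha) b
      (hss.1 hb), fun a ha b hb c hc => hL.tri a (hss.1 ha) b (hss.1 hb) c (hss.1 hc)⟩
      (fun e he => hFL e (Finset.mem_union_right _ he)) x (Finset.mem_sdiff.2 ⟨hx, hxB⟩) y
      (Finset.mem_sdiff.2 ⟨hy, hyB⟩) hxy

end

section
variable {V ι : Type*} [Fintype V] [Nonempty V] [DecidableEq ι]

/-- Shortcuts between the cells of a partition, for the pairs at distance at most `D`. -/
theorem exists_cell_shortcuts {d : V → V → ℝ} (hd : IsPDist d) (cell : V → ι) (U : Finset V)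
    (Γ h : ℕ) (hU : (U.image cell).card < Γ ^ h) {D : ℝ} (hD : 0 ≤ D) :
    ∃ P : Finset (V × V), ∑ a ∈ P, d a.1 a.2 ≤ Γ * (U.image cell).card * D ∧
      ∀ δ, IsPDist δ → (∀ a ∈ P, δ a.1 a.2 ≤ d a.1 a.2) → ∀ ρ,
        (∀ u ∈ U, ∀ v ∈ U, cell u = cell v → δ u v ≤ ρ) →
        ∀ u ∈ U, ∀ v ∈ U, d u v ≤ D → δ u v ≤ (2 * h + 2) * (D + 2 * ρ) := by
  obtain ⟨F, hF, hFc, hFδ⟩ := exists_sparse_hop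
    (fun c c' => ∃ u ∈ U, ∃ v ∈ U, cell u = c ∧ cell v = c' ∧ d u v ≤ D)
    (by
      rintro a b ⟨u, hu, v, hv, h1, h2, h3⟩
      exact ⟨v, hv, u, hu, h2, h1, by rw [hd.symm]; exact h3⟩) Γ h (U.image cell) hU
  have hrep : ∀ e ∈ F, ∃ p : V × V, p.1 ∈ U ∧ p.2 ∈ U ∧ cell p.1 = e.1 ∧ cell p.2 = e.2 ∧
      d p.1 p.2 ≤ D := by
    intro e he
    obtain ⟨-, -, u, hu, v, hv, h⟩ := hF e he
    exact ⟨(u, v), hu, hv, h⟩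
  choose! r hr1 hr2 hr3 hr4 hr5 using hrep
  refine ⟨F.image r, ?_, ?_⟩
  · calc ∑ a ∈ F.image r, d a.1 a.2 ≤ ∑ a ∈ F.image r, D := by
          refine Finset.sum_le_sum fun a ha => ?_
          obtain ⟨e, he, rfl⟩ := Finset.mem_image.1 ha
          exact hr5 e he
      _ = (F.image r).card * D := by simp
      _ ≤ (Γ * (U.image cell).card : ℕ) * D := by
          gcongr
          exact Finset.card_image_le.trans hFc
      _ = _ := by push_cast; ring
  · intro δ hδ hδP ρ hρ u hu v hv huv
    set S : ι → ι → Set ℝ := fun c c' =>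
      (fun p : V × V => δ p.1 p.2) '' {p | p.1 ∈ U ∧ p.2 ∈ U ∧ cell p.1 = c ∧ cell p.2 = c'}
      with hS
    have hbdd : ∀ c c', BddAbove (S c c') := fun c c' => (Set.toFinite _).bddAbove
    have hmem : ∀ u ∈ U, ∀ v ∈ U, δ u v ≤ sSup (S (cell u) (cell v)) := fun u hu v hv =>
      le_csSup (hbdd _ _) ⟨(u, v), ⟨hu, hv, rfl, rfl⟩, rfl⟩
    have hle : ∀ c ∈ U.image cell, ∀ c' ∈ U.image cell, ∀ B,
        (∀ u ∈ U, ∀ v ∈ U, cell u = c → cell v = c' → δ u v ≤ B) → sSup (S c c') ≤ B := by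
      intro c hc c' hc' B hB
      obtain ⟨x, hx, rfl⟩ := Finset.mem_image.1 hc
      obtain ⟨y, hy, rfl⟩ := Finset.mem_image.1 hc'
      refine csSup_le ⟨_, (x, y), ⟨hx, hy, rfl, rfl⟩, rfl⟩ ?_
      rintro _ ⟨p, ⟨h1, h2, h3, h4⟩, rfl⟩
      exact hB _ h1 _ h2 h3 h4
    have hρ0 : 0 ≤ ρ := by
      have := hρ u hu u hu rfl
      rwa [hδ.self] at this
    refine (hmem u hu v hv).trans (hFδ (fun c c' => sSup (S c c')) (D + 2 * ρ) ⟨?_, ?_, ?_⟩ ?_ _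
      (Finset.mem_image_of_mem _ hu) _ (Finset.mem_image_of_mem _ hv) ⟨u, hu, v, hv, rfl, rfl, huv⟩)
    · intro c hc
      refine hle c hc c hc _ fun u hu v hv h1 h2 => ?_
      have := hρ u hu v hv (h1.trans h2.symm)
      linarith
    · intro c hc c' hc'
      refine le_antisymm (hle c hc c' hc' _ ?_) (hle c' hc' c hc _ ?_)
      · rintro u hu v hv rfl rfl
        rw [hδ.symm]; exact hmem v hv u hu
      · rintro u hu v hv rfl rfl
        rw [hδ.symm]; exact hmem v hv u hu
    · intro a ha b hb c hc
      refine hle a ha c hc _ ?_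
      rintro u hu v hv rfl rfl
      obtain ⟨x, hx, rfl⟩ := Finset.mem_image.1 hb
      have h1 := hmem u hu x hx
      have h2 := hmem x hx v hv
      have h3 := hδ.tri u x v
      linarith
    · intro e he
      have he' := hF e he
      refine hle _ he'.1 _ he'.2.1 _ fun x hx y hy h1 h2 => ?_
      have t1 := hδ.tri x (r e).1 y
      have t2 := hδ.tri (r e).1 (r e).2 y
      have t3 := hρ x hx _ (hr1 e he) (h1.trans (hr3 e he).symm)
      have t4 := hρ _ (hr2 e he) y hy ((hr4 e he).trans h2.symm)
      have t5 := hδP (r e) (Finset.mem_image_of_mem _ he)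
      have t6 := hr5 e he
      linarith

end

theorem exists_union_cost_le_block {α : Type*} [Fintype α] (P : ℕ → ℕ → Finset α)
    (c : α → ℝ) (hc : ∀ a, 0 ≤ c a) (m : ℕ → ℕ) (b : ℕ → ℝ)
    (hP : ∀ t, ∀ i < m t, ∑ a ∈ P t i, c a ≤ b t) (B : ℝ)
    (hB : ∀ T, ∑ t ∈ range T, m t * b t ≤ B) :
    ∃ Q : Finset α, (∀ t, ∀ i < m t, P t i ⊆ Q) ∧ ∑ a ∈ Q, c a ≤ B := by
  obtain ⟨Q, hQ, hQc⟩ := exists_union_cost_le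
    (fun x : Σ t : ℕ, Fin (m t) => P x.1 x.2) c hc B (by
      intro s
      set T := (s.sup fun x => x.1) + 1 with hT
      have hsub : s ⊆ (range T).sigma fun t => (univ : Finset (Fin (m t))) := by
        intro x hx
        have := Finset.le_sup (f := fun x : Σ t : ℕ, Fin (m t) => x.1) hx
        simp only [Finset.mem_sigma, Finset.mem_range, Finset.mem_univ, and_true]
        omega
      refine (Finset.sum_le_sum_of_subset_of_nonneg hsub
        fun x _ _ => Finset.sum_nonneg fun a _ => hc a).trans ?_
      rw [Finset.sum_sigma]
      refine le_trans (Finset.sum_le_sum fun t _ => ?_) (hB T)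
      calc ∑ i : Fin (m t), ∑ a ∈ P t i, c a ≤ ∑ i : Fin (m t), b t :=
            Finset.sum_le_sum fun i _ => hP t i i.2
        _ = m t * b t := by simp)
  exact ⟨Q, fun t i hi => hQ ⟨t, ⟨i, hi⟩⟩, hQc⟩

theorem sum_inv_two_pow_le (T : ℕ) : ∑ t ∈ range T, (1 / 2 : ℝ) ^ t ≤ 2 := by
  have := sum_geometric_two_le T
  exact this

theorem sum_inv_sq_le (T : ℕ) : ∑ t ∈ range T, 1 / ((t : ℝ) + 1) ^ 2 ≤ 2 := by
  have h : ∀ T : ℕ, ∑ t ∈ range (T + 1), 1 / ((t : ℝ) + 1) ^ 2 ≤ 2 - 1 / ((T : ℝ) + 1) := by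
    intro T
    induction T with
    | zero => norm_num
    | succ T ih =>
      rw [Finset.sum_range_succ]
      have h : (0 : ℝ) ≤ T := T.cast_nonneg
      have e : 1 / ((T : ℝ) + 1) - 1 / ((T : ℝ) + 1 + 1) =
          1 / (((T : ℝ) + 1) * ((T : ℝ) + 1 + 1)) := by field_simp; ring
      have : 1 / ((T : ℝ) + 1 + 1) ^ 2 ≤ 1 / (((T : ℝ) + 1) * ((T : ℝ) + 1 + 1)) := by
        apply one_div_le_one_div_of_le (by positivity)
        nlinarith
      push_cast
      linarith
  have h1 := h T
  rw [Finset.sum_range_succ] at h1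
  have : (0 : ℝ) ≤ 1 / ((T : ℝ) + 1) := by positivity
  have : (0 : ℝ) ≤ 1 / ((T : ℝ) + 1) ^ 2 := by positivity
  linarith

section
variable {V : Type*} [Fintype V] [Nonempty V]

/-- Shortcuts at one distance scale, from the partition of the line into equal cells. -/
theorem exists_line_tier {d : V → V → ℝ} (hd : IsPDist d) {f : V → ℝ} {M : ℝ}
    (hf : ∀ v, 0 ≤ f v ∧ f v ≤ 2 * M) {ρ D : ℝ} (hρ : 0 < ρ) (hρM : ρ ≤ M) (hD : 0 ≤ D) (h : ℕ)
    (hh : 3 * M / ρ < 2 ^ h) :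
    ∃ P : Finset (V × V), ∑ a ∈ P, d a.1 a.2 ≤ 6 * M * D / ρ ∧
      ∀ δ, Dominated d f P δ → ∀ u v, d u v ≤ D → δ u v ≤ (2 * h + 2) * (D + 2 * ρ) := by
  set cell : V → ℕ := fun v => ⌊f v / ρ⌋₊ with hcell
  have hcard : ((univ.image cell).card : ℝ) ≤ 3 * M / ρ := by
    have hsub : univ.image cell ⊆ range (⌊2 * M / ρ⌋₊ + 1) := by
      intro c hc
      obtain ⟨v, -, rfl⟩ := Finset.mem_image.1 hc
      rw [Finset.mem_range, Nat.lt_succ_iff]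
      refine Nat.floor_le_floor ?_
      have := (hf v).2
      gcongr
    have h1 : ((univ.image cell).card : ℝ) ≤ (⌊2 * M / ρ⌋₊ : ℝ) + 1 := by
      have := Finset.card_le_card hsub
      rw [Finset.card_range] at this
      exact_mod_cast this
    have h2 : (⌊2 * M / ρ⌋₊ : ℝ) ≤ 2 * M / ρ :=
      Nat.floor_le (div_nonneg (by linarith) hρ.le)
    have h3 : 1 ≤ M / ρ := by rw [le_div_iff₀ hρ]; linarith
    have h4 : 3 * M / ρ = 2 * M / ρ + M / ρ := by ring
    linarith
  obtain ⟨P, hP, hPδ⟩ := exists_cell_shortcuts hd cell univ 2 h (by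
    have : ((univ.image cell).card : ℝ) < ((2 ^ h : ℕ) : ℝ) := by
      push_cast; exact hcard.trans_lt hh
    exact_mod_cast this) hD
  refine ⟨P, hP.trans ?_, ?_⟩
  · calc ((2 : ℕ) : ℝ) * ((univ.image cell).card : ℝ) * D ≤ 2 * (3 * M / ρ) * D := by
          push_cast; gcongr
      _ = _ := by ring
  · intro δ hδ u v huv
    refine hPδ δ hδ.pdist hδ.le_on ρ ?_ u (mem_univ _) v (mem_univ _) huv
    intro u _ v _ huv
    refine (hδ.le_line u v).trans ?_
    have a1 := Nat.floor_le (div_nonneg (hf u).1 hρ.le)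
    have a2 := Nat.floor_le (div_nonneg (hf v).1 hρ.le)
    have a3 := Nat.lt_floor_add_one (f u / ρ)
    have a4 := Nat.lt_floor_add_one (f v / ρ)
    have e : (⌊f u / ρ⌋₊ : ℝ) = ⌊f v / ρ⌋₊ := by exact_mod_cast huv
    have : |f u / ρ - f v / ρ| ≤ 1 := by rw [abs_le]; constructor <;> linarith
    rw [← sub_div, abs_div, abs_of_pos hρ, div_le_one hρ] at this
    exact this

/-- Shortcuts for all small scales between points whose balls are populous. -/
theorem exists_populous_tier {d : V → V → ℝ} (hd : IsPDist d) {f : V → ℝ} {M : ℝ} (hM : 0 < M)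
    (hf : ∀ v, 0 ≤ f v ∧ f v ≤ 2 * M) {θ c : ℝ} (hθ0 : 0 < θ) (hθ1 : θ ≤ 1)
    (hc0 : 0 < c) (hc1 : c ≤ 1) (Γ h : ℕ) (hΓ : 1 ≤ Γ) (hh : 1 / θ < Γ ^ h) :
    ∃ P : Finset (V × V), ∑ a ∈ P, d a.1 a.2 ≤ 6 * c * M ∧
      ∀ δ, Dominated d f P δ → ∀ D, 0 < D → D ≤ M * θ * c / Γ → ∀ u v, d u v ≤ D →
        θ * Fintype.card V ≤ ((pball d u D).card : ℝ) →
        θ * Fintype.card V ≤ ((pball d v D).card : ℝ) →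
        δ u v ≤ 68 * (h + 1) / c * D := by
  have hΓ0 : (0 : ℝ) < Γ := by exact_mod_cast hΓ
  obtain ⟨N, hN, hNc, hNet⟩ := exists_net hd hθ0 hθ1
  obtain ⟨P0, g, hP0, hgN, hg⟩ := exists_shallow_light hd hf hN hc0 hc1
  set Dm := M * θ * c / Γ with hDm
  have hDm0 : 0 < Dm := by positivity
  set U : ℕ → Finset V := fun i =>
    univ.filter fun u => θ * Fintype.card V ≤ ((pball d u (Dm / 2 ^ i)).card : ℝ) with hU
  have hNθ : (N.card : ℝ) ≤ 1 / θ := by rw [le_div_iff₀ hθ0]; exact hNc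
  have hcard : ∀ i, (((U i).image g).card : ℝ) ≤ 1 / θ := by
    intro i
    refine le_trans ?_ hNθ
    exact_mod_cast Finset.card_le_card (Finset.image_subset_iff.2 fun u _ => hgN u)
  have hsc := fun i : ℕ => exists_cell_shortcuts hd g (U i) Γ h (by
    have : (((U i).image g).card : ℝ) < ((Γ ^ h : ℕ) : ℝ) := by
      push_cast; exact (hcard i).trans_lt hh
    exact_mod_cast this) (D := Dm / 2 ^ i) (by positivity)
  choose P hPc hPδ using hsc
  obtain ⟨Q, hQ, hQc⟩ := exists_union_cost_le P (fun a => d a.1 a.2) (fun a => hd.nonneg _ _)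
    (2 * c * M) (by
      intro s
      obtain ⟨T, hT⟩ := s.exists_nat_subset_range
      have h1 : ∀ i, ∑ a ∈ P i, d a.1 a.2 ≤ c * M * (1 / 2) ^ i := by
        intro i
        refine (hPc i).trans ?_
        calc (Γ : ℝ) * ((U i).image g).card * (Dm / 2 ^ i) ≤ Γ * (1 / θ) * (Dm / 2 ^ i) := by
              gcongr; exact hcard i
          _ = _ := by rw [hDm, one_div_pow]; field_simp
      calc _ ≤ ∑ i ∈ range T, ∑ a ∈ P i, d a.1 a.2 :=
            Finset.sum_le_sum_of_subset_of_nonneg hT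
              fun x _ _ => Finset.sum_nonneg fun a _ => hd.nonneg _ _
        _ ≤ ∑ i ∈ range T, c * M * (1 / 2) ^ i := Finset.sum_le_sum fun i _ => h1 i
        _ = c * M * ∑ i ∈ range T, (1 / 2 : ℝ) ^ i := by rw [Finset.mul_sum]
        _ ≤ c * M * 2 := by gcongr; exact sum_inv_two_pow_le T
        _ = _ := by ring)
  refine ⟨P0 ∪ Q, ?_, ?_⟩
  · have := Finset.sum_union_inter (s₁ := P0) (s₂ := Q) (f := fun a => d a.1 a.2)
    have h2 : 0 ≤ ∑ a ∈ P0 ∩ Q, d a.1 a.2 := Finset.sum_nonneg fun a _ => hd.nonneg _ _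
    linarith
  · intro δ hδ D hD hDle u v huv hu hv
    obtain ⟨i, hi1, hi2⟩ := exists_nat_pow_near (one_le_div hD |>.2 hDle) (one_lt_two (α := ℝ))
    rw [le_div_iff₀ hD] at hi1
    rw [div_lt_iff₀ hD, pow_succ] at hi2
    have hpow : (0 : ℝ) < 2 ^ i := by positivity
    have hD1 : D ≤ Dm / 2 ^ i := by rw [le_div_iff₀ hpow]; linarith
    have hD2 : Dm / 2 ^ i ≤ 2 * D := by rw [div_le_iff₀ hpow]; linarith
    have hmemU : ∀ u, θ * Fintype.card V ≤ ((pball d u D).card : ℝ) → u ∈ U i := by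
      intro u hu
      simp only [hU, mem_filter, mem_univ, true_and]
      exact hu.trans (Nat.cast_le.2 (Finset.card_le_card (pball_mono hD1)))
    have hδ0 := hδ.mono (Finset.subset_union_left (s₁ := P0) (s₂ := Q))
    have hgU : ∀ u ∈ U i, δ u (g u) ≤ 4 / c * (Dm / 2 ^ i) := by
      intro u hu
      obtain ⟨p, hp, hup⟩ := hNet u _ (Finset.mem_filter.1 hu).2
      calc δ u (g u) ≤ 2 / c * d u p := hg δ hδ0 u p hp
        _ ≤ 2 / c * (2 * (Dm / 2 ^ i)) := by gcongr
        _ = _ := by ring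
    have := hPδ i δ hδ.pdist
      (fun a ha => hδ.le_on a (Finset.mem_union_right _ (hQ i ha))) (8 / c * (Dm / 2 ^ i)) (by
        intro x hx y hy hxy
        have h1 := hδ.pdist.tri x (g x) y
        have h2 := hgU x hx
        have h3 := hgU y hy
        rw [hδ.pdist.symm (g x) y, hxy] at h1
        have : 8 / c * (Dm / 2 ^ i) = 4 / c * (Dm / 2 ^ i) + 4 / c * (Dm / 2 ^ i) := by ring
        rw [hxy] at h2
        linarith) u (hmemU u hu) v (hmemU v hv) (huv.trans hD1)
    refine this.trans ?_
    have hc2 : 1 ≤ 1 / c := by rw [le_div_iff₀ hc0]; linarith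
    calc (2 * (h : ℝ) + 2) * (Dm / 2 ^ i + 2 * (8 / c * (Dm / 2 ^ i)))
        = (2 * h + 2) * ((1 + 16 * (1 / c)) * (Dm / 2 ^ i)) := by ring
      _ ≤ (2 * h + 2) * ((1 / c + 16 * (1 / c)) * (2 * D)) := by gcongr
      _ = _ := by ring

end

theorem exists_tier_index {L ℓ : ℝ} (hℓ : 2 ≤ ℓ) (hL : 0 < L) (hLℓ : L ≤ 2 * ℓ) :
    ∃ s k : ℕ, 1 ≤ s ∧ 1 ≤ k ∧ k ≤ 256 ^ (s + 1) ∧ L ≤ s * k ∧ (s : ℝ) * k ≤ L + s ∧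
      (s : ℝ) * 256 ^ s ≤ 128 * ℓ := by
  have hex : ∃ s : ℕ, 1 ≤ s ∧ L ≤ s * 256 ^ (s + 1) := by
    refine ⟨⌈L⌉₊ + 1, by omega, ?_⟩
    have h1 := Nat.le_ceil L
    have h2 : (1 : ℝ) ≤ 256 ^ (⌈L⌉₊ + 1 + 1) := one_le_pow₀ (by norm_num)
    push_cast
    nlinarith
  set s := Nat.find hex with hs
  obtain ⟨hs1, hsL⟩ := Nat.find_spec hex
  rw [← hs] at hs1 hsL
  have hs0 : (0 : ℝ) < s := by exact_mod_cast hs1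
  have hceil : L / s ≤ ⌈L / s⌉₊ := Nat.le_ceil _
  have hceil2 : (⌈L / s⌉₊ : ℝ) < L / s + 1 := Nat.ceil_lt_add_one (by positivity)
  refine ⟨s, ⌈L / s⌉₊, hs1, Nat.ceil_pos.2 (by positivity), ?_, ?_, ?_, ?_⟩
  · rw [Nat.ceil_le, div_le_iff₀ hs0]
    push_cast; linarith
  · rw [div_le_iff₀ hs0] at hceil; linarith
  · have : (s : ℝ) * ⌈L / s⌉₊ ≤ s * (L / s + 1) := by gcongr
    have e : (s : ℝ) * (L / s + 1) = L + s := by field_simp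
    linarith
  · rcases Nat.lt_or_ge 1 s with h | h
    · have hmin := Nat.find_min hex (m := s - 1) (by omega)
      rw [not_and, not_le] at hmin
      have h1 := hmin (by omega)
      have h2 : s - 1 + 1 = s := by omega
      rw [h2, Nat.cast_sub hs1] at h1
      have h3 : (2 : ℝ) ≤ s := by exact_mod_cast h
      have h4 : (0 : ℝ) < 256 ^ s := by positivity
      push_cast at h1
      nlinarith
    · have : s = 1 := by omega
      rw [this]; norm_num; linarith

theorem mul_four_pow_le {s : ℕ} {ℓ : ℝ} (hs : 1 ≤ s) (hℓ : 0 ≤ ℓ)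
    (h : (s : ℝ) * 256 ^ s ≤ 128 * ℓ) : (s : ℝ) * 4 ^ s ≤ 12 * √ℓ := by
  have h1 : (s : ℝ) ≤ 16 ^ s := by
    have : s < 16 ^ s := Nat.lt_pow_self (by norm_num)
    exact_mod_cast this.le
  have h2 : ((s : ℝ) * 4 ^ s) ^ 2 ≤ s * 256 ^ s := by
    have : ((s : ℝ) * 4 ^ s) ^ 2 = s * (s * 16 ^ s) := by
      rw [mul_pow, ← pow_mul, mul_comm s 2, pow_mul]; norm_num; ring
    rw [this]
    have e : (256 : ℝ) ^ s = 16 ^ s * 16 ^ s := by rw [← mul_pow]; norm_num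
    rw [e]
    gcongr
  have h3 : (√ℓ) ^ 2 = ℓ := Real.sq_sqrt hℓ
  have : ((s : ℝ) * 4 ^ s) ^ 2 ≤ (12 * √ℓ) ^ 2 := by rw [mul_pow 12, h3]; linarith
  exact le_of_sq_le_sq this (by positivity)

section
variable {V : Type*} [Fintype V] [Nonempty V]

theorem exists_populous_shortcuts {d : V → V → ℝ} (hd : IsPDist d) {f : V → ℝ} {M : ℝ}
    (hM : 0 < M) (hf : ∀ v, 0 ≤ f v ∧ f v ≤ 2 * M) :
    ∃ P : Finset (V × V), ∑ a ∈ P, d a.1 a.2 ≤ 3072 * M ∧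
      ∀ δ, Dominated d f P δ → ∀ ℓ L D, 2 ≤ ℓ → 0 < L → L ≤ 2 * ℓ → 0 < D →
        D * (1536 * ℓ * √ℓ * (2 : ℝ) ^ L) ≤ M → ∀ u v, d u v ≤ D →
        (2 : ℝ) ^ (-L) * Fintype.card V ≤ ((pball d u D).card : ℝ) →
        (2 : ℝ) ^ (-L) * Fintype.card V ≤ ((pball d v D).card : ℝ) →
        δ u v ≤ 40000 * ℓ ^ 2 * D := by
  have hfam := fun t i : ℕ => exists_populous_tier hd hM hf
    (θ := 1 / 2 ^ ((t + 1) * (i + 1))) (c := 1 / (256 ^ (t + 1) * ((t : ℝ) + 1) ^ 2))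
    (by positivity) (by
      rw [div_le_one (by positivity)]; exact one_le_pow₀ (by norm_num)) (by positivity) (by
      rw [div_le_one (by positivity)]
      have h1 : (1 : ℝ) ≤ 256 ^ (t + 1) := one_le_pow₀ (by norm_num)
      have h2 : (1 : ℝ) ≤ ((t : ℝ) + 1) ^ 2 := one_le_pow₀ (by linarith [t.cast_nonneg (α := ℝ)])
      nlinarith) (2 ^ (t + 1)) (i + 2) Nat.one_le_two_pow (by
      rw [one_div_one_div]
      push_cast
      rw [← pow_mul]
      exact pow_lt_pow_right₀ (by norm_num) (by nlinarith))
  choose P hPc hPδ using hfam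
  obtain ⟨Q, hQ, hQc⟩ := exists_union_cost_le_block P (fun a => d a.1 a.2)
    (fun a => hd.nonneg _ _) (fun t => 256 ^ (t + 2))
    (fun t => 6 * (1 / (256 ^ (t + 1) * ((t : ℝ) + 1) ^ 2)) * M) (fun t i _ => hPc t i)
    (3072 * M) (by
      intro T
      calc _ = ∑ t ∈ range T, 1536 * M * (1 / ((t : ℝ) + 1) ^ 2) := by
            refine Finset.sum_congr rfl fun t _ => ?_
            have : (t : ℝ) + 1 ≠ 0 := by positivity
            push_cast
            rw [pow_succ (256 : ℝ) (t + 1)]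
            field_simp
            norm_num
        _ = 1536 * M * ∑ t ∈ range T, 1 / ((t : ℝ) + 1) ^ 2 := by rw [Finset.mul_sum]
        _ ≤ 1536 * M * 2 := by gcongr; exact sum_inv_sq_le T
        _ = _ := by ring)
  refine ⟨Q, hQc, ?_⟩
  intro δ hδ ℓ L D hℓ hL0 hLℓ hD hDM u v huv hu hv
  obtain ⟨s, k, hs, hk, hks, hL1, hL2, hsℓ⟩ := exists_tier_index hℓ hL0 hLℓ
  obtain ⟨t, rfl⟩ : ∃ t, s = t + 1 := ⟨s - 1, by omega⟩
  obtain ⟨i, rfl⟩ : ∃ i, k = i + 1 := ⟨k - 1, by omega⟩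
  have h4 := mul_four_pow_le hs (by linarith) hsℓ
  set s' : ℝ := (t : ℝ) + 1 with hs'
  have es : ((t + 1 : ℕ) : ℝ) = s' := by push_cast; rfl
  rw [es] at hL1 hL2 hsℓ h4
  have hs'1 : 1 ≤ s' := by rw [← es]; exact_mod_cast hs
  push_cast at hL1 hL2
  have hθL : (1 : ℝ) / 2 ^ ((t + 1) * (i + 1)) ≤ 2 ^ (-L) := by
    rw [Real.rpow_neg (by norm_num), ← one_div]
    apply one_div_le_one_div_of_le (by positivity)
    rw [← Real.rpow_natCast]
    apply Real.rpow_le_rpow_of_exponent_le (by norm_num)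
    push_cast; exact hL1
  have hθL2 : (2 : ℝ) ^ ((t + 1) * (i + 1)) ≤ 2 ^ L * 2 ^ (t + 1) := by
    rw [← Real.rpow_natCast 2 (t + 1), ← Real.rpow_natCast, ← Real.rpow_add (by norm_num)]
    apply Real.rpow_le_rpow_of_exponent_le (by norm_num)
    push_cast; exact hL2
  have hn : (0 : ℝ) ≤ Fintype.card V := Nat.cast_nonneg _
  have p256 : (0 : ℝ) < 256 ^ (t + 1) := by positivity
  have p4 : (0 : ℝ) < 4 ^ (t + 1) := by positivity
  have hres := hPδ t i δ (hδ.mono (hQ t i (by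
    have : t + 2 = t + 1 + 1 := rfl
    rw [this]; omega))) D hD (by
      push_cast
      rw [le_div_iff₀ (by positivity)]
      have h1 : D * 2 ^ (t + 1) * (2 ^ ((t + 1) * (i + 1)) * (256 ^ (t + 1) * s' ^ 2)) ≤ M := by
        refine le_trans ?_ hDM
        have e4 : (4 : ℝ) ^ (t + 1) = 2 ^ (t + 1) * 2 ^ (t + 1) := by rw [← mul_pow]; norm_num
        calc D * 2 ^ (t + 1) * (2 ^ ((t + 1) * (i + 1)) * (256 ^ (t + 1) * s' ^ 2))
            ≤ D * 2 ^ (t + 1) * ((2 ^ L * 2 ^ (t + 1)) * (256 ^ (t + 1) * s' ^ 2)) := by gcongr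
          _ = D * (2 ^ L * ((s' * 4 ^ (t + 1)) * (s' * 256 ^ (t + 1)))) := by rw [e4]; ring
          _ ≤ D * (2 ^ L * ((12 * √ℓ) * (128 * ℓ))) := by gcongr
          _ = _ := by ring
      calc D * 2 ^ (t + 1) = D * 2 ^ (t + 1) * (2 ^ ((t + 1) * (i + 1)) *
            (256 ^ (t + 1) * s' ^ 2)) *
              (1 / 2 ^ ((t + 1) * (i + 1)) * (1 / (256 ^ (t + 1) * s' ^ 2))) := by
            have : s' ≠ 0 := by positivity
            field_simp
        _ ≤ M * (1 / 2 ^ ((t + 1) * (i + 1)) * (1 / (256 ^ (t + 1) * s' ^ 2))) := by gcongr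
        _ = _ := by ring) u v huv
    (le_trans (by gcongr) hu) (le_trans (by gcongr) hv)
  refine hres.trans ?_
  have hs256 : s' ≤ ℓ / 2 := by
    have : (256 : ℝ) ≤ 256 ^ (t + 1) := by
      rw [pow_succ]
      have : (1 : ℝ) ≤ 256 ^ t := one_le_pow₀ (by norm_num)
      linarith
    nlinarith
  have e : 68 * (((i + 2 : ℕ) : ℝ) + 1) / (1 / (256 ^ (t + 1) * s' ^ 2)) * D =
      68 * ((s' * (i + 3)) * (s' * 256 ^ (t + 1))) * D := by
    push_cast; field_simp; ring
  rw [e]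
  have h5 : s' * (i + 3) ≤ 4 * ℓ := by nlinarith
  calc 68 * ((s' * (i + 3)) * (s' * 256 ^ (t + 1))) * D ≤ 68 * ((4 * ℓ) * (128 * ℓ)) * D := by
        gcongr
    _ ≤ _ := by nlinarith [mul_pos (mul_pos (by linarith : 0 < ℓ) (by linarith : 0 < ℓ)) hD]

end

section
variable {V : Type*} [Fintype V] [Nonempty V]

theorem exists_line_shortcuts {d : V → V → ℝ} (hd : IsPDist d) {f : V → ℝ} {M : ℝ}
    (hM : 0 < M) (hf : ∀ v, 0 ≤ f v ∧ f v ≤ 2 * M) :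
    ∃ P : Finset (V × V), ∑ a ∈ P, d a.1 a.2 ≤ 192 * M ∧
      ∀ δ, Dominated d f P δ → ∀ t q : ℕ, 16 ^ t ≤ q → q < 16 ^ (t + 1) → ∀ u v,
        d u v ≤ M / 2 ^ q → δ u v ≤ 24 * q * 32 ^ t * (M / 2 ^ q) := by
  have hfam : ∀ t q : ℕ, ∃ P : Finset (V × V), ∑ a ∈ P, d a.1 a.2 ≤ 6 * M / 32 ^ t ∧
      (16 ^ t ≤ q → ∀ δ, Dominated d f P δ → ∀ u v,
        d u v ≤ M / 2 ^ q → δ u v ≤ 24 * q * 32 ^ t * (M / 2 ^ q)) := by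
    intro t q
    by_cases hq : 16 ^ t ≤ q
    · have p32 : (1 : ℝ) ≤ 32 ^ t := one_le_pow₀ (by norm_num)
      have hle : (32 : ℝ) ^ t ≤ 2 ^ q := by
        have : (32 : ℝ) = 2 ^ 5 := by norm_num
        rw [this, ← pow_mul]
        refine pow_le_pow_right₀ (by norm_num) (le_trans ?_ hq)
        clear hq this p32
        induction t with
        | zero => simp
        | succ t ih =>
          have : 1 ≤ 16 ^ t := Nat.one_le_pow _ _ (by norm_num)
          rw [pow_succ]; omega
      have hD : 0 < M / 2 ^ q := by positivity
      obtain ⟨P, hP, hPδ⟩ := exists_line_tier hd hf (ρ := 32 ^ t * (M / 2 ^ q)) (D := M / 2 ^ q)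
        (by positivity) (by
          rw [← mul_div_assoc, div_le_iff₀ (by positivity), mul_comm]
          gcongr) hD.le (q + 2) (by
          rw [div_lt_iff₀ (by positivity)]
          have : (2 : ℝ) ^ (q + 2) * (32 ^ t * (M / 2 ^ q)) = 4 * 32 ^ t * M := by
            rw [pow_add]; field_simp; norm_num
          rw [this]; nlinarith)
      refine ⟨P, hP.trans (le_of_eq (by field_simp)), fun _ δ hδ u v huv =>
        (hPδ δ hδ u v huv).trans ?_⟩
      have hq1 : (1 : ℝ) ≤ q := by
        have : 1 ≤ q := le_trans (Nat.one_le_pow _ _ (by norm_num)) hq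
        exact_mod_cast this
      calc (2 * ((q + 2 : ℕ) : ℝ) + 2) * (M / 2 ^ q + 2 * (32 ^ t * (M / 2 ^ q)))
          = (2 * q + 6) * ((1 + 2 * 32 ^ t) * (M / 2 ^ q)) := by push_cast; ring
        _ ≤ (8 * q) * ((32 ^ t + 2 * 32 ^ t) * (M / 2 ^ q)) := by gcongr; linarith
        _ = _ := by ring
    · exact ⟨∅, by simp; positivity, fun h => absurd h hq⟩
  choose P hPc hPδ using hfam
  obtain ⟨Q, hQ, hQc⟩ := exists_union_cost_le_block P (fun a => d a.1 a.2)
    (fun a => hd.nonneg _ _) (fun t => 16 ^ (t + 1))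
    (fun t => 6 * M / 32 ^ t) (fun t i _ => hPc t i)
    (192 * M) (by
      intro T
      calc _ = ∑ t ∈ range T, 96 * M * (1 / 2) ^ t := by
            refine Finset.sum_congr rfl fun t _ => ?_
            have : (32 : ℝ) ^ t = 16 ^ t * 2 ^ t := by rw [← mul_pow]; norm_num
            rw [this, one_div_pow]
            push_cast
            rw [pow_succ]
            field_simp
            norm_num
        _ = 96 * M * ∑ t ∈ range T, (1 / 2 : ℝ) ^ t := by rw [Finset.mul_sum]
        _ ≤ 96 * M * 2 := by gcongr; exact sum_inv_two_pow_le T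
        _ = _ := by ring)
  exact ⟨Q, hQc, fun δ hδ t q h1 h2 => hPδ t q h1 δ (hδ.mono (hQ t q h2))⟩

/-- Cheap shortcuts on a line of length `2 M`: distances are preserved up to a polylogarithmic
factor at all scales, for points whose balls are populous enough. -/
theorem exists_shortcuts {d : V → V → ℝ} (hd : IsPDist d) {f : V → ℝ} {M : ℝ}
    (hM : 0 < M) (hf : ∀ v, 0 ≤ f v ∧ f v ≤ 2 * M) :
    ∃ P : Finset (V × V), ∑ a ∈ P, d a.1 a.2 ≤ 3264 * M ∧
      ∀ δ, Dominated d f P δ → ∀ ℓ D, 2 ≤ ℓ → 0 < D → ∀ u v, d u v ≤ D →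
        (D * (4 * ℓ ^ 2) ≤ M →
          (2 : ℝ) ^ (-(ℓ + 2)) * Fintype.card V ≤ ((pball d u D).card : ℝ) →
          (2 : ℝ) ^ (-(ℓ + 2)) * Fintype.card V ≤ ((pball d v D).card : ℝ) →
          δ u v ≤ 40000 * ℓ ^ 2 * √(√ℓ) * D) ∧
        (∀ L, 0 < L → L ≤ 2 * ℓ → D * (1536 * ℓ * √ℓ * (2 : ℝ) ^ L) ≤ M →
          (2 : ℝ) ^ (-L) * Fintype.card V ≤ ((pball d u D).card : ℝ) →
          (2 : ℝ) ^ (-L) * Fintype.card V ≤ ((pball d v D).card : ℝ) →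
          δ u v ≤ 40000 * ℓ ^ 2 * D) := by
  obtain ⟨P1, hP1, h1⟩ := exists_populous_shortcuts hd hM hf
  obtain ⟨P2, hP2, h2⟩ := exists_line_shortcuts hd hM hf
  refine ⟨P1 ∪ P2, ?_, ?_⟩
  · have := Finset.sum_union_inter (s₁ := P1) (s₂ := P2) (f := fun a => d a.1 a.2)
    have h2 : 0 ≤ ∑ a ∈ P1 ∩ P2, d a.1 a.2 := Finset.sum_nonneg fun a _ => hd.nonneg _ _
    linarith
  · intro δ hδ ℓ D hℓ hD u v huv
    have hδ1 := hδ.mono (Finset.subset_union_left (s₁ := P1) (s₂ := P2))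
    have hδ2 := hδ.mono (Finset.subset_union_right (s₁ := P1) (s₂ := P2))
    have hsq1 : 1 ≤ √(√ℓ) := by
      rw [Real.one_le_sqrt, Real.one_le_sqrt]; linarith
    refine ⟨?_, fun L hL0 hLℓ hDM hu hv => h1 δ hδ1 ℓ L D hℓ hL0 hLℓ hD hDM u v huv hu hv⟩
    intro hDM hu hv
    have hMD : 16 ≤ M / D := by
      rw [le_div_iff₀ hD]
      have : 16 ≤ 4 * ℓ ^ 2 := by nlinarith
      nlinarith
    obtain ⟨q, hq1, hq2⟩ := exists_nat_pow_near (by linarith : 1 ≤ M / D) (one_lt_two (α := ℝ))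
    rw [le_div_iff₀ hD] at hq1
    have hq2' := hq2
    rw [div_lt_iff₀ hD, pow_succ] at hq2
    have p2q : (0 : ℝ) < 2 ^ q := by positivity
    by_cases hqℓ : (q : ℝ) ≤ 10 * ℓ
    · have hq0 : q ≠ 0 := by
        rintro rfl
        norm_num at hq2'; linarith
      set t := Nat.log 16 q with ht
      have ht1 : 16 ^ t ≤ q := Nat.pow_log_le_self 16 hq0
      have ht2 : q < 16 ^ (t + 1) := Nat.lt_pow_succ_log_self (by norm_num) q
      have hD1 : D ≤ M / 2 ^ q := by rw [le_div_iff₀ p2q]; linarith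
      have hD2 : M / 2 ^ q ≤ 2 * D := by rw [div_le_iff₀ p2q]; linarith
      refine (h2 δ hδ2 t q ht1 ht2 u v (huv.trans hD1)).trans ?_
      have e16 : (16 : ℝ) ^ t ≤ 10 * ℓ := le_trans (by exact_mod_cast ht1) hqℓ
      have e2 : (2 : ℝ) ^ t ≤ 2 * √(√ℓ) := by
        have e4 : (2 : ℝ) ^ t = √(√(16 ^ t)) := by
          rw [show (16 : ℝ) = 4 * 4 by norm_num, mul_pow, Real.sqrt_mul_self (by positivity),
            show (4 : ℝ) = 2 * 2 by norm_num, mul_pow, Real.sqrt_mul_self (by positivity)]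
        have e5 : 2 * √(√ℓ) = √(√(16 * ℓ)) := by
          rw [Real.sqrt_mul (by norm_num), show (16 : ℝ) = 4 * 4 by norm_num,
            Real.sqrt_mul_self (by positivity), Real.sqrt_mul (by norm_num),
            show (4 : ℝ) = 2 * 2 by norm_num, Real.sqrt_mul_self (by positivity)]
        rw [e4, e5]
        apply Real.sqrt_le_sqrt
        apply Real.sqrt_le_sqrt
        linarith
      have e32 : (32 : ℝ) ^ t = 16 ^ t * 2 ^ t := by rw [← mul_pow]; norm_num
      calc 24 * (q : ℝ) * 32 ^ t * (M / 2 ^ q)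
          ≤ 24 * (10 * ℓ) * ((10 * ℓ) * (2 * √(√ℓ))) * (2 * D) := by
            rw [e32]; gcongr
        _ = 9600 * (ℓ ^ 2 * √(√ℓ) * D) := by ring
        _ ≤ 40000 * (ℓ ^ 2 * √(√ℓ) * D) := by gcongr; norm_num
        _ = _ := by ring
    · rw [not_le] at hqℓ
      have hb := h1 δ hδ1 ℓ (ℓ + 2) D hℓ (by linarith) (by linarith) hD ?_ u v huv hu hv
      · refine hb.trans ?_
        have : 0 ≤ 40000 * ℓ ^ 2 := by positivity
        nlinarith [mul_nonneg this hD.le]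
      · have hsq : √ℓ ≤ ℓ := by
          rw [Real.sqrt_le_left (by linarith)]; nlinarith
        have k1 : 1536 * ℓ * √ℓ * (2 : ℝ) ^ (ℓ + 2) ≤ 2 ^ q := by
          have hlℓ : ℓ ≤ (2 : ℝ) ^ ℓ := by
            have := one_add_mul_self_le_rpow_one_add (by norm_num : (-1 : ℝ) ≤ 1)
              (by linarith : 1 ≤ ℓ)
            norm_num at this
            linarith
          have c1 : (1536 : ℝ) ≤ 2 ^ (12 : ℝ) := by norm_num
          calc 1536 * ℓ * √ℓ * (2 : ℝ) ^ (ℓ + 2)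
              ≤ 1536 * ℓ * ℓ * (2 : ℝ) ^ (ℓ + 2) := by gcongr
            _ ≤ 2 ^ (12 : ℝ) * 2 ^ ℓ * 2 ^ ℓ * (2 : ℝ) ^ (ℓ + 2) := by gcongr
            _ = 2 ^ (12 + ℓ + ℓ + (ℓ + 2)) := by
              rw [← Real.rpow_add (by norm_num), ← Real.rpow_add (by norm_num),
                ← Real.rpow_add (by norm_num)]
            _ ≤ 2 ^ (q : ℝ) := by
              apply Real.rpow_le_rpow_of_exponent_le (by norm_num)
              linarith
            _ = 2 ^ q := Real.rpow_natCast _ _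
        calc D * (1536 * ℓ * √ℓ * (2 : ℝ) ^ (ℓ + 2)) ≤ D * 2 ^ q := by gcongr
          _ ≤ M := by linarith

end

section
variable {V : Type*} {G H : SimpleGraph V} {w : Sym2 V → ℝ}

/-- Weighted length of a walk. -/
def wlen (w : Sym2 V → ℝ) {u v : V} (p : G.Walk u v) : ℝ := (p.edges.map w).sum

@[simp] theorem wlen_nil (u : V) : wlen w (SimpleGraph.Walk.nil : G.Walk u u) = 0 := by
  simp [wlen]

@[simp] theorem wlen_cons {u v x : V} (h : G.Adj u v) (p : G.Walk v x) :
    wlen w (SimpleGraph.Walk.cons h p) = w s(u, v) + wlen w p := by simp [wlen]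

theorem wlen_append {u v x : V} (p : G.Walk u v) (q : G.Walk v x) :
    wlen w (p.append q) = wlen w p + wlen w q := by simp [wlen]

theorem wlen_reverse {u v : V} (p : G.Walk u v) : wlen w p.reverse = wlen w p := by
  simp [wlen, List.sum_reverse]

theorem wlen_mapLe (h : G ≤ H) {u v : V} (p : G.Walk u v) : wlen w (p.mapLe h) = wlen w p := by
  simp [wlen]

theorem wlen_nonneg (hw : ∀ e ∈ G.edgeSet, 0 < w e) {u v : V} (p : G.Walk u v) :
    0 ≤ wlen w p := by
  refine List.sum_nonneg fun x hx => ?_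
  obtain ⟨e, he, rfl⟩ := List.mem_map.1 hx
  exact (hw e (p.edges_subset_edgeSet he)).le

theorem wdist_le_wlen (hw : ∀ e ∈ G.edgeSet, 0 < w e) {u v : V} (p : G.Walk u v) :
    wdist G w u v ≤ wlen w p := by
  refine csInf_le ⟨0, ?_⟩ ⟨p, rfl⟩
  rintro _ ⟨q, rfl⟩
  exact wlen_nonneg hw q

theorem wlen_eq_sum_of_isPath {u v : V} {p : G.Walk u v} (hp : p.IsPath) :
    wlen w p = ∑ e ∈ p.edges.toFinset, w e := by
  rw [List.sum_toFinset _ hp.isTrail.edges_nodup, wlen]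

theorem wlen_le_of_isPath_of_subset (hw : ∀ e ∈ G.edgeSet, 0 < w e) {u v : V} {p q : G.Walk u v}
    (hp : p.IsPath) (h : p.edges ⊆ q.edges) : wlen w p ≤ wlen w q := by
  rw [wlen, wlen]
  have hsub : (p.edges : Multiset (Sym2 V)) ≤ q.edges :=
    (Multiset.le_iff_subset (by exact_mod_cast hp.isTrail.edges_nodup)).2 (by intro a; exact @h a)
  have hsp : p.edges.Subperm q.edges := Multiset.coe_le.1 hsub
  obtain ⟨l, hl1, hl2⟩ := hsp
  rw [← (hl1.map w).sum_eq]
  refine (hl2.map w).sum_le_sum fun x hx => ?_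
  obtain ⟨e, he, rfl⟩ := List.mem_map.1 hx
  exact (hw e (q.edges_subset_edgeSet he)).le

theorem wdist_nonneg (hw : ∀ e ∈ G.edgeSet, 0 < w e) (u v : V) : 0 ≤ wdist G w u v := by
  refine Real.sInf_nonneg ?_
  rintro _ ⟨q, rfl⟩
  exact wlen_nonneg hw q

theorem wdist_self (hw : ∀ e ∈ G.edgeSet, 0 < w e) (u : V) : wdist G w u u = 0 :=
  le_antisymm (by simpa using wdist_le_wlen (G := G) hw (SimpleGraph.Walk.nil : G.Walk u u))
    (wdist_nonneg hw _ _)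

theorem wdist_symm (u v : V) : wdist G w u v = wdist G w v u := by
  rw [wdist, wdist]
  congr 1
  ext x
  constructor
  · rintro ⟨p, rfl⟩; exact ⟨p.reverse, (wlen_reverse (w := w) p).symm⟩
  · rintro ⟨p, rfl⟩; exact ⟨p.reverse, (wlen_reverse (w := w) p).symm⟩

theorem wdist_le_of_adj (hw : ∀ e ∈ G.edgeSet, 0 < w e) {u v : V} (h : G.Adj u v) :
    wdist G w u v ≤ w s(u, v) := by
  have := wdist_le_wlen hw h.toWalk
  simpa using this

variable [Fintype V]

theorem exists_path_wlen_eq (hw : ∀ e ∈ G.edgeSet, 0 < w e) {u v : V} (h : G.Reachable u v) :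
    ∃ p : G.Walk u v, p.IsPath ∧ wlen w p = wdist G w u v := by
  set S : Set ℝ := {x | ∃ p : G.Walk u v, p.IsPath ∧ wlen w p = x} with hS
  have hfin : S.Finite := by
    refine (Set.toFinite ((fun s : Finset (Sym2 V) => ∑ e ∈ s, w e) '' Set.univ)).subset ?_
    rintro _ ⟨p, hp, rfl⟩
    exact ⟨_, trivial, (wlen_eq_sum_of_isPath hp).symm⟩
  obtain ⟨p0⟩ := h
  have hne : S.Nonempty := ⟨_, p0.bypass, p0.bypass_isPath, rfl⟩
  obtain ⟨x, ⟨p, hp, rfl⟩, hmin⟩ := Set.exists_min_image S id hfin hne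
  refine ⟨p, hp, le_antisymm ?_ (wdist_le_wlen hw p)⟩
  refine le_csInf ⟨_, p0, rfl⟩ ?_
  rintro _ ⟨q, rfl⟩
  refine (hmin _ ⟨q.bypass, q.bypass_isPath, rfl⟩).trans ?_
  exact wlen_le_of_isPath_of_subset hw q.bypass_isPath q.edges_bypass_subset_edges

theorem wdist_triangle (hw : ∀ e ∈ G.edgeSet, 0 < w e) {u v x : V} (h1 : G.Reachable u v)
    (h2 : G.Reachable v x) : wdist G w u x ≤ wdist G w u v + wdist G w v x := by
  obtain ⟨p, -, hp⟩ := exists_path_wlen_eq hw h1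
  obtain ⟨q, -, hq⟩ := exists_path_wlen_eq hw h2
  rw [← hp, ← hq, ← wlen_append]
  exact wdist_le_wlen hw _

theorem isPDist_wdist (hG : G.Connected) (hw : ∀ e ∈ G.edgeSet, 0 < w e) :
    IsPDist (wdist G w) :=
  ⟨wdist_nonneg hw, wdist_self hw, wdist_symm, fun u v x =>
    wdist_triangle hw (hG.preconnected u v) (hG.preconnected v x)⟩

theorem wdist_anti (hGH : G ≤ H) (hw : ∀ e ∈ H.edgeSet, 0 < w e) {u v : V}
    (h : G.Reachable u v) : wdist H w u v ≤ wdist G w u v := by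
  have hw' : ∀ e ∈ G.edgeSet, 0 < w e := fun e he => hw e (SimpleGraph.edgeSet_mono hGH he)
  obtain ⟨p, -, hp⟩ := exists_path_wlen_eq hw' h
  rw [← hp, ← wlen_mapLe hGH]
  exact wdist_le_wlen hw _

theorem wdist_mono_weight {w' : Sym2 V → ℝ} (hw : ∀ e ∈ G.edgeSet, 0 < w e)
    (hww : ∀ e ∈ G.edgeSet, w e ≤ w' e) {u v : V}
    (h : G.Reachable u v) : wdist G w u v ≤ wdist G w' u v := by
  obtain ⟨p, -, hp⟩ := exists_path_wlen_eq (fun e he => (hw e he).trans_le (hww e he)) h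
  rw [← hp]
  refine (wdist_le_wlen hw p).trans ?_
  exact List.sum_le_sum fun e he => hww e (p.edges_subset_edgeSet he)

theorem wlen_le_wWeight (hw : ∀ e ∈ G.edgeSet, 0 < w e) {u v : V} {p : G.Walk u v}
    (hp : p.IsPath) : wlen w p ≤ wWeight G w := by
  rw [wlen_eq_sum_of_isPath hp, wWeight]
  refine Finset.sum_le_sum_of_subset_of_nonneg (fun e he => ?_) fun e he _ => ?_
  · rw [Set.Finite.mem_toFinset]
    exact p.edges_subset_edgeSet (List.mem_toFinset.1 he)
  · rw [Set.Finite.mem_toFinset] at he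
    exact (hw e he).le

theorem wdist_le_wWeight (hG : G.Connected) (hw : ∀ e ∈ G.edgeSet, 0 < w e) (u v : V) :
    wdist G w u v ≤ wWeight G w := by
  obtain ⟨p, hp, h⟩ := exists_path_wlen_eq hw (hG.preconnected u v)
  rw [← h]
  exact wlen_le_wWeight hw hp

theorem wWeight_mono (hGH : G ≤ H) (hw : ∀ e ∈ H.edgeSet, 0 < w e) :
    wWeight G w ≤ wWeight H w := by
  refine Finset.sum_le_sum_of_subset_of_nonneg (fun e he => ?_) fun e he _ => ?_
  · rw [Set.Finite.mem_toFinset] at *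
    exact SimpleGraph.edgeSet_mono hGH he
  · rw [Set.Finite.mem_toFinset] at he
    exact (hw e he).le

theorem wWeight_nonneg (hw : ∀ e ∈ G.edgeSet, 0 < w e) : 0 ≤ wWeight G w :=
  Finset.sum_nonneg fun e he => (hw e ((Set.Finite.mem_toFinset _).1 he)).le

end

section
variable {V : Type*} {G : SimpleGraph V} {w : Sym2 V → ℝ}

theorem exists_adj_boundary (hG : G.Connected) {S : Finset V} {a b : V} (ha : a ∈ S)
    (hb : b ∉ S) : ∃ u ∈ S, ∃ v, v ∉ S ∧ G.Adj u v := by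
  obtain ⟨p⟩ := hG.preconnected a b
  obtain ⟨e, -, h1, h2⟩ := p.exists_boundary_dart (S : Set V) ha hb
  exact ⟨_, h1, _, h2, e.adj⟩

variable [Fintype V]

theorem exists_partial_tour (hG : G.Connected) (hw : ∀ e ∈ G.edgeSet, 0 < w e) (k : ℕ)
    (hk : k + 1 ≤ Fintype.card V) :
    ∃ (S : Finset V) (E : Finset (Sym2 V)) (f : V → ℝ), S.card = k + 1 ∧
      (∀ e ∈ E, e ∈ G.edgeSet ∧ ∀ x ∈ e, x ∈ S) ∧
      (∀ u ∈ S, 0 ≤ f u ∧ f u ≤ 2 * ∑ e ∈ E, w e) ∧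
      ∀ u ∈ S, ∀ v ∈ S, wdist G w u v ≤ |f u - f v| := by
  induction k with
  | zero =>
    obtain ⟨a⟩ := hG.nonempty
    exact ⟨{a}, ∅, fun _ => 0, by simp, by simp, by simp, by simp [wdist_self hw]⟩
  | succ k ih =>
    obtain ⟨S, E, f, hc, hE, hf, hd⟩ := ih (by omega)
    have hb : ∃ b, b ∉ S := by
      by_contra h
      push Not at h
      have : S = univ := Finset.eq_univ_iff_forall.2 h
      rw [this, Finset.card_univ] at hc
      omega
    obtain ⟨b, hb⟩ := hb
    obtain ⟨a, ha⟩ : S.Nonempty := by rw [← Finset.card_pos]; omega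
    obtain ⟨u, hu, v, hv, huv⟩ := exists_adj_boundary hG ha hb
    set c := w s(u, v) with hc'
    have hc0 : 0 < c := hw _ huv
    have hEn : s(u, v) ∉ E := fun h => hv ((hE _ h).2 v (by simp))
    set g : V → ℝ := fun x => if x = v then f u + c else if f u < f x then f x + 2 * c else f x
      with hg
    have hgv : g v = f u + c := by simp [hg]
    have hne : ∀ x ∈ S, x ≠ v := fun x hx h => hv (h ▸ hx)
    have hgS : ∀ x ∈ S, g x = if f u < f x then f x + 2 * c else f x := fun x hx => by
      simp [hg, hne x hx]
    have hkey : ∀ x ∈ S, wdist G w x v ≤ |g x - g v| := by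
      intro x hx
      have h1 := wdist_triangle hw (hG.preconnected x u) (hG.preconnected u v)
      have h2 := wdist_le_of_adj hw huv
      have h3 := hd x hx u hu
      rw [hgv, hgS x hx]
      split_ifs with h
      · rw [abs_of_pos (by linarith)] at h3
        rw [abs_of_pos (by linarith)]
        linarith
      · rw [abs_of_nonpos (by linarith)] at h3
        rw [abs_of_neg (by linarith)]
        linarith
    refine ⟨insert v S, insert s(u, v) E, g, by rw [Finset.card_insert_of_notMem hv, hc],
      ?_, ?_, ?_⟩
    · intro e he
      rcases Finset.mem_insert.1 he with rfl | he
      · refine ⟨huv, fun x hx => ?_⟩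
        rcases Sym2.mem_iff.1 hx with rfl | rfl
        · exact Finset.mem_insert_of_mem hu
        · exact Finset.mem_insert_self _ _
      · exact ⟨(hE e he).1, fun x hx => Finset.mem_insert_of_mem ((hE e he).2 x hx)⟩
    · intro x hx
      rw [Finset.sum_insert hEn]
      rcases Finset.mem_insert.1 hx with rfl | hx
      · rw [hgv]
        have := hf u hu
        constructor <;> linarith
      · rw [hgS x hx]
        have := hf x hx
        split_ifs <;> constructor <;> linarith
    · intro x hx y hy
      rcases Finset.mem_insert.1 hx with rfl | hx' <;> rcases Finset.mem_insert.1 hy with rfl | hy'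
      · simp [wdist_self hw]
      · rw [wdist_symm, abs_sub_comm]; exact hkey y hy'
      · exact hkey x hx'
      · refine (hd x hx' y hy').trans ?_
        rw [hgS x hx', hgS y hy']
        split_ifs with h1 h2 h2
        · simp
        · rw [abs_of_nonneg (by linarith), abs_of_nonneg (by linarith)]; linarith
        · rw [abs_of_nonpos (by linarith), abs_of_nonpos (by linarith)]; linarith
        · simp

/-- A connected weighted graph maps to a line of twice its weight without contracting any
distance. -/
theorem exists_tour (hG : G.Connected) (hw : ∀ e ∈ G.edgeSet, 0 < w e) :
    ∃ f : V → ℝ, (∀ v, 0 ≤ f v ∧ f v ≤ 2 * wWeight G w) ∧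
      ∀ u v, wdist G w u v ≤ |f u - f v| := by
  have := hG.nonempty
  have hpos : 0 < Fintype.card V := Fintype.card_pos
  obtain ⟨S, E, f, hc, hE, hf, hd⟩ := exists_partial_tour hG hw (Fintype.card V - 1) (by omega)
  have hS : S = univ := by
    rw [← Finset.card_eq_iff_eq_univ]; omega
  subst hS
  refine ⟨f, fun v => ⟨(hf v (mem_univ _)).1, (hf v (mem_univ _)).2.trans ?_⟩,
    fun u v => hd u (mem_univ _) v (mem_univ _)⟩
  have : ∑ e ∈ E, w e ≤ wWeight G w := by
    refine Finset.sum_le_sum_of_subset_of_nonneg (fun e he => ?_) fun e he _ => ?_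
    · rw [Set.Finite.mem_toFinset]; exact (hE e he).1
    · rw [Set.Finite.mem_toFinset] at he
      exact (hw e he).le
  linarith

/-- Adding shortest paths for a set of pairs to a connected spanning subgraph. -/
theorem exists_spanner_of_pairs (hG : G.Connected) (hw : ∀ e ∈ G.edgeSet, 0 < w e)
    {T : SimpleGraph V} (hT : T ≤ G) (P : Finset (V × V)) :
    ∃ H : SimpleGraph V, H ≤ G ∧ T ≤ H ∧
      wWeight H w ≤ wWeight T w + ∑ a ∈ P, wdist G w a.1 a.2 ∧
      ∀ a ∈ P, wdist H w a.1 a.2 ≤ wdist G w a.1 a.2 := by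
  have hp := fun a : V × V => exists_path_wlen_eq hw (hG.preconnected a.1 a.2)
  choose p hp hpw using hp
  set S : Finset (Sym2 V) := P.biUnion fun a => (p a).edges.toFinset with hS
  have hSG : ∀ e ∈ S, e ∈ G.edgeSet := by
    intro e he
    obtain ⟨a, -, he⟩ := Finset.mem_biUnion.1 he
    exact (p a).edges_subset_edgeSet (List.mem_toFinset.1 he)
  have hedge : ∀ e, e ∈ (T ⊔ SimpleGraph.fromEdgeSet (S : Set (Sym2 V))).edgeSet ↔
      e ∈ T.edgeSet ∨ e ∈ S := by
    intro e
    rw [SimpleGraph.edgeSet_sup, SimpleGraph.edgeSet_fromEdgeSet, Set.mem_union, Set.mem_sdiff]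
    constructor
    · rintro (h | h)
      · exact Or.inl h
      · exact Or.inr h.1
    · rintro (h | h)
      · exact Or.inl h
      · exact Or.inr ⟨h, fun hd => G.not_isDiag_of_mem_edgeSet (hSG e h) hd⟩
  have hHG : T ⊔ SimpleGraph.fromEdgeSet (S : Set (Sym2 V)) ≤ G := by
    rw [← SimpleGraph.edgeSet_subset_edgeSet]
    intro e he
    rcases (hedge e).1 he with h | h
    · exact SimpleGraph.edgeSet_mono hT h
    · exact hSG e h
  have hwH := fun e (he : e ∈ (T ⊔ SimpleGraph.fromEdgeSet (S : Set (Sym2 V))).edgeSet) =>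
    hw e (SimpleGraph.edgeSet_mono hHG he)
  refine ⟨_, hHG, le_sup_left, ?_, ?_⟩
  · have h1 : (T ⊔ SimpleGraph.fromEdgeSet (S : Set (Sym2 V))).edgeSet.toFinite.toFinset ⊆
        T.edgeSet.toFinite.toFinset ∪ S := by
      intro e he
      rw [Set.Finite.mem_toFinset] at he
      rw [Finset.mem_union, Set.Finite.mem_toFinset]
      exact (hedge e).1 he
    have h0 : ∀ e ∈ T.edgeSet.toFinite.toFinset ∪ S, 0 < w e := by
      intro e he
      rw [Finset.mem_union, Set.Finite.mem_toFinset] at he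
      exact hwH e ((hedge e).2 he)
    have h2 := Finset.sum_union_inter (s₁ := T.edgeSet.toFinite.toFinset) (s₂ := S) (f := w)
    have h3 : 0 ≤ ∑ e ∈ T.edgeSet.toFinite.toFinset ∩ S, w e := Finset.sum_nonneg fun e he =>
      (h0 e (Finset.mem_union_right _ (Finset.mem_inter.1 he).2)).le
    have h4 : ∑ e ∈ S, w e ≤ ∑ a ∈ P, wdist G w a.1 a.2 := by
      have := sum_biUnion_le P (fun a => (p a).edges.toFinset)
        (fun e => if e ∈ G.edgeSet then w e else 0) (by
          intro e; split_ifs with h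
          · exact (hw e h).le
          · exact le_rfl)
      have hS' : ∑ e ∈ S, w e = ∑ e ∈ S, if e ∈ G.edgeSet then w e else 0 :=
        Finset.sum_congr rfl fun e he => (if_pos (hSG e he)).symm
      rw [hS']
      refine this.trans (le_of_eq (Finset.sum_congr rfl fun a _ => ?_))
      rw [← hpw a, wlen_eq_sum_of_isPath (hp a)]
      exact Finset.sum_congr rfl fun e he =>
        if_pos ((p a).edges_subset_edgeSet (List.mem_toFinset.1 he))
    have h5 : wWeight (T ⊔ SimpleGraph.fromEdgeSet (S : Set (Sym2 V))) w ≤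
        ∑ e ∈ T.edgeSet.toFinite.toFinset ∪ S, w e :=
      Finset.sum_le_sum_of_subset_of_nonneg h1 fun e he _ => (h0 e he).le
    have h6 : wWeight T w = ∑ e ∈ T.edgeSet.toFinite.toFinset, w e := rfl
    linarith
  · intro a ha
    have hmem : ∀ e ∈ (p a).edges, e ∈ (T ⊔ SimpleGraph.fromEdgeSet (S : Set (Sym2 V))).edgeSet :=
      fun e he => (hedge e).2 (Or.inr (Finset.mem_biUnion.2 ⟨a, ha, List.mem_toFinset.2 he⟩))
    rw [← hpw a]
    refine (wdist_le_wlen hwH ((p a).transfer _ hmem)).trans (le_of_eq ?_)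
    simp [wlen]

/-- Every connected spanning subgraph of weight `M` extends to a spanner of weight `O(M)` that
preserves, up to polylogarithmic factors, the distances between points with populous balls. -/
theorem exists_light_spanner (hG : G.Connected) (hw : ∀ e ∈ G.edgeSet, 0 < w e)
    {T : SimpleGraph V} (hT : T ≤ G) (hTc : T.Connected) (hM : 0 < wWeight T w) :
    ∃ H : SimpleGraph V, H ≤ G ∧ H.Connected ∧ wWeight H w ≤ 3265 * wWeight T w ∧
      (∀ u v, wdist H w u v ≤ wWeight T w) ∧
      ∀ ℓ D, 2 ≤ ℓ → 0 < D → ∀ u v, wdist G w u v ≤ D →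
        (D * (4 * ℓ ^ 2) ≤ wWeight T w →
          (2 : ℝ) ^ (-(ℓ + 2)) * Fintype.card V ≤ ((pball (wdist G w) u D).card : ℝ) →
          (2 : ℝ) ^ (-(ℓ + 2)) * Fintype.card V ≤ ((pball (wdist G w) v D).card : ℝ) →
          wdist H w u v ≤ 40000 * ℓ ^ 2 * √(√ℓ) * D) ∧
        (∀ L, 0 < L → L ≤ 2 * ℓ → D * (1536 * ℓ * √ℓ * (2 : ℝ) ^ L) ≤ wWeight T w →
          (2 : ℝ) ^ (-L) * Fintype.card V ≤ ((pball (wdist G w) u D).card : ℝ) →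
          (2 : ℝ) ^ (-L) * Fintype.card V ≤ ((pball (wdist G w) v D).card : ℝ) →
          wdist H w u v ≤ 40000 * ℓ ^ 2 * D) := by
  have := hG.nonempty
  have hwT : ∀ e ∈ T.edgeSet, 0 < w e := fun e he => hw e (SimpleGraph.edgeSet_mono hT he)
  have hd := isPDist_wdist hG hw
  obtain ⟨f, hf, hfd⟩ := exists_tour hTc hwT
  have hGT : ∀ u v, wdist G w u v ≤ wdist T w u v := fun u v =>
    wdist_anti hT hw (hTc.preconnected u v)
  obtain ⟨P, hP, hPδ⟩ := exists_shortcuts hd hM hf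
  obtain ⟨H, hHG, hTH, hHw, hHP⟩ := exists_spanner_of_pairs hG hw hT P
  have hwH : ∀ e ∈ H.edgeSet, 0 < w e := fun e he => hw e (SimpleGraph.edgeSet_mono hHG he)
  have hHc : H.Connected := hTc.mono hTH
  have hHT : ∀ u v, wdist H w u v ≤ wdist T w u v := fun u v =>
    wdist_anti hTH hwH (hTc.preconnected u v)
  refine ⟨H, hHG, hHc, by linarith, fun u v => (hHT u v).trans (wdist_le_wWeight hTc hwT u v), ?_⟩
  exact hPδ (wdist H w) ⟨isPDist_wdist hHc hwH, fun u v => (hHT u v).trans (hfd u v), hHP⟩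

end

/-- A maximal inequality for bounded monotone functions: some point of every interval has all its
symmetric increments controlled by the average slope. -/
theorem exists_increment_le {φ : ℝ → ℝ} {Φ : ℝ} (hφ : Monotone φ) (h0 : ∀ x, 0 ≤ φ x)
    (h1 : ∀ x, φ x ≤ Φ) (p : ℝ) {l : ℝ} (hl : 0 < l) :
    ∃ r, p ≤ r ∧ r ≤ p + l ∧ ∀ δ, 0 < δ → φ (r + δ) - φ (r - δ) ≤ 7 * Φ * δ / l := by
  by_contra hcon
  push Not at hcon
  have hcon' : ∀ r, ∃ δ, 0 < δ ∧
      (r ∈ Set.Icc p (p + l) → 7 * Φ * δ / l < φ (r + δ) - φ (r - δ)) := by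
    intro r
    by_cases hr : r ∈ Set.Icc p (p + l)
    · obtain ⟨δ, h, h'⟩ := hcon r hr.1 hr.2
      exact ⟨δ, h, fun _ => h'⟩
    · exact ⟨1, one_pos, fun h => absurd h hr⟩
  choose δ hδ hinc using hcon'
  obtain ⟨t, ht, hcov⟩ := (isCompact_Icc (a := p) (b := p + l)).elim_nhds_subcover
    (fun r => Metric.ball r (δ r)) (fun r _ => Metric.ball_mem_nhds r (hδ r))
  obtain ⟨B, hBt, hind, hgr⟩ := exists_greedy t (fun r => -δ r)
    (fun r r' => |r - r'| ≤ δ r + δ r') (fun r => by simp; linarith [hδ r])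
  have hsum : ∑ r ∈ B, (φ (r + δ r) - φ (r - δ r)) ≤ Φ - 0 := by
    refine sum_length_le B (fun r => φ (r - δ r)) (fun r => φ (r + δ r) - φ (r - δ r)) 0
      (fun r _ => sub_nonneg.2 (hφ (by linarith [hδ r]))) (fun r _ => h0 _) ?_ Φ
      ((h0 0).trans (h1 0)) (fun r _ => by simpa using h1 _)
    intro a ha b hb hab
    have hn := hind a ha b hb hab
    have hlt : δ a + δ b < |a - b| := by
      by_contra h
      rw [not_lt] at h
      exact hn ⟨h, by rw [abs_sub_comm, add_comm]; exact h⟩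
    rcases le_total a b with h | h
    · left
      rw [abs_of_nonpos (by linarith)] at hlt
      have := hφ (show a + δ a ≤ b - δ b by linarith)
      linarith
    · right
      rw [abs_of_nonneg (by linarith)] at hlt
      have := hφ (show b + δ b ≤ a - δ a by linarith)
      linarith
  have hlen : l ≤ ∑ r ∈ B, 6 * δ r := by
    have hcov2 : Set.Icc p (p + l) ⊆ ⋃ r ∈ B, Set.Icc (r - 3 * δ r) (r + 3 * δ r) := by
      intro y hy
      have := hcov hy
      simp only [Set.mem_iUnion, Metric.mem_ball, Real.dist_eq, exists_prop] at this ⊢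
      obtain ⟨r, hr, hyr⟩ := this
      obtain ⟨b, hb, hrb, hδb⟩ := hgr r hr
      refine ⟨b, hb, ?_⟩
      rw [abs_lt] at hyr
      rw [abs_le] at hrb
      constructor <;> linarith
    have hm := (MeasureTheory.measure_mono (μ := MeasureTheory.volume) hcov2).trans
      (MeasureTheory.measure_biUnion_finset_le B _)
    simp only [Real.volume_Icc] at hm
    rw [← ENNReal.ofReal_sum_of_nonneg (fun r _ => by linarith [hδ r]),
      ENNReal.ofReal_le_ofReal_iff (Finset.sum_nonneg fun r _ => by linarith [hδ r])] at hm
    calc l = p + l - p := by ring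
      _ ≤ _ := hm
      _ = _ := Finset.sum_congr rfl fun r _ => by ring
  have hBne : B.Nonempty := by
    by_contra h
    rw [Finset.not_nonempty_iff_eq_empty] at h
    rw [h] at hlen; simp at hlen; linarith
  have hlt : ∑ r ∈ B, 7 * Φ * δ r / l < ∑ r ∈ B, (φ (r + δ r) - φ (r - δ r)) :=
    Finset.sum_lt_sum_of_nonempty hBne fun r hr => hinc r (ht r (hBt hr))
  have e : ∑ r ∈ B, 7 * Φ * δ r / l = 7 * Φ / l / 6 * ∑ r ∈ B, 6 * δ r := by
    rw [Finset.mul_sum]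
    exact Finset.sum_congr rfl fun r _ => by ring
  have hΦ : 0 ≤ Φ := (h0 0).trans (h1 0)
  have : 7 * Φ / l / 6 * l ≤ 7 * Φ / l / 6 * ∑ r ∈ B, 6 * δ r := by gcongr
  have e2 : 7 * Φ / l / 6 * l = 7 / 6 * Φ := by field_simp
  linarith

theorem sqrt_sqrt_pow_four {x : ℝ} (hx : 0 ≤ x) : √(√x) ^ 4 = x := by
  have : √(√x) ^ 4 = (√(√x) ^ 2) ^ 2 := by ring
  rw [this, Real.sq_sqrt (Real.sqrt_nonneg _), Real.sq_sqrt hx]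

section
variable {V : Type*}

theorem exists_thin_level {S : ℝ → Finset V} (hS : Monotone S) {n ξ : ℝ} (hn : 0 < n)
    (hS1 : ∀ z, ((S z).card : ℝ) ≤ n * ξ ^ 8) (p : ℝ) {l : ℝ} (hl : 0 < l) :
    ∃ r, p ≤ r ∧ r ≤ p + l ∧ ∀ β, 0 ≤ β → ((S r).card : ℝ) = n * β ^ 8 → ∀ δ, 0 < δ →
      ((S (r + 2 * δ)).card : ℝ) - (S (r - 2 * δ)).card ≤
        16 * 14 ^ 4 * n * (δ / l * β ^ 6 * ξ ^ 2 + (δ / l) ^ 4 * ξ ^ 8) := by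
  set φ : ℝ → ℝ := fun z => √(√((S z).card / n)) with hφ
  have hmono : Monotone φ := by
    intro a b hab
    apply Real.sqrt_le_sqrt
    apply Real.sqrt_le_sqrt
    have := Finset.card_le_card (hS hab)
    gcongr
  have hφ4 : ∀ z, φ z ^ 4 = (S z).card / n := fun z => sqrt_sqrt_pow_four (by positivity)
  have hφ0 : ∀ z, 0 ≤ φ z := fun z => Real.sqrt_nonneg _
  have hle : ∀ z, φ z ≤ ξ ^ 2 := by
    intro z
    refine le_of_pow_le_pow_left₀ (n := 4) (by norm_num) (by positivity) ?_
    rw [hφ4, div_le_iff₀ hn]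
    have := hS1 z
    calc _ ≤ _ := this
      _ = _ := by ring
  obtain ⟨r, hr1, hr2, hr⟩ := exists_increment_le hmono hφ0 hle p hl
  refine ⟨r, hr1, hr2, fun β hβ hrβ δ hδ => ?_⟩
  have hφr : φ r = β ^ 2 := by
    refine (pow_left_inj₀ (hφ0 r) (by positivity) (by norm_num : (4 : ℕ) ≠ 0)).1 ?_
    rw [hφ4, hrβ]; field_simp
  set s := 14 * (δ / l) * ξ ^ 2 with hs
  have hs0 : 0 ≤ s := by positivity
  have h1 := hr (2 * δ) (by linarith)
  have e1 : 7 * ξ ^ 2 * (2 * δ) / l = s := by rw [hs]; ring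
  rw [e1] at h1
  set y := φ (r + 2 * δ) with hy
  set x := φ (r - 2 * δ) with hx
  have hxr : x ≤ β ^ 2 := hφr ▸ hmono (by linarith)
  have hx0 : 0 ≤ x := hφ0 _
  have hy0 : 0 ≤ y := hφ0 _
  have hxy : x ≤ y := hmono (by linarith)
  have hβ2 : 0 ≤ β ^ 2 := by positivity
  have h2 : y ^ 4 - x ^ 4 ≤ 16 * (s * (β ^ 2) ^ 3 + s ^ 4) := by
    have a1 : y ^ 4 - x ^ 4 = (y - x) * (y ^ 3 + y ^ 2 * x + y * x ^ 2 + x ^ 3) := by ring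
    have a2 : y ^ 3 + y ^ 2 * x + y * x ^ 2 + x ^ 3 ≤ 4 * y ^ 3 := by
      have b1 : y ^ 2 * x ≤ y ^ 2 * y := by gcongr
      have b2 : y * x ^ 2 ≤ y * y ^ 2 := by gcongr
      have b3 : x ^ 3 ≤ y ^ 3 := by gcongr
      nlinarith
    have a3 : y ^ 3 ≤ (β ^ 2 + s) ^ 3 := by gcongr; linarith
    have a4 : (β ^ 2 + s) ^ 3 ≤ 4 * ((β ^ 2) ^ 3 + s ^ 3) := by
      nlinarith [mul_nonneg (add_nonneg hβ2 hs0) (sq_nonneg (β ^ 2 - s))]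
    have a5 : 0 ≤ y ^ 3 + y ^ 2 * x + y * x ^ 2 + x ^ 3 := by positivity
    calc y ^ 4 - x ^ 4 = (y - x) * (y ^ 3 + y ^ 2 * x + y * x ^ 2 + x ^ 3) := a1
      _ ≤ s * (4 * (4 * ((β ^ 2) ^ 3 + s ^ 3))) := by gcongr; linarith
      _ = _ := by ring
  rw [hφ4, hφ4, ← sub_div, div_le_iff₀ hn] at h2
  refine h2.trans ?_
  have e3 : 16 * (s * (β ^ 2) ^ 3 + s ^ 4) * n = 16 * n * (14 * (δ / l * β ^ 6 * ξ ^ 2) +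
    14 ^ 4 * ((δ / l) ^ 4 * ξ ^ 8)) := by rw [hs]; ring
  rw [e3]
  have : 0 ≤ n * (δ / l * β ^ 6 * ξ ^ 2) := by positivity
  nlinarith

/-- A cut value `r` of `f` in an interval of length `l`, such that few points lie close to the
cut, in terms of the smaller side of the cut. -/
theorem exists_thin_cut (X : Finset V) (f : V → ℝ) {n ξ : ℝ} (hn : 0 < n)
    (hX : (X.card : ℝ) = n * ξ ^ 8) (p : ℝ) {l : ℝ} (hl : 0 < l) :
    ∃ r, p ≤ r ∧ r ≤ p + l ∧ ∀ β, 0 ≤ β →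
      (min (X.filter fun v => f v ≤ r).card (X.filter fun v => r < f v).card : ℝ) = n * β ^ 8 →
      ∀ δ, 0 < δ → ((X.filter fun v => |f v - r| ≤ δ).card : ℝ) ≤
        10 ^ 7 * n * (δ / l * β ^ 6 * ξ ^ 2 + (δ / l) ^ 4 * ξ ^ 8) := by
  have hsplit : ∀ r, (X.filter fun v => f v ≤ r).card + (X.filter fun v => r < f v).card =
      X.card := by
    intro r
    have := Finset.card_filter_add_card_filter_not (s := X) (fun v => f v ≤ r)
    simpa only [not_le] using this
  have hconst : ∀ β δ : ℝ, 0 ≤ β → 0 < δ →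
      16 * 14 ^ 4 * n * (δ / (l / 2) * β ^ 6 * ξ ^ 2 + (δ / (l / 2)) ^ 4 * ξ ^ 8) ≤
        10 ^ 7 * n * (δ / l * β ^ 6 * ξ ^ 2 + (δ / l) ^ 4 * ξ ^ 8) := by
    intro β δ hβ hδ
    have e : δ / (l / 2) = 2 * (δ / l) := by field_simp
    rw [e]
    have h1 : 0 ≤ n * (δ / l * β ^ 6 * ξ ^ 2) := by positivity
    have h2 : 0 ≤ n * ((δ / l) ^ 4 * ξ ^ 8) := by positivity
    nlinarith
  have hsub : ∀ q : V → Prop, ((X.filter q).card : ℝ) ≤ n * ξ ^ 8 := fun q => by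
    rw [← hX]; exact_mod_cast Finset.card_filter_le X q
  rcases le_total (2 * (X.filter fun v => f v ≤ p + l / 2).card) X.card with h | h
  · obtain ⟨r, hr1, hr2, hr⟩ := exists_thin_level (S := fun z => X.filter fun v => f v ≤ z)
      (fun a b hab v hv => by
        rw [Finset.mem_filter] at hv ⊢; exact ⟨hv.1, hv.2.trans hab⟩) hn
      (fun z => hsub _) p (half_pos hl)
    refine ⟨r, hr1, by linarith, fun β hβ hb δ hδ => ?_⟩
    have hle : (X.filter fun v => f v ≤ r).card ≤ (X.filter fun v => r < f v).card := by
      have h1 : (X.filter fun v => f v ≤ r).card ≤ (X.filter fun v => f v ≤ p + l / 2).card :=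
        Finset.card_le_card fun v hv => by
          rw [Finset.mem_filter] at hv ⊢; exact ⟨hv.1, hv.2.trans hr2⟩
      have := hsplit r
      omega
    rw [min_eq_left (by exact_mod_cast hle)] at hb
    refine le_trans ?_ ((hr β hβ hb δ hδ).trans (hconst β δ hβ hδ))
    rw [le_sub_iff_add_le]
    have hdis : Disjoint (X.filter fun v => |f v - r| ≤ δ)
        (X.filter fun v => f v ≤ r - 2 * δ) := by
      rw [Finset.disjoint_left]
      intro v hv hv'
      rw [Finset.mem_filter, abs_le] at hv
      rw [Finset.mem_filter] at hv'
      linarith [hv.2.1, hv'.2]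
    rw [← Nat.cast_add, ← Finset.card_union_of_disjoint hdis]
    refine Nat.cast_le.2 (Finset.card_le_card fun v hv => ?_)
    rw [Finset.mem_union, Finset.mem_filter, Finset.mem_filter, abs_le] at hv
    rw [Finset.mem_filter]
    rcases hv with hv | hv
    · exact ⟨hv.1, by linarith [hv.2.2]⟩
    · exact ⟨hv.1, by linarith [hv.2]⟩
  · obtain ⟨r, hr1, hr2, hr⟩ := exists_thin_level (S := fun z => X.filter fun v => -f v < z)
      (fun a b hab v hv => by
        rw [Finset.mem_filter] at hv ⊢; exact ⟨hv.1, hv.2.trans_le hab⟩) hn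
      (fun z => hsub _) (-(p + l)) (half_pos hl)
    refine ⟨-r, by linarith, by linarith, fun β hβ hb δ hδ => ?_⟩
    have hle : (X.filter fun v => -r < f v).card ≤ (X.filter fun v => f v ≤ -r).card := by
      have h1 : (X.filter fun v => f v ≤ p + l / 2).card ≤ (X.filter fun v => f v ≤ -r).card :=
        Finset.card_le_card fun v hv => by
          rw [Finset.mem_filter] at hv ⊢; exact ⟨hv.1, hv.2.trans (by linarith)⟩
      have := hsplit (-r)
      omega
    rw [min_eq_right (by exact_mod_cast hle)] at hb
    have heq : (X.filter fun v => -f v < r) = X.filter fun v => -r < f v := by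
      ext v; simp only [Finset.mem_filter, and_congr_right_iff]
      intro _; constructor <;> intro h <;> linarith
    rw [← heq] at hb
    refine le_trans ?_ ((hr β hβ hb δ hδ).trans (hconst β δ hβ hδ))
    rw [le_sub_iff_add_le]
    have hdis : Disjoint (X.filter fun v => |f v - -r| ≤ δ)
        (X.filter fun v => -f v < r - 2 * δ) := by
      rw [Finset.disjoint_left]
      intro v hv hv'
      rw [Finset.mem_filter, abs_le] at hv
      rw [Finset.mem_filter] at hv'
      linarith [hv.2.2, hv'.2]
    rw [← Nat.cast_add, ← Finset.card_union_of_disjoint hdis]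
    refine Nat.cast_le.2 (Finset.card_le_card fun v hv => ?_)
    rw [Finset.mem_union, Finset.mem_filter, Finset.mem_filter, abs_le] at hv
    rw [Finset.mem_filter]
    rcases hv with hv | hv
    · exact ⟨hv.1, by linarith [hv.2.1]⟩
    · exact ⟨hv.1, by linarith [hv.2]⟩

end

section
variable {V : Type*}

theorem card_pairs_fst_le (B : Finset (V × V)) (W : Finset V) (u : V)
    (h : ∀ v, (u, v) ∈ B → v ∈ W) : (B.filter (fun p => p.1 = u)).card ≤ W.card := by
  refine card_le_card_of_injOn Prod.snd ?_ ?_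
  · rintro ⟨a, b⟩ hp
    rw [mem_coe, mem_filter] at hp
    obtain ⟨hp, rfl⟩ := hp
    exact h b hp
  · rintro ⟨a, b⟩ hp ⟨a', b'⟩ hp' e
    rw [mem_coe, mem_filter] at hp hp'
    exact Prod.ext (hp.2.trans hp'.2.symm) e

theorem card_pairs_snd_le (B : Finset (V × V)) (W : Finset V) (u : V)
    (h : ∀ v, (v, u) ∈ B → v ∈ W) : (B.filter (fun p => p.2 = u)).card ≤ W.card := by
  refine card_le_card_of_injOn Prod.fst ?_ ?_
  · rintro ⟨a, b⟩ hp
    rw [mem_coe, mem_filter] at hp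
    obtain ⟨hp, rfl⟩ := hp
    exact h a hp
  · rintro ⟨a, b⟩ hp ⟨a', b'⟩ hp' e
    rw [mem_coe, mem_filter] at hp hp'
    exact Prod.ext e (hp.2.trans hp'.2.symm)

theorem card_pairs_touching_le (B : Finset (V × V)) (D : Finset V) {m : ℝ}
    (h1 : ∀ u ∈ D, ∃ W : Finset V, (W.card : ℝ) ≤ m ∧
      ∀ v, ((u, v) ∈ B → v ∈ W) ∧ ((v, u) ∈ B → v ∈ W)) :
    ((B.filter (fun p => p.1 ∈ D ∨ p.2 ∈ D)).card : ℝ) ≤ 2 * m * D.card := by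
  have hsub : B.filter (fun p => p.1 ∈ D ∨ p.2 ∈ D) ⊆
      D.biUnion (fun u => B.filter (fun p => p.1 = u)) ∪
        D.biUnion (fun u => B.filter (fun p => p.2 = u)) := by
    intro p hp
    rw [mem_filter] at hp
    simp only [mem_union, mem_biUnion, mem_filter]
    rcases hp.2 with h | h
    · exact Or.inl ⟨_, h, hp.1, rfl⟩
    · exact Or.inr ⟨_, h, hp.1, rfl⟩
  have hc := (card_le_card hsub).trans ((card_union_le _ _).trans
    (add_le_add card_biUnion_le card_biUnion_le))
  have hc' : ((B.filter (fun p => p.1 ∈ D ∨ p.2 ∈ D)).card : ℝ) ≤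
      ∑ u ∈ D, ((B.filter (fun p => p.1 = u)).card : ℝ) +
        ∑ u ∈ D, ((B.filter (fun p => p.2 = u)).card : ℝ) := by exact_mod_cast hc
  have e1 : ∑ u ∈ D, ((B.filter (fun p => p.1 = u)).card : ℝ) ≤ D.card • m := by
    refine sum_le_card_nsmul _ _ _ fun u hu => ?_
    obtain ⟨W, hW, h⟩ := h1 u hu
    exact le_trans (by exact_mod_cast card_pairs_fst_le B W u fun v => (h v).1) hW
  have e2 : ∑ u ∈ D, ((B.filter (fun p => p.2 = u)).card : ℝ) ≤ D.card • m := by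
    refine sum_le_card_nsmul _ _ _ fun u hu => ?_
    obtain ⟨W, hW, h⟩ := h1 u hu
    exact le_trans (by exact_mod_cast card_pairs_snd_le B W u fun v => (h v).2) hW
  rw [nsmul_eq_mul] at e1 e2
  linarith

theorem card_pairs_within_le (B : Finset (V × V)) (W : Finset V)
    (h : ∀ p ∈ B, p.1 ∈ W ∧ p.2 ∈ W) : (B.card : ℝ) ≤ (W.card : ℝ) ^ 2 := by
  have : B ⊆ W ×ˢ W := fun p hp => mem_product.2 (h p hp)
  have := card_le_card this
  rw [card_product] at this
  rw [sq]
  exact_mod_cast this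

theorem card_pairs_mixed_le (B : Finset (V × V)) (W : Finset V) {m : ℝ}
    (hW : ∀ p ∈ B, p.1 ∈ W ∧ p.2 ∈ W) (h : ∀ p ∈ B, (∃ U : Finset V, (U.card : ℝ) ≤ m ∧
      ∀ v, (p.1, v) ∈ B → v ∈ U) ∨ (∃ U : Finset V, (U.card : ℝ) ≤ m ∧
      ∀ v, (v, p.2) ∈ B → v ∈ U)) (hm : 0 ≤ m) : (B.card : ℝ) ≤ 2 * m * W.card := by
  have hsub : B ⊆ (W.filter (fun u => ((B.filter (fun p => p.1 = u)).card : ℝ) ≤ m)).biUnion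
      (fun u => B.filter (fun p => p.1 = u)) ∪
        (W.filter (fun u => ((B.filter (fun p => p.2 = u)).card : ℝ) ≤ m)).biUnion
          (fun u => B.filter (fun p => p.2 = u)) := by
    intro p hp
    simp only [mem_union, mem_biUnion, mem_filter]
    rcases h p hp with ⟨U, hU, h'⟩ | ⟨U, hU, h'⟩
    · exact Or.inl ⟨p.1, ⟨(hW p hp).1,
        le_trans (by exact_mod_cast card_pairs_fst_le B U p.1 h') hU⟩, hp, rfl⟩
    · exact Or.inr ⟨p.2, ⟨(hW p hp).2,
        le_trans (by exact_mod_cast card_pairs_snd_le B U p.2 h') hU⟩, hp, rfl⟩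
  have hc := (card_le_card hsub).trans ((card_union_le _ _).trans
    (add_le_add card_biUnion_le card_biUnion_le))
  have hc' : (B.card : ℝ) ≤
      ∑ u ∈ W.filter (fun u => ((B.filter (fun p => p.1 = u)).card : ℝ) ≤ m),
        ((B.filter (fun p => p.1 = u)).card : ℝ) +
      ∑ u ∈ W.filter (fun u => ((B.filter (fun p => p.2 = u)).card : ℝ) ≤ m),
        ((B.filter (fun p => p.2 = u)).card : ℝ) := by exact_mod_cast hc
  have e1 := sum_le_card_nsmul (W.filter (fun u => ((B.filter (fun p => p.1 = u)).card : ℝ) ≤ m))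
    (fun u => ((B.filter (fun p => p.1 = u)).card : ℝ)) m (fun u hu => (mem_filter.1 hu).2)
  have e2 := sum_le_card_nsmul (W.filter (fun u => ((B.filter (fun p => p.2 = u)).card : ℝ) ≤ m))
    (fun u => ((B.filter (fun p => p.2 = u)).card : ℝ)) m (fun u hu => (mem_filter.1 hu).2)
  rw [nsmul_eq_mul] at e1 e2
  have f1 : ((W.filter (fun u => ((B.filter (fun p => p.1 = u)).card : ℝ) ≤ m)).card : ℝ) ≤
    W.card := by exact_mod_cast card_filter_le _ _
  have f2 : ((W.filter (fun u => ((B.filter (fun p => p.2 = u)).card : ℝ) ≤ m)).card : ℝ) ≤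
    W.card := by exact_mod_cast card_filter_le _ _
  have := mul_le_mul_of_nonneg_right f1 hm
  have := mul_le_mul_of_nonneg_right f2 hm
  linarith

end

section
variable {V : Type*}

theorem card_pairs_remove_le {B : Finset (V × V)} {A A1 : Finset V} {m : ℝ} (hA1 : A1 ⊆ A)
    (hBA : ∀ p ∈ B, p.1 ∈ A ∧ p.2 ∈ A)
    (h : ∀ u ∈ A, u ∉ A1 → ∃ W : Finset V, (W.card : ℝ) ≤ m ∧
      ∀ v, ((u, v) ∈ B → v ∈ W) ∧ ((v, u) ∈ B → v ∈ W)) :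
    (B.card : ℝ) ≤ 2 * m * ((A.card : ℝ) - A1.card) +
      ((B.filter (fun p => p.1 ∈ A1 ∧ p.2 ∈ A1)).card : ℝ) := by
  have h1 := card_pairs_touching_le B (A \ A1)
    (fun u hu => h u (mem_sdiff.1 hu).1 (mem_sdiff.1 hu).2)
  have hcA : ((A \ A1).card : ℝ) = A.card - A1.card := by
    have := card_sdiff_add_card_eq_card hA1
    have : (((A \ A1).card + A1.card : ℕ) : ℝ) = A.card := by rw [this]
    push_cast at this; linarith
  rw [hcA] at h1
  have hsub : B ⊆ B.filter (fun p => p.1 ∈ A \ A1 ∨ p.2 ∈ A \ A1) ∪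
      B.filter (fun p => p.1 ∈ A1 ∧ p.2 ∈ A1) := by
    intro p hp
    have hpA := hBA p hp
    rw [mem_union, mem_filter, mem_filter, mem_sdiff, mem_sdiff]
    tauto
  have h2 := (card_le_card hsub).trans (card_union_le _ _)
  have h3 : (B.card : ℝ) ≤ (B.filter (fun p => p.1 ∈ A \ A1 ∨ p.2 ∈ A \ A1)).card +
      (B.filter (fun p => p.1 ∈ A1 ∧ p.2 ∈ A1)).card := by exact_mod_cast h2
  linarith

theorem exists_cut_count [Fintype V] {d dH : V → V → ℝ} (hd : IsPDist d) {supp : V → V → Finset V}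
    {s lam D a n r β ξ : ℝ} {f : V → ℝ} {A Y : Finset V} {B : Finset (V × V)}
    (hn : 0 < n) (hs : 0 < s) (hlam : 1 ≤ lam) (hsl : s ^ 2 * lam ^ 4 ≤ 2)
    (hβ0 : 0 ≤ β) (hβ1 : β ≤ 1) (hξ0 : 0 ≤ ξ) (hξ1 : ξ ≤ 1)
    (hdense : ∀ u v, d u v ≤ D → s ^ 2 / 16 * n ≤ ((pball d u D).card : ℝ) →
      s ^ 2 / 16 * n ≤ ((pball d v D).card : ℝ) → 2 * dH u v ≤ 1 / 10 ^ 10 * s * lam * a)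
    (hpop : ∀ u v, d u v ≤ D → s / lam ^ 2 * n ≤ ((pball d u D).card : ℝ) →
      s / lam ^ 2 * n ≤ ((pball d v D).card : ℝ) → 2 * dH u v ≤ 1 / 10 ^ 10 * s * a)
    (hN : ∀ y, 0 < y → ((Y.filter (fun v => |f v - r| ≤ y * a)).card : ℝ) ≤
      10 ^ 7 * n * (y * β ^ 6 * ξ + y ^ 4 * ξ ^ 4))
    (hBA : ∀ p ∈ B, p.1 ∈ A ∧ p.2 ∈ A) (hBd : ∀ p ∈ B, d p.1 p.2 ≤ D)
    (hBs : ∀ p ∈ B, supp p.1 p.2 ⊆ Y ∧ p.1 ∈ supp p.1 p.2 ∧ p.2 ∈ supp p.1 p.2)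
    (hBf : ∀ p ∈ B, ∀ x ∈ supp p.1 p.2, ∀ y ∈ supp p.1 p.2, |f x - f y| ≤ 2 * dH p.1 p.2) :
    ∃ A1 ⊆ A, (B.card : ℝ) ≤ s ^ 2 / 8 * n * ((A.card : ℝ) - A1.card) +
      ((B.filter (fun p => p.1 ∈ A1 ∧ p.2 ∈ A1 ∧
        supp p.1 p.2 ⊆ Y.filter (fun v => f v ≤ r))).card : ℝ) +
      ((B.filter (fun p => p.1 ∈ A1 ∧ p.2 ∈ A1 ∧
        supp p.1 p.2 ⊆ Y.filter (fun v => r < f v))).card : ℝ) +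
      1 / 50 * s ^ 2 * n ^ 2 * β ^ 8 * ξ := by
  have hsym := hd.symm
  have hsplit : ∀ A1 : Finset V, ((B.filter (fun p => p.1 ∈ A1 ∧ p.2 ∈ A1)).card : ℝ) ≤
        ((B.filter (fun p => p.1 ∈ A1 ∧ p.2 ∈ A1 ∧
          supp p.1 p.2 ⊆ Y.filter (fun v => f v ≤ r))).card : ℝ) +
        ((B.filter (fun p => p.1 ∈ A1 ∧ p.2 ∈ A1 ∧
          supp p.1 p.2 ⊆ Y.filter (fun v => r < f v))).card : ℝ) +
      ((B.filter (fun p => (p.1 ∈ A1 ∧ p.2 ∈ A1) ∧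
        ¬ supp p.1 p.2 ⊆ Y.filter (fun v => f v ≤ r) ∧
        ¬ supp p.1 p.2 ⊆ Y.filter (fun v => r < f v))).card : ℝ) := by
    intro A1
    have hsub : B.filter (fun p => p.1 ∈ A1 ∧ p.2 ∈ A1) ⊆
        (B.filter (fun p => p.1 ∈ A1 ∧ p.2 ∈ A1 ∧
          supp p.1 p.2 ⊆ Y.filter (fun v => f v ≤ r)) ∪
        B.filter (fun p => p.1 ∈ A1 ∧ p.2 ∈ A1 ∧
          supp p.1 p.2 ⊆ Y.filter (fun v => r < f v))) ∪
        B.filter (fun p => (p.1 ∈ A1 ∧ p.2 ∈ A1) ∧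
        ¬ supp p.1 p.2 ⊆ Y.filter (fun v => f v ≤ r) ∧
        ¬ supp p.1 p.2 ⊆ Y.filter (fun v => r < f v)) := by
      intro p hp
      rw [mem_union, mem_union, mem_filter, mem_filter, mem_filter]
      rw [mem_filter] at hp
      tauto
    have h2 := (card_le_card hsub).trans ((card_union_le _ _).trans
      (add_le_add_left (card_union_le _ _) _))
    exact_mod_cast h2
  -- points of a cut pair are near the cut
  have hann : ∀ p ∈ B, ¬ supp p.1 p.2 ⊆ Y.filter (fun v => f v ≤ r) →
      ¬ supp p.1 p.2 ⊆ Y.filter (fun v => r < f v) →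
      |f p.1 - r| ≤ 2 * dH p.1 p.2 ∧ |f p.2 - r| ≤ 2 * dH p.1 p.2 := by
    intro p hp h1 h2
    obtain ⟨hY, hp1, hp2⟩ := hBs p hp
    obtain ⟨x, hx, hx'⟩ := not_subset.1 h1
    obtain ⟨y, hy, hy'⟩ := not_subset.1 h2
    have hx' : r < f x := by
      by_contra h
      exact hx' (mem_filter.2 ⟨hY hx, not_lt.1 h⟩)
    have hy' : f y ≤ r := by
      by_contra h
      exact hy' (mem_filter.2 ⟨hY hy, not_le.1 h⟩)
    have hf := hBf p hp
    constructor
    · have a1 := abs_le.1 (hf _ hp1 _ hx)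
      have a2 := abs_le.1 (hf _ hp1 _ hy)
      rw [abs_le]; constructor <;> linarith
    · have a1 := abs_le.1 (hf _ hp2 _ hx)
      have a2 := abs_le.1 (hf _ hp2 _ hy)
      rw [abs_le]; constructor <;> linarith
  set A0 := A.filter (fun u => s ^ 2 / 16 * n ≤ ((pball d u D).card : ℝ)) with hA0
  have hA0A : A0 ⊆ A := filter_subset _ _
  have hsparse : ∀ u ∈ A, u ∉ A0 → ∃ W : Finset V, (W.card : ℝ) ≤ s ^ 2 / 16 * n ∧
        ∀ v, ((u, v) ∈ B → v ∈ W) ∧ ((v, u) ∈ B → v ∈ W) := by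
    intro u hu hu0
    rw [mem_filter, not_and, not_le] at hu0
    refine ⟨pball d u D, (hu0 hu).le, fun v => ⟨fun h => ?_, fun h => ?_⟩⟩
    · exact mem_pball.2 (hBd _ h)
    · exact mem_pball.2 (by rw [hsym]; exact hBd _ h)
  set y0 := 1 / 10 ^ 10 * s * lam with hy0
  set y1 := 1 / 10 ^ 10 * s with hy1
  have hy0p : 0 < y0 := by positivity
  have hy1p : 0 < y1 := by positivity
  have hdense0 : ∀ p ∈ B, p.1 ∈ A0 → p.2 ∈ A0 → 2 * dH p.1 p.2 ≤ y0 * a := fun p hp h1 h2 =>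
    hdense _ _ (hBd p hp) (mem_filter.1 h1).2 (mem_filter.1 h2).2
  have hrem0 := card_pairs_remove_le hA0A hBA hsparse
  have hs2 : s ^ 2 * lam ^ 4 * s ^ 2 ≤ 2 * s ^ 2 := by gcongr
  rcases lt_or_ge (β ^ 2) (y0 * ξ) with hcase | hcase
  · set A1 := A0.filter (fun u => y0 * a < |f u - r|) with hA1
    have hA10 : A1 ⊆ A0 := filter_subset _ _
    have hrem1 := card_pairs_remove_le (m := s ^ 2 / 16 * n)
      (B := B.filter (fun p => p.1 ∈ A0 ∧ p.2 ∈ A0)) hA10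
      (fun p hp => (mem_filter.1 hp).2) (by
        intro u hu hu1
        rw [mem_filter, not_and, not_lt] at hu1
        have hu1 := hu1 hu
        refine ⟨Y.filter (fun v => |f v - r| ≤ (2 * y0) * a), ?_, ?_⟩
        · refine (hN _ (by positivity)).trans ?_
          have h1 : β ^ 6 ≤ y0 ^ 3 := by
            calc β ^ 6 = (β ^ 2) ^ 3 := by ring
              _ ≤ (y0 * ξ) ^ 3 := by gcongr
              _ ≤ (y0 * 1) ^ 3 := by gcongr
              _ = _ := by ring
          have h2 : ξ ^ 4 ≤ 1 := pow_le_one₀ hξ0 hξ1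
          have h3 : y0 ^ 4 ≤ 1 / 10 ^ 40 * (2 * s ^ 2) := by
            rw [hy0, hy1]
            calc _ = 1 / 10 ^ 40 * (s ^ 2 * lam ^ 4 * s ^ 2) := by ring
              _ ≤ _ := by gcongr
          calc _ ≤ 10 ^ 7 * n * (2 * y0 * y0 ^ 3 * 1 + (2 * y0) ^ 4 * 1) := by gcongr
            _ = 10 ^ 7 * n * 18 * y0 ^ 4 := by ring
            _ ≤ 10 ^ 7 * n * 18 * (1 / 10 ^ 40 * (2 * s ^ 2)) := by gcongr
            _ ≤ _ := by
              have : 0 < n * s ^ 2 := by positivity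
              nlinarith
        · have key : ∀ p ∈ B, p.1 ∈ A0 → p.2 ∈ A0 → |f p.1 - f p.2| ≤ y0 * a :=
            fun p hp h1 h2 => (hBf p hp _ (hBs p hp).2.1 _ (hBs p hp).2.2).trans
              (hdense0 p hp h1 h2)
          have hu1' := abs_le.1 hu1
          refine fun v => ⟨fun h => ?_, fun h => ?_⟩
          · rw [mem_filter] at h
            have h' := abs_le.1 (key _ h.1 h.2.1 h.2.2)
            refine mem_filter.2 ⟨(hBs _ h.1).1 (hBs _ h.1).2.2, ?_⟩
            rw [abs_le]; constructor <;> linarith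
          · rw [mem_filter] at h
            have h' := abs_le.1 (key _ h.1 h.2.1 h.2.2)
            refine mem_filter.2 ⟨(hBs _ h.1).1 (hBs _ h.1).2.1, ?_⟩
            rw [abs_le]; constructor <;> linarith)
    refine ⟨A1, hA10.trans hA0A, ?_⟩
    have hz : (B.filter (fun p => (p.1 ∈ A1 ∧ p.2 ∈ A1) ∧
        ¬ supp p.1 p.2 ⊆ Y.filter (fun v => f v ≤ r) ∧
        ¬ supp p.1 p.2 ⊆ Y.filter (fun v => r < f v))) = ∅ := by
      rw [filter_eq_empty_iff]
      rintro p hp ⟨⟨h1, h2⟩, h3, h4⟩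
      have := (hann p hp h3 h4).1
      have h5 := hdense0 p hp (hA10 h1) (hA10 h2)
      have h6 := (mem_filter.1 h1).2
      linarith
    have h3 := hsplit A1
    rw [hz, card_empty, Nat.cast_zero, add_zero] at h3
    have h4 : (((B.filter (fun p => p.1 ∈ A0 ∧ p.2 ∈ A0)).filter
        (fun p => p.1 ∈ A1 ∧ p.2 ∈ A1)).card : ℝ) ≤
        (B.filter (fun p => p.1 ∈ A1 ∧ p.2 ∈ A1)).card := by
      exact_mod_cast card_le_card (filter_subset_filter _ (filter_subset _ _))
    have h5 : 0 ≤ 1 / 50 * s ^ 2 * n ^ 2 * β ^ 8 * ξ := by positivity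
    linarith
  · have hNy : ∀ y, 0 < y → y ≤ y0 → ((Y.filter (fun v => |f v - r| ≤ y * a)).card : ℝ) ≤
        2 * 10 ^ 7 * n * (y * β ^ 6 * ξ) := by
      intro y hy hyy
      refine (hN y hy).trans ?_
      have h1 : (y * ξ) ^ 3 ≤ (β ^ 2) ^ 3 := by
        refine pow_le_pow_left₀ (by positivity) (le_trans (by gcongr) hcase) 3
      have h2 : y ^ 4 * ξ ^ 4 ≤ y * β ^ 6 * ξ := by
        calc y ^ 4 * ξ ^ 4 = y * (y * ξ) ^ 3 * ξ := by ring
          _ ≤ y * (β ^ 2) ^ 3 * ξ := by gcongr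
          _ = _ := by ring
      calc _ ≤ 10 ^ 7 * n * (y * β ^ 6 * ξ + y * β ^ 6 * ξ) := by gcongr
        _ = _ := by ring
    have hcut : ∀ p ∈ B.filter (fun p => (p.1 ∈ A0 ∧ p.2 ∈ A0) ∧
        ¬ supp p.1 p.2 ⊆ Y.filter (fun v => f v ≤ r) ∧
        ¬ supp p.1 p.2 ⊆ Y.filter (fun v => r < f v)),
        p.1 ∈ Y.filter (fun v => |f v - r| ≤ y0 * a) ∧
        p.2 ∈ Y.filter (fun v => |f v - r| ≤ y0 * a) := by
      intro p hp
      rw [mem_filter] at hp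
      obtain ⟨hp, ⟨h1, h2⟩, h3, h4⟩ := hp
      have := hann p hp h3 h4
      have h5 := hdense0 p hp h1 h2
      obtain ⟨hY, hp1, hp2⟩ := hBs p hp
      exact ⟨mem_filter.2 ⟨hY hp1, this.1.trans h5⟩, mem_filter.2 ⟨hY hp2, this.2.trans h5⟩⟩
    suffices hQ : ((B.filter (fun p => (p.1 ∈ A0 ∧ p.2 ∈ A0) ∧
        ¬ supp p.1 p.2 ⊆ Y.filter (fun v => f v ≤ r) ∧
        ¬ supp p.1 p.2 ⊆ Y.filter (fun v => r < f v))).card : ℝ) ≤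
        1 / 50 * s ^ 2 * n ^ 2 * β ^ 8 * ξ by
      refine ⟨A0, hA0A, ?_⟩
      have := hsplit A0
      linarith
    set Q := B.filter (fun p => (p.1 ∈ A0 ∧ p.2 ∈ A0) ∧
        ¬ supp p.1 p.2 ⊆ Y.filter (fun v => f v ≤ r) ∧
        ¬ supp p.1 p.2 ⊆ Y.filter (fun v => r < f v)) with hQdef
    have hX : 0 ≤ s ^ 2 * n ^ 2 * β ^ 8 * ξ := by positivity
    rcases le_or_gt (lam * β ^ 2) 1 with hl | hl
    · refine (card_pairs_within_le _ _ hcut).trans ?_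
      have h1 : (lam * β ^ 2) ^ 2 ≤ 1 := pow_le_one₀ (by positivity) hl
      calc _ ≤ (2 * 10 ^ 7 * n * (y0 * β ^ 6 * ξ)) ^ 2 := by
            gcongr; exact hNy y0 hy0p le_rfl
        _ = 4 / 10 ^ 6 * (s ^ 2 * n ^ 2 * β ^ 8 * ξ) * ((lam * β ^ 2) ^ 2 * ξ) := by
            rw [hy0, hy1]; ring
        _ ≤ 4 / 10 ^ 6 * (s ^ 2 * n ^ 2 * β ^ 8 * ξ) * (1 * 1) := by gcongr
        _ ≤ _ := by linarith
    · have hy10 : y1 ≤ y0 := by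
        rw [hy0]; exact le_mul_of_one_le_right hy1p.le hlam
      have hpopc : ((Q.filter (fun p => s / lam ^ 2 * n ≤ ((pball d p.1 D).card : ℝ) ∧
          s / lam ^ 2 * n ≤ ((pball d p.2 D).card : ℝ))).card : ℝ) ≤
          (2 * 10 ^ 7 * n * (y1 * β ^ 6 * ξ)) ^ 2 := by
        refine (card_pairs_within_le _ (Y.filter (fun v => |f v - r| ≤ y1 * a)) ?_).trans
          (by gcongr; exact hNy y1 hy1p hy10)
        intro p hp
        rw [mem_filter, hQdef, mem_filter] at hp
        obtain ⟨⟨hp, -, h3, h4⟩, h1, h2⟩ := hp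
        have := hann p hp h3 h4
        have h5 := hpop _ _ (hBd p hp) h1 h2
        obtain ⟨hY, hp1, hp2⟩ := hBs p hp
        exact ⟨mem_filter.2 ⟨hY hp1, this.1.trans h5⟩, mem_filter.2 ⟨hY hp2, this.2.trans h5⟩⟩
      have hmid : ((Q.filter (fun p => ¬ (s / lam ^ 2 * n ≤ ((pball d p.1 D).card : ℝ) ∧
          s / lam ^ 2 * n ≤ ((pball d p.2 D).card : ℝ)))).card : ℝ) ≤
          2 * (s / lam ^ 2 * n) * (2 * 10 ^ 7 * n * (y0 * β ^ 6 * ξ)) := by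
        refine (card_pairs_mixed_le _ (Y.filter (fun v => |f v - r| ≤ y0 * a))
          (m := s / lam ^ 2 * n) ?_ ?_ (by positivity)).trans
            (by gcongr; exact hNy y0 hy0p le_rfl)
        · exact fun p hp => hcut p (mem_filter.1 hp).1
        · intro p hp
          have h := (mem_filter.1 hp).2
          have hQB : ∀ q ∈ Q.filter (fun p => ¬ (s / lam ^ 2 * n ≤ ((pball d p.1 D).card : ℝ) ∧
            s / lam ^ 2 * n ≤ ((pball d p.2 D).card : ℝ))), q ∈ B := fun q hq =>
            (mem_filter.1 (mem_filter.1 hq).1).1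
          rw [not_and_or, not_le, not_le] at h
          rcases h with h | h
          · exact Or.inl ⟨_, h.le, fun v hv => mem_pball.2 (hBd _ (hQB _ hv))⟩
          · exact Or.inr ⟨_, h.le, fun v hv => mem_pball.2 (by rw [hsym]; exact hBd _ (hQB _ hv))⟩
      have hsum := card_filter_add_card_filter_not (s := Q)
        (fun p => s / lam ^ 2 * n ≤ ((pball d p.1 D).card : ℝ) ∧
          s / lam ^ 2 * n ≤ ((pball d p.2 D).card : ℝ))
      have hsum' : (Q.card : ℝ) =
          ((Q.filter (fun p => s / lam ^ 2 * n ≤ ((pball d p.1 D).card : ℝ) ∧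
          s / lam ^ 2 * n ≤ ((pball d p.2 D).card : ℝ))).card : ℝ) +
          ((Q.filter (fun p => ¬ (s / lam ^ 2 * n ≤ ((pball d p.1 D).card : ℝ) ∧
          s / lam ^ 2 * n ≤ ((pball d p.2 D).card : ℝ)))).card : ℝ) := by
        rw [← hsum]; push_cast; rfl
      have e1 : (2 * 10 ^ 7 * n * (y1 * β ^ 6 * ξ)) ^ 2 ≤
          4 / 10 ^ 6 * (s ^ 2 * n ^ 2 * β ^ 8 * ξ) := by
        calc _ = 4 / 10 ^ 6 * (s ^ 2 * n ^ 2 * β ^ 8 * ξ) * (β ^ 4 * ξ) := by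
              rw [hy1]; ring
          _ ≤ 4 / 10 ^ 6 * (s ^ 2 * n ^ 2 * β ^ 8 * ξ) * (1 ^ 4 * 1) := by gcongr
          _ = _ := by ring
      have e2 : 2 * (s / lam ^ 2 * n) * (2 * 10 ^ 7 * n * (y0 * β ^ 6 * ξ)) ≤
          4 / 10 ^ 3 * (s ^ 2 * n ^ 2 * β ^ 8 * ξ) := by
        have hl0 : lam ≠ 0 := by positivity
        calc _ = 4 / 10 ^ 3 * (s ^ 2 * n ^ 2 * β ^ 6 * ξ) * (1 / lam) := by
              rw [hy0, hy1]; field_simp; ring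
          _ ≤ 4 / 10 ^ 3 * (s ^ 2 * n ^ 2 * β ^ 6 * ξ) * β ^ 2 := by
              gcongr
              rw [div_le_iff₀ (by positivity)]; linarith
          _ = _ := by ring
      linarith

end

section
variable {V : Type*} [Fintype V]

/-- The eighth root of the fraction of the points that lie in `X`. -/
noncomputable def massRoot (X : Finset V) : ℝ := √(√(√((X.card : ℝ) / Fintype.card V)))

theorem massRoot_nonneg (X : Finset V) : 0 ≤ massRoot X := Real.sqrt_nonneg _

theorem massRoot_le_one (X : Finset V) : massRoot X ≤ 1 := by
  have : (X.card : ℝ) / Fintype.card V ≤ 1 :=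
    div_le_one_of_le₀ (by exact_mod_cast card_le_univ X) (Nat.cast_nonneg _)
  simpa only [massRoot, Real.sqrt_le_one] using this

theorem massRoot_mono {X Y : Finset V} (h : X ⊆ Y) : massRoot X ≤ massRoot Y := by
  have := card_le_card h
  unfold massRoot
  gcongr

theorem mul_massRoot_pow [Nonempty V] (X : Finset V) :
    (Fintype.card V : ℝ) * massRoot X ^ 8 = X.card := by
  have hn : (Fintype.card V : ℝ) ≠ 0 := by exact_mod_cast Fintype.card_ne_zero
  have h : (0 : ℝ) ≤ (X.card : ℝ) / Fintype.card V := by positivity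
  have : massRoot X ^ 8 = (X.card : ℝ) / Fintype.card V := by
    rw [massRoot, show 8 = 2 * 2 * 2 by norm_num, pow_mul, pow_mul, Real.sq_sqrt (by positivity),
      Real.sq_sqrt (by positivity), Real.sq_sqrt h]
  rw [this]; field_simp

theorem massRoot_pos [Nonempty V] {X : Finset V} (h : X.Nonempty) : 0 < massRoot X := by
  have : (0 : ℝ) < X.card := by exact_mod_cast h.card_pos
  have hn : (0 : ℝ) < Fintype.card V := by exact_mod_cast Fintype.card_pos
  unfold massRoot
  positivity

theorem massRoot_le_of_two_mul_card_le [Nonempty V] {X Y : Finset V} (h : 2 * X.card ≤ Y.card) :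
    massRoot X ≤ 92 / 100 * massRoot Y := by
  have hn : (0 : ℝ) < Fintype.card V := by exact_mod_cast Fintype.card_pos
  have hY := massRoot_nonneg Y
  refine le_of_pow_le_pow_left₀ (n := 8) (by norm_num) (by positivity) ?_
  refine le_of_mul_le_mul_left ?_ hn
  rw [mul_massRoot_pow, mul_pow, mul_left_comm, mul_massRoot_pow]
  have : (2 : ℝ) * X.card ≤ Y.card := by exact_mod_cast h
  have : (0 : ℝ) ≤ Y.card := by positivity
  norm_num
  linarith

theorem massRoot_add_le {a b x : ℝ} (hb : 0 ≤ b) (hx : 0 ≤ x)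
    (hab : b ^ 8 ≤ a ^ 8) (h : x ^ 8 = a ^ 8 + b ^ 8) :
    a ^ 9 + b ^ 9 + 8 / 100 * b ^ 8 * x ≤ x ^ 9 := by
  have h1 : a ≤ x := le_of_pow_le_pow_left₀ (n := 8) (by norm_num) hx (by
    rw [h]; nlinarith [pow_nonneg hb 8])
  have h2 : b ≤ 92 / 100 * x := le_of_pow_le_pow_left₀ (n := 8) (by norm_num) (by positivity) (by
    rw [mul_pow, h]; norm_num; nlinarith [pow_nonneg hb 8])
  have e : x ^ 9 = a ^ 8 * x + b ^ 8 * x := by rw [pow_succ, h]; ring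
  have e1 : a ^ 9 ≤ a ^ 8 * x := by rw [pow_succ]; gcongr
  have e2 : b ^ 9 ≤ b ^ 8 * (92 / 100 * x) := by rw [pow_succ]; gcongr
  rw [e]; linarith

/-- The distance `dH` is controlled by `d` at all scales up to `Rm`, for points whose balls are
populous enough. -/
structure IsLevel (d dH : V → V → ℝ) (Rm s lam τ : ℝ) : Prop where
  s_pos : 0 < s
  one_le : 1 ≤ lam
  le_two : s ^ 2 * lam ^ 4 ≤ 2
  pos : 0 < τ
  dense : ∀ R, 0 < R → R ≤ Rm → ∀ u v, d u v ≤ τ * R →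
    s ^ 2 / 16 * Fintype.card V ≤ ((pball d u (τ * R)).card : ℝ) →
    s ^ 2 / 16 * Fintype.card V ≤ ((pball d v (τ * R)).card : ℝ) →
    2 * dH u v ≤ 1 / 10 ^ 10 * s * lam * (R / 100)
  populous : ∀ R, 0 < R → R ≤ Rm → ∀ u v, d u v ≤ τ * R →
    s / lam ^ 2 * Fintype.card V ≤ ((pball d u (τ * R)).card : ℝ) →
    s / lam ^ 2 * Fintype.card V ≤ ((pball d v (τ * R)).card : ℝ) →
    2 * dH u v ≤ 1 / 10 ^ 10 * s * (R / 100)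

/-- The pairs of points of `A` at distance at most `D`, supported in `X`, whose distance in `T`
is more than `4 / τ` times larger. -/
noncomputable def badPairs (d : V → V → ℝ) (w : Sym2 V → ℝ) (supp : V → V → Finset V)
    (T : SimpleGraph V) (τ : ℝ) (X A : Finset V) (D : ℝ) : Finset (V × V) :=
  (A ×ˢ A).filter (fun p => d p.1 p.2 ≤ D ∧ supp p.1 p.2 ⊆ X ∧
    ¬ ∃ q : T.Walk p.1 p.2, τ * wlen w q ≤ 4 * d p.1 p.2)

/-- The graph `T` has few bad pairs supported in `X` at scale `R`, at all levels. -/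
def HasFewBad (d dH : V → V → ℝ) (w : Sym2 V → ℝ) (supp : V → V → Finset V) (Rm : ℝ)
    (T : SimpleGraph V) (X : Finset V) (R : ℝ) : Prop :=
  ∀ s lam τ, IsLevel d dH Rm s lam τ → ∀ A ⊆ X,
    ((badPairs d w supp T τ X A (τ * R)).card : ℝ) ≤
      s ^ 2 / 8 * Fintype.card V * A.card +
        s ^ 2 / 4 * (Fintype.card V : ℝ) ^ 2 * massRoot X ^ 9

theorem exists_cut_few_bad [Nonempty V] {d dH : V → V → ℝ} (hd : IsPDist d) {w : Sym2 V → ℝ}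
    {supp : V → V → Finset V} (hsupp : ∀ u v, u ∈ supp u v ∧ v ∈ supp u v)
    {Y : Finset V} (hY : Y.Nonempty) {f : V → ℝ}
    (hf : ∀ u v, supp u v ⊆ Y → ∀ x ∈ supp u v, ∀ y ∈ supp u v, |f x - f y| ≤ 2 * dH u v)
    {R Rm : ℝ} (hR : 0 < R) (hRm : R ≤ Rm) (p : ℝ) :
    ∃ r, p ≤ r ∧ r ≤ p + massRoot Y * R / 100 ∧ ∀ T1 T2 T : SimpleGraph V, T1 ≤ T → T2 ≤ T →
      HasFewBad d dH w supp Rm T1 (Y.filter (fun v => f v ≤ r)) R →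
      HasFewBad d dH w supp Rm T2 (Y.filter (fun v => r < f v)) R →
      HasFewBad d dH w supp Rm T Y R := by
  have hn : (0 : ℝ) < Fintype.card V := by exact_mod_cast Fintype.card_pos
  have hξ := massRoot_pos hY
  obtain ⟨r, hr1, hr2, hr⟩ := exists_thin_cut Y f hn (ξ := massRoot Y)
    (by rw [mul_massRoot_pow]) p (l := massRoot Y * R / 100) (by positivity)
  refine ⟨r, hr1, hr2, fun T1 T2 T hT1 hT2 hb1 hb2 s lam τ hlev A hA => ?_⟩
  set S := Y.filter (fun v => f v ≤ r) with hS
  set S' := Y.filter (fun v => r < f v) with hS'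
  have hcard : (Y.card : ℝ) = S.card + S'.card := by
    have := card_filter_add_card_filter_not (s := Y) (fun v => f v ≤ r)
    simp only [not_le] at this
    rw [← this]; push_cast; rfl
  obtain ⟨β, hβ0, hβ1, hβ, hsup⟩ : ∃ β, 0 ≤ β ∧ β ≤ 1 ∧
      (min S.card S'.card : ℝ) = Fintype.card V * β ^ 8 ∧
      massRoot S ^ 9 + massRoot S' ^ 9 + 8 / 100 * β ^ 8 * massRoot Y ≤ massRoot Y ^ 9 := by
    have h8 : massRoot Y ^ 8 = massRoot S ^ 8 + massRoot S' ^ 8 := by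
      have h1 := mul_massRoot_pow S
      have h2 := mul_massRoot_pow S'
      have h3 := mul_massRoot_pow Y
      refine mul_left_cancel₀ hn.ne' ?_
      linarith
    rcases le_total S.card S'.card with h | h
    · have h' : (S.card : ℝ) ≤ S'.card := by exact_mod_cast h
      refine ⟨massRoot S, massRoot_nonneg _, massRoot_le_one _, ?_, ?_⟩
      · rw [mul_massRoot_pow, min_eq_left h']
      · have := massRoot_add_le (a := massRoot S') (massRoot_nonneg S) (massRoot_nonneg Y)
          (le_of_mul_le_mul_left (by rw [mul_massRoot_pow, mul_massRoot_pow]; exact h') hn)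
          (by linarith)
        linarith
    · have h' : (S'.card : ℝ) ≤ S.card := by exact_mod_cast h
      refine ⟨massRoot S', massRoot_nonneg _, massRoot_le_one _, ?_, ?_⟩
      · rw [mul_massRoot_pow, min_eq_right h']
      · exact massRoot_add_le (a := massRoot S) (massRoot_nonneg S') (massRoot_nonneg Y)
          (le_of_mul_le_mul_left (by rw [mul_massRoot_pow, mul_massRoot_pow]; exact h') hn) h8
  obtain ⟨A1, hA1, hc⟩ := exists_cut_count hd (supp := supp) (dH := dH) (f := f) (r := r) (A := A)
    (Y := Y) (B := badPairs d w supp T τ Y A (τ * R)) (D := τ * R) (a := R / 100) (β := β)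
    (ξ := massRoot Y) hn hlev.s_pos hlev.one_le
    hlev.le_two hβ0 hβ1 hξ.le (massRoot_le_one _) (hlev.dense R hR hRm) (hlev.populous R hR hRm)
    (by
      intro y hy
      refine (hr β hβ0 hβ (y * (R / 100)) (by positivity)).trans (le_of_eq ?_)
      field_simp)
    (fun p hp => mem_product.1 (mem_filter.1 hp).1) (fun p hp => (mem_filter.1 hp).2.1)
    (fun p hp => ⟨(mem_filter.1 hp).2.2.1, hsupp _ _⟩)
    (fun p hp => hf _ _ (mem_filter.1 hp).2.2.1)
  have hpart : ∀ (S : Finset V) (T0 : SimpleGraph V), T0 ≤ T →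
      (badPairs d w supp T τ Y A (τ * R)).filter (fun p => p.1 ∈ A1 ∧ p.2 ∈ A1 ∧
        supp p.1 p.2 ⊆ S) ⊆ badPairs d w supp T0 τ S (A1 ∩ S) (τ * R) := by
    intro S T0 hT0 p hp
    rw [mem_filter, badPairs, mem_filter] at hp
    obtain ⟨⟨-, h1, h2, h3⟩, h4, h5, h6⟩ := hp
    refine mem_filter.2 ⟨mem_product.2 ⟨mem_inter.2 ⟨h4, h6 (hsupp _ _).1⟩,
      mem_inter.2 ⟨h5, h6 (hsupp _ _).2⟩⟩, h1, h6, fun ⟨q, hq⟩ => h3 ⟨q.mapLe hT0, ?_⟩⟩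
    rwa [wlen_mapLe]
  have k1 : (((badPairs d w supp T τ Y A (τ * R)).filter (fun p => p.1 ∈ A1 ∧ p.2 ∈ A1 ∧
        supp p.1 p.2 ⊆ S)).card : ℝ) ≤ _ :=
    le_trans (by exact_mod_cast card_le_card (hpart S T1 hT1))
      (hb1 s lam τ hlev (A1 ∩ S) inter_subset_right)
  have k2 : (((badPairs d w supp T τ Y A (τ * R)).filter (fun p => p.1 ∈ A1 ∧ p.2 ∈ A1 ∧
        supp p.1 p.2 ⊆ S')).card : ℝ) ≤ _ :=
    le_trans (by exact_mod_cast card_le_card (hpart S' T2 hT2))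
      (hb2 s lam τ hlev (A1 ∩ S') inter_subset_right)
  have k3 : ((A1 ∩ S).card : ℝ) + (A1 ∩ S').card ≤ A1.card := by
    have hdis : Disjoint (A1 ∩ S) (A1 ∩ S') := by
      rw [disjoint_left]
      intro x hx hx'
      have h1 := (mem_filter.1 (mem_inter.1 hx).2).2
      have h2 := (mem_filter.1 (mem_inter.1 hx').2).2
      linarith
    have := card_le_card (union_subset (inter_subset_left (s₁ := A1) (s₂ := S))
      (inter_subset_left (s₁ := A1) (s₂ := S')))
    rw [card_union_of_disjoint hdis] at this
    exact_mod_cast this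
  have hs := hlev.s_pos
  have k4 := mul_le_mul_of_nonneg_left k3
    (show 0 ≤ s ^ 2 / 8 * (Fintype.card V : ℝ) by positivity)
  have k5 := mul_le_mul_of_nonneg_left hsup
    (show 0 ≤ s ^ 2 / 4 * (Fintype.card V : ℝ) ^ 2 by positivity)
  linarith

end

section
variable {V : Type*} {H : SimpleGraph V} {w : Sym2 V → ℝ}

theorem abs_sub_le_two_mul_wlen {Y : Finset V} {f : V → ℝ} (hw : ∀ e ∈ H.edgeSet, 0 < w e)
    (hf : ∀ a ∈ Y, ∀ b ∈ Y, H.Adj a b → |f a - f b| ≤ 2 * w s(a, b)) {u v : V} (p : H.Walk u v)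
    (hp : ∀ a ∈ p.support, a ∈ Y) : ∀ x ∈ p.support, ∀ y ∈ p.support,
      |f x - f y| ≤ 2 * wlen w p := by
  induction p with
  | nil => simp
  | @cons a b c h q ih =>
    have ha : a ∈ Y := hp a (by simp)
    have hq : ∀ a ∈ q.support, a ∈ Y := fun x hx => hp x (by simp [hx])
    have hb : b ∈ Y := hq b q.start_mem_support
    have ih := ih hq
    have hab := hf a ha b hb h
    have hpos := hw s(a, b) h
    have hq0 := wlen_nonneg hw q
    have key : ∀ y ∈ q.support, |f a - f y| ≤ 2 * (w s(a, b) + wlen w q) := by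
      intro y hy
      have h1 := abs_sub_le (f a) (f b) (f y)
      have h2 := ih b q.start_mem_support y hy
      linarith
    intro x hx y hy
    rw [SimpleGraph.Walk.support_cons, List.mem_cons] at hx hy
    rw [wlen_cons]
    rcases hx with rfl | hx <;> rcases hy with rfl | hy
    · simp; linarith
    · exact key y hy
    · rw [abs_sub_comm]; exact key x hx
    · have := ih x hx y hy
      linarith

/-- The function `h` is the distance from `x0` along the edges of `H` inside `X`. -/
structure IsDistFn (H : SimpleGraph V) (w : Sym2 V → ℝ) (X : Finset V) (x0 : V) (h : V → ℝ) :
    Prop where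
  mem : x0 ∈ X
  zero : h x0 = 0
  nonneg : ∀ v ∈ X, 0 ≤ h v
  lip : ∀ u ∈ X, ∀ v ∈ X, H.Adj u v → h v ≤ h u + w s(u, v)
  pred : ∀ v ∈ X, v ≠ x0 → ∃ u ∈ X, H.Adj u v ∧ h v = h u + w s(u, v)

theorem IsDistFn.abs_sub_le {X : Finset V} {x0 : V} {h : V → ℝ} (hh : IsDistFn H w X x0 h) :
    ∀ a ∈ X, ∀ b ∈ X, H.Adj a b → |h a - h b| ≤ w s(a, b) := by
  intro a ha b hb hab
  have h1 := hh.lip a ha b hb hab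
  have h2 := hh.lip b hb a ha hab.symm
  rw [Sym2.eq_swap] at h2
  rw [abs_le]; constructor <;> linarith

theorem exists_distFn [Fintype V] (hw : ∀ e ∈ H.edgeSet, 0 < w e) {Y : Finset V} {x : V}
    (hx : x ∈ Y) :
    ∃ C ⊆ Y, ∃ g, IsDistFn H w C x g ∧ ∀ a ∈ C, ∀ b ∈ Y, H.Adj a b → b ∈ C := by
  let H' : SimpleGraph V :=
    { Adj := fun a b => H.Adj a b ∧ a ∈ Y ∧ b ∈ Y
      symm := ⟨fun a b h => ⟨h.1.symm, h.2.2, h.2.1⟩⟩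
      loopless := ⟨fun a h => H.loopless.irrefl a h.1⟩ }
  have hle : H' ≤ H := fun a b h => h.1
  have hw' : ∀ e ∈ H'.edgeSet, 0 < w e := fun e he => hw e (SimpleGraph.edgeSet_mono hle he)
  have hC : ∀ v, v ∈ Y.filter (fun v => H'.Reachable x v) ↔ v ∈ Y ∧ H'.Reachable x v :=
    fun v => mem_filter
  refine ⟨Y.filter (fun v => H'.Reachable x v), filter_subset _ _, wdist H' w x,
    ⟨(hC x).2 ⟨hx, SimpleGraph.Reachable.refl _⟩, wdist_self hw' x,
      fun v _ => wdist_nonneg hw' _ _, ?_, ?_⟩, ?_⟩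
  · intro u hu v hv huv
    rw [hC] at hu hv
    have hadj : H'.Adj u v := ⟨huv, hu.1, hv.1⟩
    have h1 := wdist_triangle hw' hu.2 hadj.reachable
    have h2 := wdist_le_of_adj hw' hadj
    linarith
  · intro v hv hvx
    rw [hC] at hv
    obtain ⟨p, -, hp⟩ := exists_path_wlen_eq hw' hv.2.symm
    cases p with
    | nil => exact absurd rfl hvx
    | @cons _ m _ h q =>
      rw [wlen_cons] at hp
      have hm : H'.Reachable x m := ⟨q.reverse⟩
      refine ⟨m, (hC m).2 ⟨h.2.2, hm⟩, h.1.symm, ?_⟩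
      have h1 := wdist_triangle hw' hm h.symm.reachable
      have h2 := wdist_le_of_adj hw' h.symm
      have h3 := wdist_le_wlen hw' q.reverse
      rw [wlen_reverse] at h3
      rw [wdist_symm, Sym2.eq_swap] at hp
      linarith
  · intro a ha b hb hab
    rw [hC] at *
    exact ⟨hb, ha.2.trans (SimpleGraph.Adj.reachable ⟨hab, ha.1, hb⟩)⟩

theorem IsDistFn.le_add_wlen {X Y : Finset V} {x0 : V} {h : V → ℝ} (hh : IsDistFn H w X x0 h)
    (hXY : ∀ a ∈ X, ∀ b ∈ Y, H.Adj a b → b ∈ X) {u v : V} (p : H.Walk u v)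
    (hp : ∀ a ∈ p.support, a ∈ Y) (hu : u ∈ X) : v ∈ X ∧ h v ≤ h u + wlen w p := by
  induction p with
  | nil => exact ⟨hu, by simp⟩
  | @cons a b c hab q ih =>
    have hq : ∀ a ∈ q.support, a ∈ Y := fun x hx => hp x (by simp [hx])
    have hb := hXY a hu b (hq b q.start_mem_support) hab
    have h1 := ih hq hb
    have h2 := hh.lip a hu b hb hab
    refine ⟨h1.1, ?_⟩
    rw [wlen_cons]; linarith

end

section
variable {V : Type*} [Fintype V] {H : SimpleGraph V} {w : Sym2 V → ℝ}

theorem ncard_edgeSet_sup_edge_le {V : Type*} (T F : SimpleGraph V) {x y : V} (hxy : x ≠ y) :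
    (T ⊔ F ⊔ SimpleGraph.edge x y).edgeSet.ncard ≤ T.edgeSet.ncard + F.edgeSet.ncard + 1 := by
  rw [SimpleGraph.edgeSet_sup, SimpleGraph.edgeSet_sup]
  refine (Set.ncard_union_le _ _).trans (add_le_add (Set.ncard_union_le _ _) ?_)
  rw [SimpleGraph.edgeSet_edge_of_ne hxy, Set.ncard_singleton]

/-- A tree on `X` rooted at `x0`, almost shortest-path, with few bad pairs. -/
def HasStarTree (H : SimpleGraph V) (w : Sym2 V → ℝ) (d dH : V → V → ℝ)
    (supp : V → V → Finset V) (Rm : ℝ) (X : Finset V) (x0 : V) (h : V → ℝ) (R : ℝ) : Prop :=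
  ∃ T : SimpleGraph V, T ≤ H ∧ T.edgeSet.ncard + 1 ≤ X.card ∧
    (∀ v ∈ X, ∃ p : T.Walk v x0, wlen w p ≤ h v + massRoot X * R) ∧
    ∀ R', HasFewBad d dH w supp Rm T X R'

theorem exists_annex_forest [Nonempty V] (hw : ∀ e ∈ H.edgeSet, 0 < w e) {d dH : V → V → ℝ}
    (hd : IsPDist d) {supp : V → V → Finset V} (hsupp : ∀ u v, u ∈ supp u v ∧ v ∈ supp u v)
    (hlip : ∀ (Y : Finset V) (f : V → ℝ),
      (∀ a ∈ Y, ∀ b ∈ Y, H.Adj a b → |f a - f b| ≤ 2 * w s(a, b)) →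
      ∀ u v, supp u v ⊆ Y → ∀ x ∈ supp u v, ∀ y ∈ supp u v, |f x - f y| ≤ 2 * dH u v)
    {X : Finset V} {Rm : ℝ}
    (IH : ∀ Z : Finset V, Z.card < X.card → ∀ x g R, IsDistFn H w Z x g → (∀ v ∈ Z, g v ≤ R) →
      0 < R → R ≤ Rm → HasStarTree H w d dH supp Rm Z x g R)
    {x0 : V} {h : V → ℝ} (hh : IsDistFn H w X x0 h) {R r q : ℝ} (hR : 0 < R) (hRm : R ≤ Rm)
    (hhR : ∀ v ∈ X, h v ≤ R) (hr1 : R / 4 ≤ r) (hr2 : r ≤ R / 4 + massRoot X * R / 100)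
    {TB : SimpleGraph V} (hTB : ∀ v ∈ X.filter (fun v => h v ≤ r),
      ∃ p : TB.Walk v x0, wlen w p ≤ h v + q) (k : ℕ) :
    ∀ Y : Finset V, Y.card ≤ k → Y ⊆ X.filter (fun v => r < h v) →
      (∀ v ∈ Y, ∃ u ∈ X, (h u ≤ r ∨ u ∈ Y) ∧ H.Adj u v ∧ h v = h u + w s(u, v)) →
      ∃ F : SimpleGraph V, F ≤ H ∧ F.edgeSet.ncard ≤ Y.card ∧
        (∀ v ∈ Y, ∃ p : (TB ⊔ F).Walk v x0, wlen w p ≤ h v + (massRoot X * R / 100 + q +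
          massRoot (X.filter (fun v => r < h v)) * (R + massRoot X * R / 100 - r))) ∧
        HasFewBad d dH w supp Rm F Y R := by
  have hξ1 := massRoot_le_one X
  have hξ0 := massRoot_nonneg X
  have hξR : massRoot X * R ≤ 1 * R := by gcongr
  induction k with
  | zero =>
    intro Y hY _ _
    have hY0 : Y = ∅ := card_eq_zero.1 (by omega)
    subst hY0
    refine ⟨⊥, bot_le, by simp, by simp, fun s lam τ hlev A hA => ?_⟩
    rw [subset_empty.1 hA]
    have := massRoot_nonneg (∅ : Finset V)
    have : badPairs d w supp ⊥ τ ∅ ∅ (τ * R) = ∅ := by simp [badPairs]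
    rw [this]
    simp; positivity
  | succ k ih =>
    intro Y hYk hYX hpred
    rcases Y.eq_empty_or_nonempty with hY0 | hYne
    · exact ih Y (by simp [hY0]) hYX hpred
    obtain ⟨x, hxY, hxmin⟩ := exists_min_image Y h hYne
    have hYX' : ∀ v ∈ Y, v ∈ X ∧ r < h v := fun v hv => mem_filter.1 (hYX hv)
    have hr0 : 0 ≤ r := by linarith
    have hx0Y : x0 ∉ Y := fun h0 => by
      have := (hYX' _ h0).2
      rw [hh.zero] at this; linarith
    obtain ⟨y, hyX, hyr, hyx, hxy⟩ := hpred x hxY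
    have hwyx : 0 < w s(y, x) := hw _ hyx
    have hyB : h y ≤ r := hyr.resolve_right fun hyY => by
      have := hxmin y hyY
      linarith
    obtain ⟨C0, hC0Y, g, hg, hC0⟩ := exists_distFn hw hxY
    set α := massRoot X * R / 100 with hα
    have hα0 : 0 ≤ α := by positivity
    set ψ : V → ℝ := fun v => if v ∈ C0 then h x + g v - h v else α + 1 with hψ
    have hψ1 : ∀ v ∈ C0, ψ v = h x + g v - h v := fun v hv => if_pos hv
    have hψ2 : ∀ v, v ∉ C0 → ψ v = α + 1 := fun v hv => if_neg hv
    have hψlip : ∀ a ∈ Y, ∀ b ∈ Y, H.Adj a b → |ψ a - ψ b| ≤ 2 * w s(a, b) := by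
      intro a ha b hb hab
      have hpos := hw _ ((SimpleGraph.mem_edgeSet H).2 hab)
      by_cases haC : a ∈ C0
      · have hbC := hC0 a haC b hb hab
        rw [hψ1 a haC, hψ1 b hbC]
        have h1 := abs_le.1 (hg.abs_sub_le a haC b hbC hab)
        have h2 := abs_le.1 (hh.abs_sub_le a (hYX' a ha).1 b (hYX' b hb).1 hab)
        rw [abs_le]; constructor <;> linarith
      · have hbC : b ∉ C0 := fun hbC => haC (hC0 b hbC a ha hab.symm)
        rw [hψ2 a haC, hψ2 b hbC]; simp; linarith
    obtain ⟨ρ, hρ0, hρ1, hcut⟩ := exists_cut_few_bad (w := w) hd hsupp hYne (hlip Y ψ hψlip)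
      hR hRm 0
    have hρα : ρ ≤ α := by
      have := massRoot_mono (fun v hv => (hYX' v hv).1 : Y ⊆ X)
      calc ρ ≤ _ := hρ1
        _ ≤ α := by rw [zero_add, hα]; gcongr
    set C := Y.filter (fun v => ψ v ≤ ρ) with hC
    have hCC0 : ∀ v ∈ C, v ∈ Y ∧ v ∈ C0 ∧ h x + g v - h v ≤ ρ := by
      intro v hv
      obtain ⟨hvY, hvρ⟩ := mem_filter.1 hv
      by_cases hvC : v ∈ C0
      · exact ⟨hvY, hvC, by rwa [hψ1 v hvC] at hvρ⟩
      · rw [hψ2 v hvC] at hvρ; linarith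
    have hCmem : ∀ v ∈ C0, h x + g v - h v ≤ ρ → v ∈ C := fun v hv hle =>
      mem_filter.2 ⟨hC0Y hv, by rwa [hψ1 v hv]⟩
    have hgC : IsDistFn H w C x g := by
      refine ⟨hCmem x hg.mem (by rw [hg.zero]; linarith), hg.zero,
        fun v hv => hg.nonneg v (hCC0 v hv).2.1,
        fun u hu v hv => hg.lip u (hCC0 u hu).2.1 v (hCC0 v hv).2.1, fun v hv hvx => ?_⟩
      obtain ⟨hvY, hv0, hvρ⟩ := hCC0 v hv
      obtain ⟨u, hu, huv, hguv⟩ := hg.pred v hv0 hvx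
      have := hh.lip u (hYX' u (hC0Y hu)).1 v (hYX' v hvY).1 huv
      exact ⟨u, hCmem u hu (by linarith), huv, hguv⟩
    have hCX : C ⊆ X := fun v hv => (hYX' v (hCC0 v hv).1).1
    have hCcard : C.card < X.card := card_lt_card ⟨hCX, fun hXC =>
      hx0Y (hCC0 x0 (hXC hh.mem)).1⟩
    have hxr := (hYX' x hxY).2
    obtain ⟨TC, hTCH, hTCc, hTCw, hTCb⟩ := IH C hCcard x g (R + α - r) hgC (fun v hv => by
      have h1 := (hCC0 v hv).2.2
      have h2 := hhR v (hCX hv)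
      linarith) (by linarith) (by linarith)
    obtain ⟨F', hF'H, hF'c, hF'w, hF'b⟩ := ih (Y.filter (fun v => ρ < ψ v))
      (by
        have h1 := card_filter_add_card_filter_not (s := Y) (fun v => ψ v ≤ ρ)
        simp only [not_le] at h1
        have h2 : 0 < C.card := card_pos.2 ⟨x, hgC.mem⟩
        rw [← hC] at h1
        omega)
      ((filter_subset _ _).trans hYX) (by
        intro v hv
        obtain ⟨hvY, hvρ⟩ := mem_filter.1 hv
        obtain ⟨u, huX, hu, huv, huw⟩ := hpred v hvY
        refine ⟨u, huX, hu.imp_right fun huY => mem_filter.2 ⟨huY, ?_⟩, huv, huw⟩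
        by_contra hcon
        rw [not_lt] at hcon
        obtain ⟨-, hu0, huρ⟩ := hCC0 u (mem_filter.2 ⟨huY, hcon⟩)
        have hv0 := hC0 u hu0 v hvY huv
        have := hg.lip u hu0 v hv0 huv
        rw [hψ1 v hv0] at hvρ
        linarith)
    have hne : x ≠ y := fun hxy' => H.ne_of_adj hyx hxy'.symm
    refine ⟨TC ⊔ F' ⊔ SimpleGraph.edge x y, ?_, ?_, ?_, ?_⟩
    · exact sup_le (sup_le hTCH hF'H) ((SimpleGraph.edge_le_iff H).2 (Or.inr hyx.symm))
    · refine (ncard_edgeSet_sup_edge_le TC F' hne).trans ?_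
      have h1 := card_filter_add_card_filter_not (s := Y) (fun v => ψ v ≤ ρ)
      simp only [not_le] at h1
      rw [← hC] at h1
      omega
    · intro v hv
      by_cases hvC : v ∈ C
      · obtain ⟨p, hp⟩ := hTCw v hvC
        obtain ⟨p', hp'⟩ := hTB y (mem_filter.2 ⟨hyX, hyB⟩)
        have e1 : TC ≤ TB ⊔ (TC ⊔ F' ⊔ SimpleGraph.edge x y) :=
          le_sup_of_le_right (le_sup_of_le_left le_sup_left)
        have e2 : TB ≤ TB ⊔ (TC ⊔ F' ⊔ SimpleGraph.edge x y) := le_sup_left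
        have e3 : (TB ⊔ (TC ⊔ F' ⊔ SimpleGraph.edge x y)).Adj x y :=
          Or.inr (Or.inr (by simp [SimpleGraph.edge_adj, hne]))
        refine ⟨(p.mapLe e1).append (SimpleGraph.Walk.cons e3 (p'.mapLe e2)), ?_⟩
        rw [wlen_append, wlen_cons, wlen_mapLe, wlen_mapLe, Sym2.eq_swap]
        have h1 := (hCC0 v hvC).2.2
        have h2 : massRoot C * (R + α - r) ≤
            massRoot (X.filter (fun v => r < h v)) * (R + α - r) := by
          have := massRoot_mono ((filter_subset _ _).trans hYX :
            C ⊆ X.filter (fun v => r < h v))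
          exact mul_le_mul_of_nonneg_right this (by linarith)
        linarith
      · obtain ⟨p, hp⟩ := hF'w v (mem_filter.2 ⟨hv, by
          by_contra hcon
          exact hvC (mem_filter.2 ⟨hv, not_lt.1 hcon⟩)⟩)
        have e : TB ⊔ F' ≤ TB ⊔ (TC ⊔ F' ⊔ SimpleGraph.edge x y) :=
          sup_le_sup_left (le_sup_of_le_left le_sup_right) _
        exact ⟨p.mapLe e, by rw [wlen_mapLe]; exact hp⟩
    · exact hcut TC F' _ (le_sup_of_le_left le_sup_left) (le_sup_of_le_left le_sup_right)
        (hTCb R) hF'b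

end

section
variable {V : Type*} [Fintype V] {H : SimpleGraph V} {w : Sym2 V → ℝ}

theorem HasFewBad.of_walk_le {d dH : V → V → ℝ} {supp : V → V → Finset V} {T : SimpleGraph V}
    {X : Finset V} {x0 : V} {R Rm : ℝ}
    (hT : ∀ v ∈ X, ∃ p : T.Walk v x0, wlen w p ≤ 2 * R) (h : HasFewBad d dH w supp Rm T X R)
    (R' : ℝ) : HasFewBad d dH w supp Rm T X R' := by
  intro s lam τ hlev A hA
  refine le_trans ?_ (h s lam τ hlev A hA)
  norm_cast
  refine card_le_card fun p hp => ?_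
  obtain ⟨h1, -, h3, h4⟩ := mem_filter.1 hp
  refine mem_filter.2 ⟨h1, ?_, h3, h4⟩
  obtain ⟨p1, hp1⟩ := hT p.1 (hA (mem_product.1 h1).1)
  obtain ⟨p2, hp2⟩ := hT p.2 (hA (mem_product.1 h1).2)
  by_contra hcon
  refine h4 ⟨p1.append p2.reverse, ?_⟩
  rw [wlen_append, wlen_reverse]
  have := hlev.pos
  have : τ * (wlen w p1 + wlen w p2) ≤ τ * (4 * R) := by
    gcongr; linarith
  linarith

theorem hasStarTree_singleton {d dH : V → V → ℝ} (hd : IsPDist d) {supp : V → V → Finset V}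
    {x0 : V} {h : V → ℝ} {R Rm : ℝ} (h0 : h x0 = 0) (hR : 0 < R) :
    HasStarTree H w d dH supp Rm {x0} x0 h R := by
  refine ⟨⊥, bot_le, by simp, fun v hv => ?_, fun R' s lam τ hlev A hA => ?_⟩
  · obtain rfl := mem_singleton.1 hv
    have := massRoot_nonneg ({v} : Finset V)
    exact ⟨SimpleGraph.Walk.nil, by rw [wlen_nil, h0]; positivity⟩
  · have hemp : badPairs d w supp ⊥ τ {x0} A (τ * R') = ∅ := by
      rw [← not_nonempty_iff_eq_empty]
      rintro ⟨⟨a, b⟩, hp⟩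
      obtain ⟨h1, -, -, h4⟩ := mem_filter.1 hp
      have ha : a = x0 := mem_singleton.1 (hA (mem_product.1 h1).1)
      have hb : b = x0 := mem_singleton.1 (hA (mem_product.1 h1).2)
      subst ha hb
      refine h4 ⟨SimpleGraph.Walk.nil, ?_⟩
      simp [hd.self]
    have hs := hlev.s_pos
    have := massRoot_nonneg ({x0} : Finset V)
    rw [hemp]
    simp only [card_empty, Nat.cast_zero]
    positivity

theorem hasStarTree [Nonempty V] (hw : ∀ e ∈ H.edgeSet, 0 < w e) {d dH : V → V → ℝ}
    (hd : IsPDist d) {supp : V → V → Finset V} (hsupp : ∀ u v, u ∈ supp u v ∧ v ∈ supp u v)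
    (hlip : ∀ (Y : Finset V) (f : V → ℝ),
      (∀ a ∈ Y, ∀ b ∈ Y, H.Adj a b → |f a - f b| ≤ 2 * w s(a, b)) →
      ∀ u v, supp u v ⊆ Y → ∀ x ∈ supp u v, ∀ y ∈ supp u v, |f x - f y| ≤ 2 * dH u v)
    {Rm : ℝ} (n : ℕ) : ∀ X : Finset V, X.card < n → ∀ x0 h R, IsDistFn H w X x0 h →
      (∀ v ∈ X, h v ≤ R) → 0 < R → R ≤ Rm → HasStarTree H w d dH supp Rm X x0 h R := by
  induction n with
  | zero => intro X hX; omega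
  | succ n ih =>
  intro X hX x0 h R1 hh hhR1 hR1 hR1m
  by_cases hX1 : X = {x0}
  · subst hX1
    exact hasStarTree_singleton hd hh.zero hR1
  obtain ⟨x1, hx1, hx1max⟩ := exists_max_image X h ⟨x0, hh.mem⟩
  set R := h x1 with hRdef
  have hRR1 : R ≤ R1 := hhR1 x1 hx1
  have hR : 0 < R := by
    obtain ⟨v, hv, hvne⟩ : ∃ v ∈ X, v ≠ x0 := by
      by_contra! hcon
      exact hX1 (eq_singleton_iff_unique_mem.2 ⟨hh.mem, hcon⟩)
    obtain ⟨u, hu, huv, he⟩ := hh.pred v hv hvne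
    have := hx1max v hv
    have := hh.nonneg u hu
    have := hw _ ((SimpleGraph.mem_edgeSet H).2 huv)
    linarith
  have hRm : R ≤ Rm := hRR1.trans hR1m
  have hξ1 := massRoot_le_one X
  have hξ0 := massRoot_nonneg X
  obtain ⟨r, hr1, hr2, hcut⟩ := exists_cut_few_bad hd hsupp ⟨x0, hh.mem⟩ (f := h)
    (hlip X h fun a ha b hb hab => by
      have h1 := hh.lip a ha b hb hab
      have h2 := hh.lip b hb a ha hab.symm
      rw [Sym2.eq_swap] at h2
      have := hw _ ((SimpleGraph.mem_edgeSet H).2 hab)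
      rw [abs_le]; constructor <;> linarith) hR hRm (R / 4) (w := w)
  have hξR : massRoot X * R ≤ 1 * R := by gcongr
  have hr0 : 0 < r := by linarith
  set B := X.filter (fun v => h v ≤ r) with hB
  set S := X.filter (fun v => r < h v) with hS
  have hBX : B.card < X.card := by
    refine card_lt_card ((filter_subset _ _).ssubset_of_ne fun he => ?_)
    have hx1B : x1 ∈ B := by rw [hB, he]; exact hx1
    have := (mem_filter.1 hx1B).2
    linarith
  have hBdist : IsDistFn H w B x0 h :=
    { mem := mem_filter.2 ⟨hh.mem, by rw [hh.zero]; exact hr0.le⟩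
      zero := hh.zero
      nonneg := fun v hv => hh.nonneg v (mem_filter.1 hv).1
      lip := fun u hu v hv => hh.lip u (mem_filter.1 hu).1 v (mem_filter.1 hv).1
      pred := fun v hv hne => by
        obtain ⟨u, hu, huv, he⟩ := hh.pred v (mem_filter.1 hv).1 hne
        have h1 := (mem_filter.1 hv).2
        have := hw _ ((SimpleGraph.mem_edgeSet H).2 huv)
        exact ⟨u, mem_filter.2 ⟨hu, by linarith⟩, huv, he⟩ }
  obtain ⟨TB, hTBH, hTBc, hTBw, hTBb⟩ := ih B (by omega) x0 h r hBdist
    (fun v hv => (mem_filter.1 hv).2) hr0 (by linarith)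
  obtain ⟨F, hFH, hFc, hFw, hFb⟩ := exists_annex_forest hw hd hsupp hlip
    (fun Z hZ x g R => ih Z (by omega) x g R) hh hR hRm hx1max hr1 hr2 hTBw S.card S le_rfl
    subset_rfl (fun v hv => by
      obtain ⟨hvX, hvr⟩ := mem_filter.1 hv
      obtain ⟨u, hu, huv, he⟩ := hh.pred v hvX fun h0 => by rw [h0, hh.zero] at hvr; linarith
      refine ⟨u, hu, ?_, huv, he⟩
      rcases le_or_gt (h u) r with h1 | h1
      · exact Or.inl h1
      · exact Or.inr (mem_filter.2 ⟨hu, h1⟩))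
  have hcard : B.card + S.card = X.card := by
    have := card_filter_add_card_filter_not (s := X) (fun v => h v ≤ r)
    simpa only [not_le] using this
  have hmB0 := massRoot_nonneg B
  have hmS0 := massRoot_nonneg S
  have hmB := massRoot_mono (filter_subset (fun v => h v ≤ r) X)
  have hmS := massRoot_mono (filter_subset (fun v => r < h v) X)
  rw [← hB] at hmB
  rw [← hS] at hmS
  have hrad : massRoot X * R / 100 + massRoot B * r + massRoot S *
      (R + massRoot X * R / 100 - r) ≤ massRoot X * R := by
    have hb : R + massRoot X * R / 100 - r ≤ 101 / 100 * R - r := by linarith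
    have hb0 : 0 ≤ 101 / 100 * R - r := by linarith
    have k1 := mul_le_mul_of_nonneg_left hb hmS0
    rcases le_total B.card S.card with hle | hle
    · have k2 := massRoot_le_of_two_mul_card_le (X := B) (Y := X) (by omega)
      have k3 := mul_le_mul_of_nonneg_right k2 hr0.le
      have k4 := mul_le_mul_of_nonneg_right hmS hb0
      have k5 := mul_le_mul_of_nonneg_left hr1 hξ0
      linarith
    · have k2 := massRoot_le_of_two_mul_card_le (X := S) (Y := X) (by omega)
      have k3 := mul_le_mul_of_nonneg_right hmB hr0.le
      have k4 := mul_le_mul_of_nonneg_right k2 hb0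
      have k5 := mul_le_mul_of_nonneg_left
        (show r ≤ 26 / 100 * R by linarith) hξ0
      nlinarith [mul_nonneg hξ0 hR.le]
  have hTw : ∀ v ∈ X, ∃ p : (TB ⊔ F).Walk v x0, wlen w p ≤ h v + massRoot X * R := by
    intro v hv
    rcases le_or_gt (h v) r with h1 | h1
    · obtain ⟨p, hp⟩ := hTBw v (mem_filter.2 ⟨hv, h1⟩)
      refine ⟨p.mapLe le_sup_left, ?_⟩
      rw [wlen_mapLe]
      have k1 : massRoot B * r ≤ massRoot X * R := by
        gcongr; linarith
      linarith
    · obtain ⟨p, hp⟩ := hFw v (mem_filter.2 ⟨hv, h1⟩)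
      exact ⟨p, by linarith⟩
  refine ⟨TB ⊔ F, sup_le hTBH hFH, ?_, fun v hv => ?_, ?_⟩
  · rw [SimpleGraph.edgeSet_sup]
    have := Set.ncard_union_le TB.edgeSet F.edgeSet
    omega
  · obtain ⟨p, hp⟩ := hTw v hv
    refine ⟨p, hp.trans ?_⟩
    gcongr
  · refine HasFewBad.of_walk_le (x0 := x0) (R := R) (fun v hv => ?_)
      (hcut TB F _ le_sup_left le_sup_right (hTBb R) hFb)
    obtain ⟨p, hp⟩ := hTw v hv
    have := hx1max v hv
    exact ⟨p, by linarith⟩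

end

section
variable {V : Type*} [Fintype V]

theorem isLevel_of_scaling {d dH : V → V → ℝ} {M : ℝ}
    (hd : ∀ ℓ D, 2 ≤ ℓ → 0 < D → ∀ u v, d u v ≤ D →
        (D * (4 * ℓ ^ 2) ≤ M →
          (2 : ℝ) ^ (-(ℓ + 2)) * Fintype.card V ≤ ((pball d u D).card : ℝ) →
          (2 : ℝ) ^ (-(ℓ + 2)) * Fintype.card V ≤ ((pball d v D).card : ℝ) →
          dH u v ≤ 40000 * ℓ ^ 2 * √(√ℓ) * D) ∧
        (∀ L, 0 < L → L ≤ 2 * ℓ → D * (1536 * ℓ * √ℓ * (2 : ℝ) ^ L) ≤ M →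
          (2 : ℝ) ^ (-L) * Fintype.card V ≤ ((pball d u D).card : ℝ) →
          (2 : ℝ) ^ (-L) * Fintype.card V ≤ ((pball d v D).card : ℝ) →
          dH u v ≤ 40000 * ℓ ^ 2 * D))
    {ε : ℝ} (hε0 : 0 < ε) (hε1 : ε < 1) {ℓ : ℝ} (hℓ : ℓ = 1 + Real.logb 2 (2 / ε)) :
    IsLevel d dH M (√ε) (√(√ℓ)) (√ε / (10 ^ 17 * ℓ ^ 2)) := by
  have hpow : (2 : ℝ) ^ (ℓ - 1) = 2 / ε := by
    rw [hℓ, add_sub_cancel_left, Real.rpow_logb (by norm_num) (by norm_num) (by positivity)]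
  have hℓ2 : 2 ≤ ℓ := by
    have : 1 ≤ Real.logb 2 (2 / ε) := by
      rw [Real.le_logb_iff_rpow_le (by norm_num) (by positivity), Real.rpow_one,
        le_div_iff₀ hε0]
      linarith
    linarith
  have hℓε : ℓ ≤ 2 / ε := by
    have := one_add_mul_self_le_rpow_one_add (s := 1) (by norm_num) (p := ℓ - 1) (by linarith)
    norm_num at this
    linarith
  have hℓ0 : 0 < ℓ := by linarith
  have hs0 : 0 < √ε := Real.sqrt_pos.2 hε0
  have hs2 : √ε ^ 2 = ε := Real.sq_sqrt hε0.le
  have hr0 : 0 < √ℓ := Real.sqrt_pos.2 hℓ0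
  have hr2 : √ℓ ^ 2 = ℓ := Real.sq_sqrt hℓ0.le
  have hr1 : 1 ≤ √ℓ := Real.one_le_sqrt.2 (by linarith)
  have hlam0 : 0 < √(√ℓ) := Real.sqrt_pos.2 hr0
  have hlam2 : √(√ℓ) ^ 2 = √ℓ := Real.sq_sqrt hr0.le
  have hτ : 0 < √ε / (10 ^ 17 * ℓ ^ 2) := by positivity
  have hs1 : √ε ≤ 1 := Real.sqrt_le_one.2 hε1.le
  refine ⟨hs0, Real.one_le_sqrt.2 hr1, ?_, hτ, fun R hR hRm u v huv h1 h2 => ?_,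
    fun R hR hRm u v huv h1 h2 => ?_⟩
  · rw [hs2, show √(√ℓ) ^ 4 = (√(√ℓ) ^ 2) ^ 2 by ring, hlam2, hr2]
    rwa [le_div_iff₀ hε0, mul_comm] at hℓε
  · have he : (2 : ℝ) ^ (-(ℓ + 2)) = √ε ^ 2 / 16 := by
      rw [hs2, show -(ℓ + 2) = -(ℓ - 1) + -3 by ring, Real.rpow_add (by norm_num),
        Real.rpow_neg (by norm_num), hpow]
      norm_num
      ring
    have key := (hd ℓ _ hℓ2 (mul_pos hτ hR) u v huv).1 (by
      calc √ε / (10 ^ 17 * ℓ ^ 2) * R * (4 * ℓ ^ 2) = √ε * R * (4 / 10 ^ 17) := by field_simp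
        _ ≤ 1 * R * 1 := by gcongr; norm_num
        _ ≤ M := by linarith) (by rwa [he]) (by rwa [he])
    have e : 40000 * ℓ ^ 2 * √(√ℓ) * (√ε / (10 ^ 17 * ℓ ^ 2) * R) =
        4 / 10 ^ 13 * (√ε * √(√ℓ) * R) := by field_simp; norm_num
    rw [e] at key
    have : 0 < √ε * √(√ℓ) * R := by positivity
    linarith
  · have hx0 : 0 < √ℓ / √ε := by positivity
    have hpL : (2 : ℝ) ^ Real.logb 2 (√ℓ / √ε) = √ℓ / √ε :=
      Real.rpow_logb (by norm_num) (by norm_num) hx0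
    have hpL' : (2 : ℝ) ^ (-Real.logb 2 (√ℓ / √ε)) = √ε / √(√ℓ) ^ 2 := by
      rw [Real.rpow_neg (by norm_num), hpL, inv_div, hlam2]
    have key := (hd ℓ _ hℓ2 (mul_pos hτ hR) u v huv).2 (Real.logb 2 (√ℓ / √ε))
      (Real.logb_pos (by norm_num) (by
        rw [lt_div_iff₀ hs0]
        have : √ε < √ℓ := Real.sqrt_lt_sqrt hε0.le (by linarith)
        linarith))
      (by
        rw [Real.logb_le_iff_le_rpow (by norm_num) hx0]
        have h3 : √ℓ ≤ 2 / ε := le_trans (by nlinarith) hℓε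
        have h4 : 1 / √ε ≤ 2 / ε := by
          rw [div_le_div_iff₀ hs0 hε0]; nlinarith
        calc √ℓ / √ε = √ℓ * (1 / √ε) := by ring
          _ ≤ 2 / ε * (2 / ε) := by gcongr
          _ = (2 : ℝ) ^ (ℓ - 1 + (ℓ - 1)) := by rw [Real.rpow_add (by norm_num), hpow]
          _ ≤ (2 : ℝ) ^ (2 * ℓ) := Real.rpow_le_rpow_of_exponent_le (by norm_num) (by linarith))
      (by
        rw [hpL]
        calc √ε / (10 ^ 17 * ℓ ^ 2) * R * (1536 * ℓ * √ℓ * (√ℓ / √ε))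
            = 1536 / 10 ^ 17 * R * (√ℓ ^ 2 / ℓ) := by field_simp
          _ ≤ 1 * R * (√ℓ ^ 2 / ℓ) := by gcongr; norm_num
          _ = R := by rw [hr2]; field_simp
          _ ≤ M := hRm)
      (by rwa [hpL']) (by rwa [hpL'])
    have e : 40000 * ℓ ^ 2 * (√ε / (10 ^ 17 * ℓ ^ 2) * R) =
        4 / 10 ^ 13 * (√ε * R) := by field_simp; norm_num
    rw [e] at key
    have : 0 < √ε * R := by positivity
    linarith

end

section
variable {V : Type*} [Fintype V] {G : SimpleGraph V} {w : Sym2 V → ℝ}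

theorem isTree_of_ncard_le {T : SimpleGraph V} (hT : T.Connected)
    (h : T.edgeSet.ncard + 1 ≤ Fintype.card V) : T.IsTree := by
  rw [SimpleGraph.isTree_iff_connected_and_card]
  refine ⟨hT, le_antisymm ?_ ?_⟩
  · rwa [Nat.card_coe_set_eq, Nat.card_eq_fintype_card]
  · exact hT.card_vert_le_card_edgeSet_add_one

theorem exists_mst (hG : G.Connected) :
    ∃ T, IsSpanningTree G T ∧ wWeight T w = mstWeight G w := by
  have hfin : {x : ℝ | ∃ T : SimpleGraph V, IsSpanningTree G T ∧ x = wWeight T w}.Finite := by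
    refine (Set.toFinite (Set.range fun T : SimpleGraph V => wWeight T w)).subset ?_
    rintro _ ⟨T, -, rfl⟩
    exact ⟨T, rfl⟩
  obtain ⟨T0, hT0, hT0'⟩ := hG.exists_isTree_le
  have hne : {x : ℝ | ∃ T : SimpleGraph V, IsSpanningTree G T ∧ x = wWeight T w}.Nonempty :=
    ⟨_, T0, ⟨hT0, hT0'⟩, rfl⟩
  obtain ⟨T, hT, h⟩ := hne.csInf_mem hfin
  exact ⟨T, hT, h.symm⟩

theorem hasScalingDistortion_of_card_le_one {T : SimpleGraph V} (h : Fintype.card V ≤ 1)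
    (γ : ℝ → ℝ) : HasScalingDistortion G T w γ := by
  intro ε _ _
  have : (Fintype.card V : ℝ) * ((Fintype.card V : ℝ) - 1) = 0 := by
    interval_cases Fintype.card V <;> simp
  rw [this, mul_zero]
  positivity

theorem exists_tree_of_connected (hG : G.Connected) (hw : ∀ e ∈ G.edgeSet, 0 < w e)
    {T0 : SimpleGraph V} (hT0 : T0 ≤ G) (hT0c : T0.Connected) (hM : 0 < wWeight T0 w) :
    ∃ T, IsSpanningTree G T ∧ wWeight T w ≤ 3265 * wWeight T0 w ∧
      HasScalingDistortion G T w
        (fun ε => 4 * 10 ^ 17 * (1 / √ε) * (1 + Real.logb 2 (2 / ε)) ^ 2) := by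
  obtain ⟨x⟩ := hG.nonempty
  have : Nonempty V := ⟨x⟩
  obtain ⟨H, hHG, hHc, hHw, hHM, hHd⟩ := exists_light_spanner hG hw hT0 hT0c hM
  have hwH : ∀ e ∈ H.edgeSet, 0 < w e := fun e he => hw e (SimpleGraph.edgeSet_mono hHG he)
  have hd := isPDist_wdist hG hw
  choose P _ hPw using fun u v => exists_path_wlen_eq hwH (hHc.preconnected u v)
  obtain ⟨X, -, h, hh, hX⟩ := exists_distFn hwH (mem_univ x)
  have hreach : ∀ v, v ∈ X ∧ h v ≤ wWeight T0 w := fun v => by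
    have := hh.le_add_wlen hX (P x v) (fun _ _ => mem_univ _) hh.mem
    rw [hh.zero, hPw, zero_add] at this
    exact ⟨this.1, this.2.trans (hHM x v)⟩
  obtain rfl : X = univ := eq_univ_iff_forall.2 fun v => (hreach v).1
  obtain ⟨T, hTH, hTc, hTw, hTb⟩ := hasStarTree hwH hd (dH := wdist H w)
    (supp := fun u v => (P u v).support.toFinset) (fun u v => by simp)
    (fun Y f hf u v hY x hx y hy => by
      rw [List.mem_toFinset] at hx hy
      rw [← hPw u v]
      exact abs_sub_le_two_mul_wlen hwH hf (P u v)
        (fun a ha => hY (List.mem_toFinset.2 ha)) x hx y hy)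
    (Rm := wWeight T0 w) _ univ (Nat.lt_succ_self _) x h _ hh (fun v _ => (hreach v).2) hM le_rfl
  have hTcon : T.Connected := by
    refine ⟨fun u v => ?_⟩
    obtain ⟨p, -⟩ := hTw u (mem_univ u)
    obtain ⟨q, -⟩ := hTw v (mem_univ v)
    exact ⟨p.append q.reverse⟩
  have hwT : ∀ e ∈ T.edgeSet, 0 < w e := fun e he => hwH e (SimpleGraph.edgeSet_mono hTH he)
  refine ⟨T, ⟨hTH.trans hHG, isTree_of_ncard_le hTcon hTc⟩, (wWeight_mono hTH hwH).trans hHw,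
    ?_⟩
  rcases le_or_gt (Fintype.card V) 1 with hn | hn
  · exact hasScalingDistortion_of_card_le_one hn _
  intro ε hε0 hε1
  have hlev := isLevel_of_scaling hHd hε0 hε1 rfl
  set ℓ := 1 + Real.logb 2 (2 / ε) with hℓ
  have hτ := hlev.pos
  set τ := √ε / (10 ^ 17 * ℓ ^ 2) with hτdef
  have hbad := hTb (wWeight T0 w / τ) _ _ _ hlev univ (subset_univ _)
  rw [mul_div_cancel₀ _ hτ.ne', Real.sq_sqrt hε0.le, card_univ] at hbad
  have hm : massRoot (univ : Finset V) ^ 9 ≤ 1 :=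
    pow_le_one₀ (massRoot_nonneg _) (massRoot_le_one _)
  set N : ℝ := (Fintype.card V : ℝ) with hN
  have hN2 : (2 : ℝ) ≤ N := by rw [hN]; exact_mod_cast hn
  have hsub : (univ : Finset V).offDiag ⊆
      goodPairs G T w (4 * 10 ^ 17 * (1 / √ε) * ℓ ^ 2) ∪ badPairs (wdist G w) w
        (fun u v => (P u v).support.toFinset) T τ univ univ (wWeight T0 w) := by
    intro p hp
    by_cases hq : ∃ q : T.Walk p.1 p.2, τ * wlen w q ≤ 4 * wdist G w p.1 p.2
    · obtain ⟨q, hq⟩ := hq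
      refine mem_union_left _ (mem_filter.2 ⟨hp, (wdist_le_wlen hwT q).trans ?_⟩)
      have e : 4 * 10 ^ 17 * (1 / √ε) * ℓ ^ 2 = 4 / τ := by
        rw [hτdef]; field_simp
      rw [e, div_mul_eq_mul_div, le_div_iff₀ hτ]
      linarith
    · exact mem_union_right _ (mem_filter.2 ⟨by simp,
        (wdist_anti hHG hw (hHc.preconnected _ _)).trans (hHM _ _), subset_univ _, hq⟩)
  have hcard := (card_le_card hsub).trans (card_union_le _ _)
  rw [offDiag_card, card_univ] at hcard
  have hcard' : N * N - N ≤ ((goodPairs G T w (4 * 10 ^ 17 * (1 / √ε) * ℓ ^ 2)).card : ℝ) +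
      (badPairs (wdist G w) w (fun u v => (P u v).support.toFinset) T τ univ univ
        (wWeight T0 w)).card := by
    rw [Nat.sub_le_iff_le_add] at hcard
    have := (Nat.cast_le (α := ℝ)).2 hcard
    push_cast at this
    linarith
  have k1 := mul_le_mul_of_nonneg_left hm (show 0 ≤ ε / 4 * N ^ 2 by positivity)
  have k2 : ε * N * 2 ≤ ε * N * N := by gcongr
  show (1 - ε) * (N * (N - 1)) ≤ _
  linarith

theorem exists_light_tree (hG : IsWeightedGraph G w) {ρ : ℝ} (hρ0 : 0 < ρ) (hρ1 : ρ < 1) :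
    ∃ T, IsSpanningTree G T ∧ wWeight T w / mstWeight G w ≤ 1 + ρ ∧
      HasScalingDistortion G T w
        (fun ε => 3265 * (4 * 10 ^ 17) / ρ * (1 / √ε) * (1 + Real.logb 2 (2 / ε)) ^ 2) := by
  obtain ⟨hGc, hw, -⟩ := hG
  obtain ⟨T0, hT0, hT0w⟩ := exists_mst (w := w) hGc
  have hwT0 : ∀ e ∈ T0.edgeSet, 0 < w e := fun e he => hw e (SimpleGraph.edgeSet_mono hT0.1 he)
  rcases (wWeight_nonneg hwT0).eq_or_lt with hM | hM
  · refine ⟨T0, hT0, by rw [← hT0w, ← hM]; simp; linarith, hasScalingDistortion_of_card_le_one ?_ _⟩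
    refine Fintype.card_le_one_iff.2 fun a b => ?_
    by_contra hab
    obtain ⟨c, hc⟩ : ∃ c, T0.Adj a c := by
      obtain ⟨p⟩ := hT0.2.connected.preconnected a b
      cases p with
      | nil => exact absurd rfl hab
      | cons h _ => exact ⟨_, h⟩
    have h1 := hwT0 _ ((SimpleGraph.mem_edgeSet T0).2 hc)
    have h2 : w s(a, c) ≤ wWeight T0 w := single_le_sum (f := w)
      (fun e he => (hwT0 e ((Set.Finite.mem_toFinset _).1 he)).le)
      ((Set.Finite.mem_toFinset _).2 ((SimpleGraph.mem_edgeSet T0).2 hc))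
    linarith
  set w' : Sym2 V → ℝ := fun e => if e ∈ T0.edgeSet then w e else 3265 / ρ * w e with hw'def
  have hρ' : 1 ≤ 3265 / ρ := by rw [le_div_iff₀ hρ0]; linarith
  have hww' : ∀ e ∈ G.edgeSet, w e ≤ w' e ∧ w' e ≤ 3265 / ρ * w e := fun e he => by
    have h1 := hw e he
    have h2 := mul_le_mul_of_nonneg_right hρ' h1.le
    simp only [hw'def]
    split_ifs <;> constructor <;> linarith
  have hw' : ∀ e ∈ G.edgeSet, 0 < w' e := fun e he => (hw e he).trans_le (hww' e he).1
  have hT0w' : wWeight T0 w' = wWeight T0 w :=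
    sum_congr rfl fun e he => if_pos ((Set.Finite.mem_toFinset _).1 he)
  obtain ⟨T, hT, hTw, hTs⟩ := exists_tree_of_connected hGc hw' hT0.1 hT0.2.connected
    (by rwa [hT0w'])
  have hwT : ∀ e ∈ T.edgeSet, 0 < w e := fun e he => hw e (SimpleGraph.edgeSet_mono hT.1 he)
  refine ⟨T, hT, ?_, fun ε hε0 hε1 => (hTs ε hε0 hε1).trans ?_⟩
  · rw [← hT0w, div_le_iff₀ hM]
    have key : wWeight T w ≤ wWeight T0 w + ρ / 3265 * wWeight T w' := by
      have h1 : ∑ e ∈ T.edgeSet.toFinite.toFinset, (if e ∈ T0.edgeSet then w e else 0) ≤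
          wWeight T0 w := by
        rw [← sum_filter]
        refine sum_le_sum_of_subset_of_nonneg (fun e he => ?_) fun e he _ =>
          (hwT0 e ((Set.Finite.mem_toFinset _).1 he)).le
        exact (Set.Finite.mem_toFinset _).2 (mem_filter.1 he).2
      refine le_trans ?_ (add_le_add_left h1 _)
      rw [wWeight, wWeight, mul_sum, ← sum_add_distrib]
      refine sum_le_sum fun e he => ?_
      have h2 := hwT e ((Set.Finite.mem_toFinset _).1 he)
      simp only [hw'def]
      split_ifs
      · have : 0 < ρ / 3265 * w e := by positivity
        linarith
      · refine le_of_eq ?_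
        field_simp
        simp
    have : ρ / 3265 * wWeight T w' ≤ ρ / 3265 * (3265 * wWeight T0 w) := by
      rw [← hT0w']; gcongr
    linarith
  · refine Nat.cast_le.2 (card_le_card fun p hp => ?_)
    obtain ⟨h1, h2⟩ := mem_filter.1 hp
    refine mem_filter.2 ⟨h1, ?_⟩
    have h3 : wdist T w p.1 p.2 ≤ wdist T w' p.1 p.2 :=
      wdist_mono_weight hwT (fun e he => (hww' e (SimpleGraph.edgeSet_mono hT.1 he)).1)
        (hT.2.connected.preconnected _ _)
    have h4 : wdist G w' p.1 p.2 ≤ 3265 / ρ * wdist G w p.1 p.2 := by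
      obtain ⟨q, -, hq⟩ := exists_path_wlen_eq hw (hGc.preconnected p.1 p.2)
      rw [← hq, wlen, ← List.sum_map_mul_left]
      refine (wdist_le_wlen hw' q).trans (List.sum_le_sum fun e he => ?_)
      exact (hww' e (q.edges_subset_edgeSet he)).2
    refine h3.trans (h2.trans ((mul_le_mul_of_nonneg_left h4 (by positivity)).trans (le_of_eq ?_)))
    field_simp

end

/-- There is a universal constant `C > 0` such that every weighted graph
`G` and every `0 < ρ < 1` admit a spanning tree `T` of lightness at most `1 + ρ` with
scaling distortion `γ(ε) = (C/ρ) · ε^{-1/2} · (1 + log(2/ε))²`. -/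
theorem stmt0 :
    ∃ C : ℝ, 0 < C ∧
      ∀ (V : Type) [Fintype V] (G : SimpleGraph V) (w : Sym2 V → ℝ),
        IsWeightedGraph G w →
        ∀ ρ : ℝ, 0 < ρ → ρ < 1 →
          ∃ T : SimpleGraph V, IsSpanningTree G T ∧
            wWeight T w / mstWeight G w ≤ 1 + ρ ∧
            HasScalingDistortion G T w
              (fun ε => (C / ρ) * (1 / Real.sqrt ε) * (1 + Real.logb 2 (2 / ε)) ^ 2) :=
  ⟨3265 * (4 * 10 ^ 17), by norm_num, fun _ _ _ _ hG _ hρ0 hρ1 => exists_light_tree hG hρ0 hρ1⟩
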